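/- Lemma 2.1: For each k = 2,…,n choose S̃_k to be either the vectorized Lusin square function 𝐒_k^L or the vectorized random dyadic square function 𝐒_k in the variable x_k (the choice may differ for different k), with target Hilbert space H̃_k, and set H̃¹ := H̃₂⊗…⊗H̃ₙ. Then there is a constant C, independent of f, such that ∫_X ‖(𝐒₁ ⊗ S̃₂ ⊗ … ⊗ S̃ₙ f)(x)‖_{H'₁⊗H̃¹} dx ≤ C ∫_X ‖(𝐒₁^L ⊗ S̃₂ ⊗ … ⊗ S̃ₙ f)(x)‖_{H₁⊗H̃¹} dx for every f ∈ L¹(X) for which the right-hand side is finite. -/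

import Mathlib

open MeasureTheory Filter Topology
open scoped ENNReal

noncomputable section

namespace Treil

/-- The cube of sidelength `2^k` of the dyadic lattice `t + 𝒟₀` that contains `x`. -/
def dcube {N : ℕ} (t : Fin N → ℝ) (k : ℤ) (x : Fin N → ℝ) : Set (Fin N → ℝ) :=
  {y | ∀ i, ⌊(y i - t i) / (2 : ℝ) ^ k⌋ = ⌊(x i - t i) / (2 : ℝ) ^ k⌋}

/-- The averaging operator `E_k` over the cubes of sidelength `2^k` of the (generalized)
dyadic lattice whose layer at scale `2^k` has offset `c k`. -/
def avg {N : ℕ} (c : ℤ → Fin N → ℝ) (k : ℤ) (f : (Fin N → ℝ) → ℝ) (x : Fin N → ℝ) : ℝ :=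
  (∫ y in dcube (c k) k x, f y) / ((2 : ℝ) ^ k) ^ (N : ℕ)

/-- The martingale difference `Δ_k = E_{k-1} - E_k`. -/
def mdiff {N : ℕ} (c : ℤ → Fin N → ℝ) (k : ℤ) (f : (Fin N → ℝ) → ℝ) (x : Fin N → ℝ) : ℝ :=
  avg c (k - 1) f x - avg c k f x

/-- The square of the dyadic square function, `|S_𝒟 f (x)|² = ∑_k |Δ_k f (x)|²`,
with values in `[0,∞]`. -/
def Ssq {N : ℕ} (c : ℤ → Fin N → ℝ) (f : (Fin N → ℝ) → ℝ) (x : Fin N → ℝ) : ℝ≥0∞ :=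
  ∑' k : ℤ, ENNReal.ofReal ((mdiff c k f x) ^ 2)

/-- The offset (at scale `2^k`) of the random dyadic lattice on `ℝ` built from the uniform
shift `u ∈ [0,1)` and the fair signs `ξ_j`, `j ≥ 1`, encoded as the binary digits of
`v ∈ [0,1)` (`ξ_j = -1` iff `⌊v 2^j⌋` is odd); the interval `I_0 = [u-1, u)` belongs to the
lattice, and `I_k` is obtained from `I_{k-1}` by adjoining the right neighbour if `ξ_k = +1`
and the left neighbour if `ξ_k = -1`. -/
def randOffset1 (u v : ℝ) (k : ℤ) : ℝ :=
  u - 1 - ∑ j ∈ Finset.range k.toNat, (if ⌊v * 2 ^ (j + 1)⌋ % 2 = 1 then (2 : ℝ) ^ j else 0)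

/-- The sample space for the random dyadic lattice in `ℝ^N`: each of the `N` independent
coordinate lattices is driven by a pair (uniform shift, digit-encoded fair signs). -/
abbrev RSpace (N : ℕ) := Fin N → ℝ × ℝ

/-- The probability measure of the random dyadic lattice in `ℝ^N`. -/
def randMeasure (N : ℕ) : Measure (RSpace N) :=
  Measure.pi fun _ =>
    (volume.restrict (Set.Ico (0 : ℝ) 1)).prod (volume.restrict (Set.Ico (0 : ℝ) 1))

/-- The per-scale offsets of the random dyadic lattice `𝒟(ω)` in `ℝ^N`. -/
def randOffset {N : ℕ} (ω : RSpace N) (k : ℤ) : Fin N → ℝ :=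
  fun i => randOffset1 (ω i).1 (ω i).2 k

/-- An (axis-parallel, half-open) cube in `ℝ^N`. -/
def IsPCube {N : ℕ} (Q : Set (Fin N → ℝ)) : Prop :=
  ∃ (a : Fin N → ℝ) (l : ℝ), 0 < l ∧ Q = Set.univ.pi fun i => Set.Ico (a i) (a i + l)

/-- An `H¹`-atom: supported in a cube `Q`, bounded by `|Q|⁻¹`, with zero mean. -/
def IsAtom {N : ℕ} (a : (Fin N → ℝ) → ℝ) : Prop :=
  ∃ Q : Set (Fin N → ℝ), IsPCube Q ∧ (∀ x, x ∉ Q → a x = 0) ∧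
    (∀ x, |a x| ≤ ((volume Q).toReal)⁻¹) ∧ (∫ x, a x) = 0

/-- The atomic `H¹(ℝ^N)` norm: the infimum of `∑ |λ_j|` over all decompositions
`f = ∑ λ_j a_j` converging in `L¹`, with atoms `a_j`. -/
def H1norm {N : ℕ} (f : (Fin N → ℝ) → ℝ) : ℝ≥0∞ :=
  ⨅ (lam : ℕ → ℝ) (a : ℕ → (Fin N → ℝ) → ℝ) (_ : ∀ j, IsAtom (a j))
    (_ : Tendsto (fun m => ∫ x, |f x - ∑ j ∈ Finset.range m, lam j * a j x|) atTop (𝓝 0)),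
    ∑' j, ENNReal.ofReal |lam j|
/-! ### Multi-parameter setting: `X = X₁ × ⋯ × Xₙ`, `X_j = ℝ^{N_j}` -/

variable (n : ℕ) (Nd : Fin n → ℕ)

/-- The product space `X = X₁ × X₂ × ⋯ × Xₙ`, `X_j = ℝ^{N_j}`. -/
abbrev X := Π j : Fin n, (Fin (Nd j) → ℝ)

/-- The averaging operator `E_𝐤 = E¹_{k₁} ⋯ Eⁿ_{kₙ}` over the "rectangles"
`R = Q₁ × ⋯ × Qₙ` of the product lattice with per-variable, per-scale offsets `c`. -/
def ravg (c : Π j : Fin n, ℤ → Fin (Nd j) → ℝ) (k : Fin n → ℤ) (f : X n Nd → ℝ)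
    (x : X n Nd) : ℝ :=
  (∫ y in Set.univ.pi fun j => dcube (c j (k j)) (k j) (x j), f y) /
    ∏ j, ((2 : ℝ) ^ (k j)) ^ (Nd j : ℕ)

/-- The multi-parameter martingale difference
`Δ_𝐤 = Δ¹_{k₁} ⋯ Δⁿ_{kₙ} = ∏_j (E^j_{k_j - 1} - E^j_{k_j})`, expanded by multilinearity. -/
def rmdiff (c : Π j : Fin n, ℤ → Fin (Nd j) → ℝ) (k : Fin n → ℤ) (f : X n Nd → ℝ)
    (x : X n Nd) : ℝ :=
  ∑ ε : Fin n → Bool,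
    (-1 : ℝ) ^ (Finset.univ.filter fun j => ε j = false).card *
      ravg n Nd c (fun j => k j - if ε j then 1 else 0) f x

/-- The square of the multi-parameter dyadic square function,
`|S_𝒟 f (x)|² = ∑_{R ∋ x} |Δ_R f (x)|² = ∑_{𝐤 ∈ ℤⁿ} |Δ_𝐤 f (x)|²`. -/
def rSsq (c : Π j : Fin n, ℤ → Fin (Nd j) → ℝ) (f : X n Nd → ℝ) (x : X n Nd) : ℝ≥0∞ :=
  ∑' k : Fin n → ℤ, ENNReal.ofReal ((rmdiff n Nd c k f x) ^ 2)

/-- The sample space of the random product dyadic lattice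
`𝒟(ω) = 𝒟₁(ω) × ⋯ × 𝒟ₙ(ω)`. -/
abbrev PSpace := Π j : Fin n, RSpace (Nd j)

instance randMeasure.instSigmaFinite (M : ℕ) : SigmaFinite (randMeasure M) := by
  unfold randMeasure; infer_instance

/-- The probability measure of the random product dyadic lattice (the `n` factors are
independent). -/
def prodRandMeasure : Measure (PSpace n Nd) := Measure.pi fun j => randMeasure (Nd j)

/-- The quantity `∫_X [𝔼_ω |S_{𝒟(ω)} f (x)|²]^{1/2} dx` for the multi-parameter random
dyadic square function. -/
def randProdSNorm (f : X n Nd → ℝ) : ℝ≥0∞ :=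
  ∫⁻ x, (∫⁻ ω, rSsq n Nd (fun j => randOffset (ω j)) f x ∂prodRandMeasure n Nd) ^ (1 / 2 : ℝ)

/-! ### The product (Chang–Fefferman) Hardy space `H¹(X₁ × ⋯ × Xₙ)` -/

/-- The upper half-space variables `((y₁,t₁),…,(yₙ,tₙ))`. -/
abbrev W := Π j : Fin n, ((Fin (Nd j) → ℝ) × ℝ)

/-- The Poisson kernel of the upper half-space `ℝ^{M+1}_+`. -/
def pk (M : ℕ) (y : Fin M → ℝ) (t : ℝ) : ℝ :=
  (Real.Gamma (((M : ℝ) + 1) / 2) / Real.pi ^ (((M : ℝ) + 1) / 2)) * t /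
    ((∑ i, y i ^ 2) + t ^ 2) ^ (((M : ℝ) + 1) / 2)

/-- The extension of `f` to `ℝ^{N₁+1}_+ × ⋯ × ℝ^{Nₙ+1}_+` obtained by applying the Poisson
(harmonic) extension in each variable. -/
def prodPoisson (f : X n Nd → ℝ) (p : W n Nd) : ℝ :=
  ∫ z, f z * ∏ j, pk (Nd j) ((p j).1 - z j) (p j).2

/-- The coordinate direction `i` in the `j`-th half-space factor (`i = N_j` is the
`t_j`-direction). -/
def dirW (j : Fin n) (i : Fin (Nd j + 1)) : W n Nd :=
  Pi.single j (if h : (i : ℕ) < Nd j then (Pi.single (⟨i, h⟩ : Fin (Nd j)) 1, 0) else (0, 1))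

/-- `|∇₁ ∇₂ ⋯ ∇ₙ u (p)|²`: the sum over all choices of one coordinate direction in each
half-space factor of the square of the corresponding mixed partial derivative. -/
def mixedGradSq (u : W n Nd → ℝ) (p : W n Nd) : ℝ :=
  ∑ d : Π j : Fin n, Fin (Nd j + 1),
    (iteratedFDeriv ℝ n u p fun j => dirW n Nd j (d j)) ^ 2

/-- The product cone `Γ_{x₁} × ⋯ × Γ_{xₙ}`, `Γ_{x_j} = {(y,t) : |y - x_j| < t}`. -/
def prodCone (x : X n Nd) : Set (W n Nd) :=
  {p | ∀ j, Real.sqrt (∑ i, ((p j).1 i - x j i) ^ 2) < (p j).2}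

/-- The square of the product Lusin square function `S⃗^L f`. -/
def lusinSq (f : X n Nd → ℝ) (x : X n Nd) : ℝ≥0∞ :=
  ∫⁻ p in prodCone n Nd x,
    ENNReal.ofReal (mixedGradSq n Nd (prodPoisson n Nd f) p *
      ∏ j, (p j).2 ^ (1 - (Nd j : ℝ)))

/-- The norm of the multi-parameter (product) Hardy space `H¹(X₁ × ⋯ × Xₙ)` of
Chang–Fefferman: `‖f‖ = ‖S⃗^L f‖_{L¹(X)}`. -/
def H1prodNorm (f : X n Nd → ℝ) : ℝ≥0∞ :=
  ∫⁻ x, (lusinSq n Nd f x) ^ (1 / 2 : ℝ)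
/-! ### Vectorized tensor-product square functions

For each variable `x_j` we consider the "vectorized" square functions: the random dyadic one
`𝐒_j f (x) = ((m, ω_j) ↦ Δ_m^{𝒟_j(ω_j)} f(x))`, indexed by `ℤ × Ω_j`, and the Lusin one
`𝐒_j^L f (x) = ((y,t) ↦ t^{(1-N_j)/2} ∇u(x_j + y, t))`, indexed by the cone
`Γ_j = {|y| < t}` and the gradient coordinate. A tensor product of such square functions,
taken in distinct variables, is obtained by applying the indexed scalar components
successively in the respective variables; the norm of the resulting Hilbert-space
(`L²` over the product of the index spaces) valued function is computed by integrating the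
square of the composed scalar component over all the indices.

An index for the `j`-th variable: either a dyadic index `(m, ω) ∈ ℤ × Ω` or a Lusin index
`((y, t), d)` with `(y,t)` in the half-space and `d` a gradient coordinate (`d = N_j` being
the `t`-direction). The isometric target Hilbert spaces `H'_j = L²(ℤ × Ω_j)` and
`H_j = L²(Γ_j; ℂ^{N_j+1})` are realized as `L²` over the two summands. -/
abbrev Idx (M : ℕ) := (ℤ × RSpace M) ⊕ (((Fin M → ℝ) × ℝ) × Fin (M + 1))

/-- The scalar component, with index `ι`, of the vectorized square function in the `j`-th
variable, applied (in the variable `x_j` only) to `f : X → ℝ`: for a dyadic index `(m, ω)`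
it is the martingale difference `Δ_m^{𝒟_j(ω)}`, and for a Lusin index `((y,t), d)` it is
`t^{(1-N_j)/2} ∂_d P_j f (x_j + y, t)`, where `P_j` is the Poisson extension in the `j`-th
variable. -/
def opComp (n : ℕ) (Nd : Fin n → ℕ) (j : Fin n) (ι : Idx (Nd j)) (f : X n Nd → ℝ)
    (x : X n Nd) : ℝ :=
  match ι with
  | Sum.inl (m, ω) =>
      mdiff (randOffset ω) m (fun z => f (Function.update x j z)) (x j)
  | Sum.inr (q, d) =>
      q.2 ^ ((1 - (Nd j : ℝ)) / 2) *
        fderiv ℝ (fun w : (Fin (Nd j) → ℝ) × ℝ =>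
            ∫ z : Fin (Nd j) → ℝ, f (Function.update x j z) * pk (Nd j) (w.1 - z) w.2)
          (x j + q.1, q.2)
          (if h : (d : ℕ) < Nd j then (Pi.single (⟨d, h⟩ : Fin (Nd j)) 1, 0) else (0, 1))

/-- The measure on the dyadic index summand: counting measure on scales times the law of the
random lattice. -/
def dyadIdxMeas (M : ℕ) : Measure (Idx M) :=
  ((Measure.count : Measure ℤ).prod (randMeasure M)).map Sum.inl

/-- The cone `Γ = {(y,t) : |y| < t}`. -/
def coneSet (M : ℕ) : Set ((Fin M → ℝ) × ℝ) :=
  {q | Real.sqrt (∑ i, q.1 i ^ 2) < q.2}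

/-- The measure on the Lusin index summand: Lebesgue measure on the cone `Γ` times counting
measure on the gradient coordinates. -/
def lusinIdxMeas (M : ℕ) : Measure (Idx M) :=
  ((volume.restrict (coneSet M)).prod (Measure.count : Measure (Fin (M + 1)))).map Sum.inr

/-- The index measure for the `j`-th variable: concentrated on the summand corresponding to
the chosen square function (`true` = Lusin `𝐒^L`, `false` = random dyadic `𝐒`). -/
def idxMeas (M : ℕ) (lusin : Bool) : Measure (Idx M) :=
  if lusin then lusinIdxMeas M else dyadIdxMeas M

/-- The composition of the indexed scalar components over all the variables. -/
def compAll (n : ℕ) (Nd : Fin n → ℕ) (ι : Π j, Idx (Nd j)) (f : X n Nd → ℝ) :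
    X n Nd → ℝ :=
  (List.finRange n).foldr (fun j g => opComp n Nd j (ι j) g) f

/-- Iterated integration over the index spaces of all the variables. -/
def intAll (n : ℕ) (Nd : Fin n → ℕ) (ch : Fin n → Bool) :
    List (Fin n) → ((Π j, Idx (Nd j)) → ℝ≥0∞) → (Π j, Idx (Nd j)) → ℝ≥0∞
  | [], F, ι => F ι
  | j :: l, F, ι =>
      ∫⁻ a, intAll n Nd ch l F (Function.update ι j a) ∂idxMeas (Nd j) (ch j)

/-- A base point of the index space. -/
def defIdx (n : ℕ) (Nd : Fin n → ℕ) : Π j : Fin n, Idx (Nd j) :=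
  fun _ => Sum.inl (0, fun _ => (0, 0))

/-- The squared pointwise Hilbert-space norm `‖(S̃₁ ⊗ ⋯ ⊗ S̃ₙ f)(x)‖²` of the tensor product
of the square functions chosen by `ch` (`ch j = true`: Lusin `𝐒_j^L`; `ch j = false`: random
dyadic `𝐒_j`), applied to `f`. -/
def tensorNormSq (n : ℕ) (Nd : Fin n → ℕ) (ch : Fin n → Bool) (f : X n Nd → ℝ)
    (x : X n Nd) : ℝ≥0∞ :=
  intAll n Nd ch (List.finRange n)
    (fun ι => ENNReal.ofReal ((compAll n Nd ι f x) ^ 2)) (defIdx n Nd)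

/-- `∫_X ‖(S̃₁ ⊗ ⋯ ⊗ S̃ₙ f)(x)‖ dx`. -/
def tensorL1Norm (n : ℕ) (Nd : Fin n → ℕ) (ch : Fin n → Bool) (f : X n Nd → ℝ) : ℝ≥0∞ :=
  ∫⁻ x, (tensorNormSq n Nd ch f x) ^ (1 / 2 : ℝ)

/-! ### The Poisson kernel -/

/-- The Poisson kernel as a function on the product space. -/
def psn (N : ℕ) (w : (Fin N → ℝ) × ℝ) : ℝ := pk N w.1 w.2

/-- The coordinate direction `d` of the half-space. -/
def hdir (N : ℕ) (d : Fin (N + 1)) : (Fin N → ℝ) × ℝ :=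
  if h : (d : ℕ) < N then (Pi.single (⟨d, h⟩ : Fin N) 1, 0) else (0, 1)

/-- The Euclidean norm squared on the product space. -/
def nsq {N : ℕ} (w : (Fin N → ℝ) × ℝ) : ℝ := (∑ i, w.1 i ^ 2) + w.2 ^ 2

lemma hdir_castSucc {N : ℕ} (i : Fin N) : hdir N i.castSucc = (Pi.single i 1, 0) := by
  simp [hdir]

lemma hdir_last (N : ℕ) : hdir N (Fin.last N) = (0, 1) := by
  simp [hdir]

lemma nsq_pos {N : ℕ} {w : (Fin N → ℝ) × ℝ} (hw : w ≠ 0) : 0 < nsq w := by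
  have h0 : 0 ≤ ∑ i, w.1 i ^ 2 := Finset.sum_nonneg fun i _ => sq_nonneg _
  rcases (h0.lt_or_eq) with h | h
  · unfold nsq; positivity
  · have h1 : w.1 = 0 := by
      ext i
      have := (Finset.sum_eq_zero_iff_of_nonneg (fun i _ => sq_nonneg (w.1 i))).1 h.symm i
        (Finset.mem_univ i)
      simpa using this
    have h2 : w.2 ≠ 0 := fun h2 => hw (Prod.ext h1 h2)
    unfold nsq; rw [← h]; positivity

lemma ne_zero_of_snd_pos {N : ℕ} {w : (Fin N → ℝ) × ℝ} (hw : 0 < w.2) : w ≠ 0 := by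
  rintro rfl; simp at hw

/-- The normalizing constant of the Poisson kernel. -/
def pconst (N : ℕ) : ℝ := Real.Gamma (((N : ℝ) + 1) / 2) / Real.pi ^ (((N : ℝ) + 1) / 2)

lemma pconst_pos (N : ℕ) : 0 < pconst N := by
  unfold pconst
  have := Real.Gamma_pos_of_pos (show 0 < ((N : ℝ) + 1) / 2 by positivity)
  have := Real.pi_pos
  positivity

lemma psn_eq {N : ℕ} {w : (Fin N → ℝ) × ℝ} (hw : w ≠ 0) :
    psn N w = pconst N * (w.2 * nsq w ^ (-(((N : ℝ) + 1) / 2))) := by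
  rw [Real.rpow_neg (nsq_pos hw).le]
  simp only [psn, pk, pconst, nsq]
  ring

lemma contDiff_nsq {N : ℕ} : ContDiff ℝ 3 (nsq (N := N)) := by
  unfold nsq; fun_prop

lemma contDiffAt_psn {N : ℕ} {w : (Fin N → ℝ) × ℝ} (hw : w ≠ 0) :
    ContDiffAt ℝ 3 (psn N) w := by
  have h1 : ContDiffAt ℝ 3
      (fun w : (Fin N → ℝ) × ℝ => pconst N * (w.2 * nsq w ^ (-(((N : ℝ) + 1) / 2)))) w :=
    contDiffAt_const.mul (contDiffAt_snd.mul
      (contDiff_nsq.contDiffAt.rpow_const_of_ne (nsq_pos hw).ne'))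
  refine h1.congr_of_eventuallyEq ?_
  filter_upwards [isOpen_ne.mem_nhds hw] with v hv using psn_eq hv

lemma nsq_smul {N : ℕ} (r : ℝ) (w : (Fin N → ℝ) × ℝ) : nsq (r • w) = r ^ 2 * nsq w := by
  simp [nsq, mul_pow, Finset.mul_sum, mul_add]

lemma psn_smul {N : ℕ} {r : ℝ} (hr : 0 < r) {w : (Fin N → ℝ) × ℝ} (hw : w ≠ 0) :
    r ^ N * psn N (r • w) = psn N w := by
  have hrw : r • w ≠ 0 := smul_ne_zero hr.ne' hw
  rw [psn_eq hw, psn_eq hrw, nsq_smul, Real.mul_rpow (by positivity) (nsq_pos hw).le]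
  have : ((r ^ 2) ^ (-(((N : ℝ) + 1) / 2)) : ℝ) = (r ^ N)⁻¹ * r⁻¹ := by
    rw [← Real.rpow_natCast r 2, ← Real.rpow_mul hr.le]
    rw [show ((2 : ℕ) : ℝ) * (-(((N : ℝ) + 1) / 2)) = -(N + 1 : ℕ) by push_cast; ring]
    rw [Real.rpow_neg hr.le, Real.rpow_natCast, pow_succ, mul_inv]
  rw [this]
  simp only [Prod.smul_snd, smul_eq_mul]
  field_simp

section Homogeneous

variable {V F : Type*} [NormedAddCommGroup V] [NormedSpace ℝ V] [NormedAddCommGroup F]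

lemma bound_snd_of_bound_norm {N a : ℕ} {g : (Fin N → ℝ) × ℝ → F} {C : ℝ}
    (h : ∀ w, w ≠ 0 → ‖w‖ ^ a * ‖g w‖ ≤ C) {w : (Fin N → ℝ) × ℝ} (hw : 0 < w.2) :
    ‖g w‖ ≤ C / w.2 ^ a := by
  have h1 := h w (ne_zero_of_snd_pos hw)
  have h2 : w.2 ≤ ‖w‖ := (le_abs_self _).trans (norm_snd_le w)
  rw [le_div_iff₀ (by positivity), mul_comm]
  refine le_trans ?_ h1
  gcongr

variable [NormedSpace ℝ F]

lemma fderiv_homogeneous {g : V → F} {a : ℕ}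
    (hg : ∀ r : ℝ, 0 < r → ∀ w : V, w ≠ 0 → r ^ a • g (r • w) = g w)
    (hd : ∀ w : V, w ≠ 0 → DifferentiableAt ℝ g w) {r : ℝ} (hr : 0 < r) {w : V} (hw : w ≠ 0) :
    r ^ (a + 1) • fderiv ℝ g (r • w) = fderiv ℝ g w := by
  have h1 : (fun v : V => r ^ a • g (r • v)) =ᶠ[𝓝 w] g := by
    filter_upwards [isOpen_ne.mem_nhds hw] with v hv using hg r hr v hv
  rw [← h1.fderiv_eq]
  have h2 : HasFDerivAt (fun v : V => r • v) (r • ContinuousLinearMap.id ℝ V) w :=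
    (hasFDerivAt_id w).const_smul r
  have h3 := ((hd (r • w) (smul_ne_zero hr.ne' hw)).hasFDerivAt.comp w h2).const_smul (r ^ a)
  have h4 := h3.fderiv
  simp only [Function.comp_def] at h4
  rw [show (fun v : V => r ^ a • g (r • v)) = r ^ a • (fun v : V => g (r • v)) from rfl, h4]
  ext v
  simp [pow_succ, mul_smul]

lemma exists_bound_of_homogeneous [FiniteDimensional ℝ V] {g : V → F} {a : ℕ}
    (hg : ∀ r : ℝ, 0 < r → ∀ w : V, w ≠ 0 → r ^ a • g (r • w) = g w)
    (hc : ∀ w : V, w ≠ 0 → ContinuousAt g w) :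
    ∃ C : ℝ, 0 ≤ C ∧ ∀ w : V, w ≠ 0 → ‖w‖ ^ a * ‖g w‖ ≤ C := by
  have : ProperSpace V := FiniteDimensional.proper ℝ V
  obtain ⟨C, hC⟩ := (isCompact_sphere (0 : V) 1).exists_bound_of_continuousOn (f := g) fun w hw =>
    (hc w (by rintro rfl; simp at hw)).continuousWithinAt
  refine ⟨max C 0, le_max_right _ _, fun w hw => ?_⟩
  have hw' : 0 < ‖w‖ := norm_pos_iff.2 hw
  have h1 := hg ‖w‖⁻¹ (inv_pos.2 hw') w hw
  have h2 := hC (‖w‖⁻¹ • w) (by simp [norm_smul, hw'.ne'])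
  rw [← h1, norm_smul, norm_pow, norm_inv, norm_norm, ← mul_assoc, ← mul_pow,
    mul_inv_cancel₀ hw'.ne', one_pow, one_mul]
  exact h2.trans (le_max_left _ _)

end Homogeneous

lemma fderiv_psn_smul {N : ℕ} {r : ℝ} (hr : 0 < r) {w : (Fin N → ℝ) × ℝ} (hw : w ≠ 0) :
    r ^ (N + 1) • fderiv ℝ (psn N) (r • w) = fderiv ℝ (psn N) w :=
  fderiv_homogeneous (fun _ hr _ hw => by simpa using psn_smul hr hw)
    (fun _ hw => (contDiffAt_psn hw).differentiableAt (by norm_num)) hr hw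

lemma contDiffAt_fderiv_psn {N : ℕ} {w : (Fin N → ℝ) × ℝ} (hw : w ≠ 0) :
    ContDiffAt ℝ 2 (fderiv ℝ (psn N)) w :=
  (contDiffAt_psn hw).fderiv_right (by norm_num)

lemma contDiffAt_fderiv_fderiv_psn {N : ℕ} {w : (Fin N → ℝ) × ℝ} (hw : w ≠ 0) :
    ContDiffAt ℝ 1 (fderiv ℝ (fderiv ℝ (psn N))) w :=
  (contDiffAt_fderiv_psn hw).fderiv_right (by norm_num)

lemma exists_psn_bounds (N : ℕ) : ∃ C : ℝ, 0 ≤ C ∧ ∀ w : (Fin N → ℝ) × ℝ, 0 < w.2 →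
    ‖psn N w‖ ≤ C / w.2 ^ N ∧ ‖fderiv ℝ (psn N) w‖ ≤ C / w.2 ^ (N + 1) ∧
    ‖fderiv ℝ (fderiv ℝ (psn N)) w‖ ≤ C / w.2 ^ (N + 2) := by
  obtain ⟨C0, h00, h0⟩ := exists_bound_of_homogeneous (g := psn N) (a := N)
    (fun r hr w hw => by simpa using psn_smul hr hw) fun w hw => (contDiffAt_psn hw).continuousAt
  obtain ⟨C1, h10, h1⟩ := exists_bound_of_homogeneous (g := fderiv ℝ (psn N)) (a := N + 1)
    (fun r hr w hw => fderiv_psn_smul hr hw) fun w hw => (contDiffAt_fderiv_psn hw).continuousAt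
  obtain ⟨C2, h20, h2⟩ := exists_bound_of_homogeneous (g := fderiv ℝ (fderiv ℝ (psn N)))
    (a := N + 2)
    (fun r hr w hw => fderiv_homogeneous (fun _ hr _ hw => fderiv_psn_smul hr hw)
      (fun _ hw => (contDiffAt_fderiv_psn hw).differentiableAt (by norm_num)) hr hw)
    fun w hw => (contDiffAt_fderiv_fderiv_psn hw).continuousAt
  refine ⟨C0 + C1 + C2, by positivity, fun w hw => ⟨?_, ?_, ?_⟩⟩
  · refine (bound_snd_of_bound_norm h0 hw).trans ?_
    gcongr; linarith
  · refine (bound_snd_of_bound_norm h1 hw).trans ?_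
    gcongr; linarith
  · refine (bound_snd_of_bound_norm h2 hw).trans ?_
    gcongr; linarith

lemma psn_pos {N : ℕ} {w : (Fin N → ℝ) × ℝ} (hw : 0 < w.2) : 0 < psn N w := by
  rw [psn_eq (ne_zero_of_snd_pos hw)]
  have := nsq_pos (ne_zero_of_snd_pos hw)
  have := pconst_pos N
  positivity

lemma continuous_psn_slice (N : ℕ) {t : ℝ} (ht : 0 < t) :
    Continuous fun y : Fin N → ℝ => psn N (y, t) :=
  continuous_iff_continuousAt.2 fun y =>
    (contDiffAt_psn (ne_zero_of_snd_pos (w := (y, t)) ht)).continuousAt.comp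
      (f := fun y : Fin N → ℝ => (y, t)) (by fun_prop)

lemma integrable_psn_one (N : ℕ) : Integrable fun y : Fin N → ℝ => psn N (y, 1) := by
  have h1 : Integrable fun y : Fin N → ℝ =>
      pconst N * ((1 : ℝ) + ‖y‖ ^ 2) ^ (-((N : ℝ) + 1) / 2) :=
    (integrable_rpow_neg_one_add_norm_sq (by simp)).const_mul _
  refine h1.mono' (continuous_psn_slice N one_pos).aestronglyMeasurable (ae_of_all _ fun y => ?_)
  have hw : ((y, 1) : (Fin N → ℝ) × ℝ) ≠ 0 := ne_zero_of_snd_pos one_pos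
  rw [Real.norm_of_nonneg (psn_pos one_pos).le, psn_eq hw, neg_div, one_mul]
  refine mul_le_mul_of_nonneg_left ?_ (pconst_pos N).le
  refine Real.rpow_le_rpow_of_nonpos (by positivity) ?_ (by
    have : (0 : ℝ) ≤ ((N : ℝ) + 1) / 2 := by positivity
    linarith)
  have h2 : ‖y‖ ^ 2 ≤ ∑ i, y i ^ 2 := by
    have h3 : ‖y‖ ≤ √(∑ i, y i ^ 2) := by
      refine (pi_norm_le_iff_of_nonneg (Real.sqrt_nonneg _)).2 fun i => ?_
      rw [Real.norm_eq_abs, ← Real.sqrt_sq_eq_abs]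
      exact Real.sqrt_le_sqrt (Finset.single_le_sum (f := fun i => y i ^ 2)
        (fun i _ => sq_nonneg _) (Finset.mem_univ i))
    calc ‖y‖ ^ 2 ≤ √(∑ i, y i ^ 2) ^ 2 := by gcongr
      _ = _ := Real.sq_sqrt (Finset.sum_nonneg fun i _ => sq_nonneg _)
  simp only [nsq]; linarith

lemma integral_psn_one_pos (N : ℕ) : 0 < ∫ y : Fin N → ℝ, psn N (y, 1) := by
  rw [integral_pos_iff_support_of_nonneg (fun y => (psn_pos one_pos).le) (integrable_psn_one N)]
  have : Function.support (fun y : Fin N → ℝ => psn N (y, 1)) = Set.univ := by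
    ext y
    simpa using (psn_pos (w := (y, 1)) one_pos).ne'
  rw [this]
  exact NeZero.pos _

lemma fderiv_eq_of_line {V : Type*} [NormedAddCommGroup V] [NormedSpace ℝ V] {g : V → ℝ}
    {w v : V} {a : ℝ} (hg : DifferentiableAt ℝ g w)
    (h : HasDerivAt (fun τ : ℝ => g (w + τ • v)) a 0) : fderiv ℝ g w v = a :=
  (hg.hasFDerivAt.hasLineDerivAt v).unique h

lemma nsq_line_castSucc {N : ℕ} (w : (Fin N → ℝ) × ℝ) (i : Fin N) (τ : ℝ) :
    nsq (w + τ • hdir N i.castSucc) = nsq w + 2 * τ * w.1 i + τ ^ 2 := by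
  rw [hdir_castSucc]
  have : ∀ j, (w.1 j + τ * (Pi.single i (1 : ℝ) : Fin N → ℝ) j) ^ 2
      = w.1 j ^ 2 + if j = i then 2 * τ * w.1 i + τ ^ 2 else 0 := by
    intro j
    by_cases h : j = i
    · subst h; simp; ring
    · simp [h]
  simp [nsq, this, Finset.sum_add_distrib]
  ring

lemma nsq_line_last {N : ℕ} (w : (Fin N → ℝ) × ℝ) (τ : ℝ) :
    nsq (w + τ • hdir N (Fin.last N)) = nsq w + 2 * τ * w.2 + τ ^ 2 := by
  rw [hdir_last]
  simp [nsq]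
  ring

lemma hasDerivAt_nsq_rpow {N : ℕ} {w v : (Fin N → ℝ) × ℝ} (hw : w ≠ 0) {b : ℝ}
    (hv : ∀ τ : ℝ, nsq (w + τ • v) = nsq w + 2 * τ * b + τ ^ 2) (p : ℝ) :
    HasDerivAt (fun τ : ℝ => nsq (w + τ • v) ^ p) (p * nsq w ^ (p - 1) * (2 * b)) 0 := by
  have h1 : HasDerivAt (fun τ : ℝ => nsq (w + τ • v)) (2 * b) 0 := by
    simp only [hv]
    have := (((hasDerivAt_id (0 : ℝ)).const_mul 2).mul_const b).const_add (nsq w)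
    have := this.add (hasDerivAt_pow 2 (0 : ℝ))
    simpa [Pi.add_def] using this
  have h2 := h1.rpow_const (p := p) (Or.inl (by simpa using (nsq_pos hw).ne'))
  convert h2 using 1
  simp; ring

lemma line_ne_zero {N : ℕ} {w : (Fin N → ℝ) × ℝ} (hw : w ≠ 0) (v : (Fin N → ℝ) × ℝ) :
    ∀ᶠ τ : ℝ in 𝓝 0, w + τ • v ≠ 0 := by
  have : ContinuousAt (fun τ : ℝ => w + τ • v) 0 := by fun_prop
  exact this.eventually_ne (by simpa using hw)

lemma fderiv_psn_castSucc {N : ℕ} {w : (Fin N → ℝ) × ℝ} (hw : w ≠ 0) (i : Fin N) :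
    fderiv ℝ (psn N) w (hdir N i.castSucc) =
      pconst N * (w.2 * (-(((N : ℝ) + 1) / 2) * nsq w ^ (-(((N : ℝ) + 1) / 2) - 1)
        * (2 * w.1 i))) := by
  refine fderiv_eq_of_line ((contDiffAt_psn hw).differentiableAt (by norm_num)) ?_
  have h := ((hasDerivAt_nsq_rpow hw (nsq_line_castSucc w i) (-(((N : ℝ) + 1) / 2))).const_mul
    w.2).const_mul (pconst N)
  refine h.congr_of_eventuallyEq ?_
  filter_upwards [line_ne_zero hw (hdir N i.castSucc)] with τ hτ
  rw [psn_eq hτ]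
  simp [hdir_castSucc]

lemma hasDerivAt_line_last {N : ℕ} (w : (Fin N → ℝ) × ℝ) :
    HasDerivAt (fun τ : ℝ => (w + τ • hdir N (Fin.last N)).2) 1 0 := by
  simp only [hdir_last]
  simpa using (hasDerivAt_id (0 : ℝ)).const_add w.2

lemma fderiv_psn_last {N : ℕ} {w : (Fin N → ℝ) × ℝ} (hw : w ≠ 0) :
    fderiv ℝ (psn N) w (hdir N (Fin.last N)) =
      pconst N * (nsq w ^ (-(((N : ℝ) + 1) / 2)) +
        w.2 * (-(((N : ℝ) + 1) / 2) * nsq w ^ (-(((N : ℝ) + 1) / 2) - 1) * (2 * w.2))) := by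
  refine fderiv_eq_of_line ((contDiffAt_psn hw).differentiableAt (by norm_num)) ?_
  have h := ((hasDerivAt_line_last w).mul
    (hasDerivAt_nsq_rpow hw (nsq_line_last w) (-(((N : ℝ) + 1) / 2)))).const_mul (pconst N)
  refine (h.congr_of_eventuallyEq ?_).congr_deriv ?_
  · filter_upwards [line_ne_zero hw (hdir N (Fin.last N))] with τ hτ
    rw [psn_eq hτ]; rfl
  · simp

lemma fderiv_fderiv_apply {N : ℕ} {w : (Fin N → ℝ) × ℝ} (hw : w ≠ 0) (u v : (Fin N → ℝ) × ℝ) :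
    fderiv ℝ (fun w => fderiv ℝ (psn N) w v) w u = fderiv ℝ (fderiv ℝ (psn N)) w u v := by
  rw [fderiv_clm_apply ((contDiffAt_fderiv_psn hw).differentiableAt (by norm_num))
    (differentiableAt_const v)]
  simp

lemma snd_fderiv_eq_of_line {N : ℕ} {w u v : (Fin N → ℝ) × ℝ} (hw : w ≠ 0) {a : ℝ}
    (h : HasDerivAt (fun τ : ℝ => fderiv ℝ (psn N) (w + τ • u) v) a 0) :
    fderiv ℝ (fderiv ℝ (psn N)) w u v = a := by
  rw [← fderiv_fderiv_apply hw]
  refine fderiv_eq_of_line ?_ h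
  exact ((contDiffAt_fderiv_psn hw).differentiableAt (by norm_num)).clm_apply
    (differentiableAt_const v)

lemma nsq_rpow_sub_one {N : ℕ} {w : (Fin N → ℝ) × ℝ} (hw : w ≠ 0) (p : ℝ) :
    nsq w ^ (p - 1) * nsq w = nsq w ^ p := by
  rw [Real.rpow_sub_one (nsq_pos hw).ne', div_mul_cancel₀ _ (nsq_pos hw).ne']

/-- The Poisson kernel is harmonic. -/
lemma psn_harmonic {N : ℕ} {w : (Fin N → ℝ) × ℝ} (hw : w ≠ 0) :
    ∑ d, fderiv ℝ (fderiv ℝ (psn N)) w (hdir N d) (hdir N d) = 0 := by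
  set q : ℝ := ((N : ℝ) + 1) / 2 with hq
  have hi : ∀ i : Fin N, fderiv ℝ (fderiv ℝ (psn N)) w (hdir N i.castSucc) (hdir N i.castSucc)
      = pconst N * (w.2 * (-q * (nsq w ^ (-q - 1) * 2 +
        (-q - 1) * nsq w ^ (-q - 1 - 1) * (2 * w.1 i) * (2 * w.1 i)))) := by
    intro i
    refine snd_fderiv_eq_of_line hw ?_
    have h1 : HasDerivAt (fun τ : ℝ => 2 * (w + τ • hdir N i.castSucc).1 i) 2 0 := by
      simp only [hdir_castSucc]
      simpa using ((hasDerivAt_id (0 : ℝ)).const_add (w.1 i)).const_mul 2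
    have h2 := (((hasDerivAt_nsq_rpow hw (nsq_line_castSucc w i) (-q - 1)).const_mul
      (-q)).mul h1).const_mul w.2 |>.const_mul (pconst N)
    refine (h2.congr_of_eventuallyEq ?_).congr_deriv ?_
    · filter_upwards [line_ne_zero hw (hdir N i.castSucc)] with τ hτ
      rw [fderiv_psn_castSucc hτ]
      simp [hdir_castSucc, hq]
    · simp; ring
  have hl : fderiv ℝ (fderiv ℝ (psn N)) w (hdir N (Fin.last N)) (hdir N (Fin.last N))
      = pconst N * (-q * nsq w ^ (-q - 1) * (2 * w.2) + (-q * nsq w ^ (-q - 1) * (2 * w.2) +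
        w.2 * (-q * (nsq w ^ (-q - 1) * 2 +
        (-q - 1) * nsq w ^ (-q - 1 - 1) * (2 * w.2) * (2 * w.2))))) := by
    refine snd_fderiv_eq_of_line hw ?_
    have h0 := hasDerivAt_line_last w
    have h1 := hasDerivAt_nsq_rpow hw (nsq_line_last w) (-q)
    have h2 := hasDerivAt_nsq_rpow hw (nsq_line_last w) (-q - 1)
    have h3 := (h1.add (h0.mul ((h2.const_mul (-q)).mul (h0.const_mul 2)))).const_mul (pconst N)
    refine (h3.congr_of_eventuallyEq ?_).congr_deriv ?_
    · filter_upwards [line_ne_zero hw (hdir N (Fin.last N))] with τ hτ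
      rw [fderiv_psn_last hτ]; rfl
    · simp; left; ring
  rw [Fin.sum_univ_castSucc, hl, Finset.sum_congr rfl fun i _ => hi i]
  rw [← Finset.mul_sum, ← Finset.mul_sum, ← Finset.mul_sum, Finset.sum_add_distrib]
  have hs : ∑ i, (-q - 1) * nsq w ^ (-q - 1 - 1) * (2 * w.1 i) * (2 * w.1 i)
      = (-q - 1) * nsq w ^ (-q - 1 - 1) * 4 * (nsq w - w.2 ^ 2) := by
    simp only [nsq, add_sub_cancel_right, Finset.mul_sum]
    exact Finset.sum_congr rfl fun i _ => by ring
  rw [hs]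
  have hR := nsq_rpow_sub_one hw (-q - 1)
  simp only [Finset.sum_const, Finset.card_univ, Fintype.card_fin, nsmul_eq_mul]
  have hN : (N : ℝ) = 2 * q - 1 := by rw [hq]; ring
  rw [← hR, hN]
  ring

lemma psn_symm {N : ℕ} {w : (Fin N → ℝ) × ℝ} (hw : w ≠ 0) (u v : (Fin N → ℝ) × ℝ) :
    fderiv ℝ (fderiv ℝ (psn N)) w u v = fderiv ℝ (fderiv ℝ (psn N)) w v u :=
  ((contDiffAt_psn hw).isSymmSndFDerivAt (by simpa using by norm_num)).eq u v

/-! ### Differentiating Poisson averages along rays -/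

lemma measurable_psn (N : ℕ) : Measurable (psn N) := by
  unfold psn pk; fun_prop

lemma measurable_fderiv_psn_apply {N : ℕ} {M : Type*} [MeasurableSpace M]
    {γ v : M → (Fin N → ℝ) × ℝ} (hγ : Measurable γ) (hv : Measurable v) :
    Measurable fun m => fderiv ℝ (psn N) (γ m) (v m) :=
  isBoundedBilinearMap_apply.continuous.measurable.comp
    (((measurable_fderiv ℝ (psn N)).comp hγ).prodMk hv)

lemma measurable_fderiv_fderiv_psn_apply {N : ℕ} {M : Type*} [MeasurableSpace M]
    {γ u v : M → (Fin N → ℝ) × ℝ} (hγ : Measurable γ) (hu : Measurable u) (hv : Measurable v) :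
    Measurable fun m => fderiv ℝ (fderiv ℝ (psn N)) (γ m) (u m) (v m) := by
  have h1 : Measurable fun m => fderiv ℝ (fderiv ℝ (psn N)) (γ m) (u m) :=
    isBoundedBilinearMap_apply.continuous.measurable.comp
      (((measurable_fderiv ℝ (fderiv ℝ (psn N))).comp hγ).prodMk hu)
  exact isBoundedBilinearMap_apply.continuous.measurable.comp (h1.prodMk hv)

lemma hasDerivAt_ray {N : ℕ} (b ζ : Fin N → ℝ) (t : ℝ) :
    HasDerivAt (fun t : ℝ => ((b - t • ζ, t) : (Fin N → ℝ) × ℝ)) (-ζ, 1) t := by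
  have h1 : HasDerivAt (fun t : ℝ => b - t • ζ) (-ζ) t := by
    simpa using ((hasDerivAt_id t).smul_const ζ).const_sub b
  exact h1.prodMk (hasDerivAt_id t)

lemma hasDerivAt_psn_ray {N : ℕ} (b ζ : Fin N → ℝ) {t : ℝ} (ht : 0 < t) :
    HasDerivAt (fun t : ℝ => psn N (b - t • ζ, t))
      (fderiv ℝ (psn N) (b - t • ζ, t) (-ζ, 1)) t :=
  HasFDerivAt.comp_hasDerivAt (f := fun t : ℝ => (b - t • ζ, t)) t
    ((contDiffAt_psn (ne_zero_of_snd_pos (w := (b - t • ζ, t)) ht)).differentiableAt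
      (by norm_num)).hasFDerivAt (hasDerivAt_ray b ζ t)

lemma hasDerivAt_fderiv_psn_ray {N : ℕ} (b ζ : Fin N → ℝ) {t : ℝ} (ht : 0 < t) :
    HasDerivAt (fun t : ℝ => fderiv ℝ (psn N) (b - t • ζ, t) (-ζ, 1))
      (fderiv ℝ (fderiv ℝ (psn N)) (b - t • ζ, t) (-ζ, 1) (-ζ, 1)) t := by
  have h := HasFDerivAt.comp_hasDerivAt (f := fun t : ℝ => (b - t • ζ, t)) t
    ((contDiffAt_fderiv_psn (ne_zero_of_snd_pos (w := (b - t • ζ, t)) ht)).differentiableAt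
      (by norm_num)).hasFDerivAt (hasDerivAt_ray b ζ t)
  simpa [Function.comp_def] using h.clm_apply (hasDerivAt_const t ((-ζ, 1) : (Fin N → ℝ) × ℝ))

lemma norm_ray_le {N : ℕ} {ζ : Fin N → ℝ} (h : ‖ζ‖ ≤ 1) : ‖((-ζ, 1) : (Fin N → ℝ) × ℝ)‖ ≤ 1 := by
  simp [Prod.norm_def, h]

section Ray

variable {M : Type*} [MeasurableSpace M] {μ : Measure M} {N : ℕ} {g : M → ℝ}
  {b ζ : M → Fin N → ℝ} {C : ℝ}

lemma bounds_ray (hC : ∀ w : (Fin N → ℝ) × ℝ, 0 < w.2 →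
      ‖psn N w‖ ≤ C / w.2 ^ N ∧ ‖fderiv ℝ (psn N) w‖ ≤ C / w.2 ^ (N + 1) ∧
      ‖fderiv ℝ (fderiv ℝ (psn N)) w‖ ≤ C / w.2 ^ (N + 2)) (hC0 : 0 ≤ C) {a t : ℝ} (ha : 0 < a)
    (hat : a ≤ t) {c : ℝ} {b ζ : Fin N → ℝ} (hz : c ≠ 0 → ‖ζ‖ ≤ 1) :
    ‖c * psn N (b - t • ζ, t)‖ ≤ |c| * (C / a ^ N) ∧
    ‖c * fderiv ℝ (psn N) (b - t • ζ, t) (-ζ, 1)‖ ≤ |c| * (C / a ^ (N + 1)) ∧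
    ‖c * fderiv ℝ (fderiv ℝ (psn N)) (b - t • ζ, t) (-ζ, 1) (-ζ, 1)‖
      ≤ |c| * (C / a ^ (N + 2)) := by
  rcases eq_or_ne c 0 with rfl | hc
  · simp
  have hz' := norm_ray_le (hz hc)
  have ht : 0 < t := ha.trans_le hat
  obtain ⟨h0, h1, h2⟩ := hC (b - t • ζ, t) ht
  have hm : ∀ k : ℕ, C / t ^ k ≤ C / a ^ k := fun k => by gcongr
  simp only [norm_mul, Real.norm_eq_abs c]
  refine ⟨by gcongr; exact h0.trans (hm _), ?_, ?_⟩
  · gcongr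
    refine (ContinuousLinearMap.le_opNorm _ _).trans ((mul_le_of_le_one_right (norm_nonneg _)
      hz').trans (h1.trans (hm _)))
  · gcongr
    refine (ContinuousLinearMap.le_opNorm _ _).trans ((mul_le_of_le_one_right (norm_nonneg _)
      hz').trans ?_)
    exact (ContinuousLinearMap.le_opNorm _ _).trans ((mul_le_of_le_one_right (norm_nonneg _)
      hz').trans (h2.trans (hm _)))

lemma measurable_ray (hb : Measurable b) (hζ : Measurable ζ) (t : ℝ) :
    Measurable fun m => ((b m - t • ζ m, t) : (Fin N → ℝ) × ℝ) := by fun_prop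

lemma hasDerivAt_integral_ray (hg : Integrable g μ) (hb : Measurable b) (hζ : Measurable ζ)
    (hz : ∀ m, g m ≠ 0 → ‖ζ m‖ ≤ 1) {t : ℝ} (ht : 0 < t) :
    HasDerivAt (fun t : ℝ => ∫ m, g m * psn N (b m - t • ζ m, t) ∂μ)
      (∫ m, g m * fderiv ℝ (psn N) (b m - t • ζ m, t) (-ζ m, 1) ∂μ) t := by
  obtain ⟨C, hC0, hC⟩ := exists_psn_bounds N
  have hB := fun m (s : ℝ) (hs : t / 2 ≤ s) =>
    bounds_ray hC hC0 (half_pos ht) hs (c := g m) (b := b m) (hz m)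
  have hm : ∀ s : ℝ, AEStronglyMeasurable (fun m => g m * psn N (b m - s • ζ m, s)) μ := fun s =>
    hg.1.mul ((measurable_psn N).comp (measurable_ray hb hζ s)).aestronglyMeasurable
  refine (hasDerivAt_integral_of_dominated_loc_of_deriv_le (s := Set.Ioi (t / 2))
    (F' := fun t m => g m * fderiv ℝ (psn N) (b m - t • ζ m, t) (-ζ m, 1))
    (bound := fun m => |g m| * (C / (t / 2) ^ (N + 1))) (Ioi_mem_nhds (half_lt_self ht))
    (Eventually.of_forall hm) ?_ ?_ ?_ ?_ ?_).2
  · exact (hg.abs.mul_const _).mono' (hm t) (ae_of_all _ fun m => (hB m t (by linarith)).1)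
  · exact hg.1.mul (measurable_fderiv_psn_apply (measurable_ray hb hζ t)
      (by fun_prop)).aestronglyMeasurable
  · exact ae_of_all _ fun m s hs => (hB m s (le_of_lt hs)).2.1
  · exact hg.abs.mul_const _
  · exact ae_of_all _ fun m s hs => (hasDerivAt_psn_ray _ _
      (show 0 < s from (half_pos ht).trans (Set.mem_Ioi.1 hs))).const_mul _

lemma integrable_fderiv_fderiv_ray (hg : Integrable g μ) (hb : Measurable b) (hζ : Measurable ζ)
    (hz : ∀ m, g m ≠ 0 → ‖ζ m‖ ≤ 1) {t : ℝ} (ht : 0 < t) :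
    Integrable (fun m => g m * fderiv ℝ (fderiv ℝ (psn N)) (b m - t • ζ m, t)
      (-ζ m, 1) (-ζ m, 1)) μ := by
  obtain ⟨C, hC0, hC⟩ := exists_psn_bounds N
  refine (hg.abs.mul_const (C / t ^ (N + 2))).mono' ?_ (ae_of_all _ fun m =>
    (bounds_ray hC hC0 ht le_rfl (c := g m) (b := b m) (hz m)).2.2)
  exact hg.1.mul (measurable_fderiv_fderiv_psn_apply (measurable_ray hb hζ t)
      (by fun_prop) (by fun_prop)).aestronglyMeasurable

lemma hasDerivAt_integral_fderiv_ray (hg : Integrable g μ) (hb : Measurable b) (hζ : Measurable ζ)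
    (hz : ∀ m, g m ≠ 0 → ‖ζ m‖ ≤ 1) {t : ℝ} (ht : 0 < t) :
    HasDerivAt (fun t : ℝ => ∫ m, g m * fderiv ℝ (psn N) (b m - t • ζ m, t) (-ζ m, 1) ∂μ)
      (∫ m, g m * fderiv ℝ (fderiv ℝ (psn N)) (b m - t • ζ m, t) (-ζ m, 1) (-ζ m, 1) ∂μ) t := by
  obtain ⟨C, hC0, hC⟩ := exists_psn_bounds N
  have hB := fun m (s : ℝ) (hs : t / 2 ≤ s) =>
    bounds_ray hC hC0 (half_pos ht) hs (c := g m) (b := b m) (hz m)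
  have hm : ∀ s : ℝ, AEStronglyMeasurable
      (fun m => g m * fderiv ℝ (psn N) (b m - s • ζ m, s) (-ζ m, 1)) μ := fun s =>
    hg.1.mul (measurable_fderiv_psn_apply (measurable_ray hb hζ s)
      (by fun_prop)).aestronglyMeasurable
  refine (hasDerivAt_integral_of_dominated_loc_of_deriv_le (s := Set.Ioi (t / 2))
    (F' := fun t m => g m * fderiv ℝ (fderiv ℝ (psn N)) (b m - t • ζ m, t) (-ζ m, 1) (-ζ m, 1))
    (bound := fun m => |g m| * (C / (t / 2) ^ (N + 2))) (Ioi_mem_nhds (half_lt_self ht))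
    (Eventually.of_forall hm) ?_ ?_ ?_ ?_ ?_).2
  · exact (hg.abs.mul_const _).mono' (hm t) (ae_of_all _ fun m => (hB m t (by linarith)).2.1)
  · exact (integrable_fderiv_fderiv_ray hg hb hζ hz ht).1
  · exact ae_of_all _ fun m s hs => (hB m s (le_of_lt hs)).2.2
  · exact hg.abs.mul_const _
  · exact ae_of_all _ fun m s hs => (hasDerivAt_fderiv_psn_ray _ _
      (show 0 < s from (half_pos ht).trans (Set.mem_Ioi.1 hs))).const_mul _

lemma norm_integral_ray_le (hC : ∀ w : (Fin N → ℝ) × ℝ, 0 < w.2 →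
      ‖psn N w‖ ≤ C / w.2 ^ N ∧ ‖fderiv ℝ (psn N) w‖ ≤ C / w.2 ^ (N + 1) ∧
      ‖fderiv ℝ (fderiv ℝ (psn N)) w‖ ≤ C / w.2 ^ (N + 2)) (hC0 : 0 ≤ C) (hg : Integrable g μ)
    (hz : ∀ m, g m ≠ 0 → ‖ζ m‖ ≤ 1) {t : ℝ} (ht : 0 < t) :
    ‖∫ m, g m * psn N (b m - t • ζ m, t) ∂μ‖ ≤ (∫ m, |g m| ∂μ) * (C / t ^ N) ∧
    ‖∫ m, g m * fderiv ℝ (psn N) (b m - t • ζ m, t) (-ζ m, 1) ∂μ‖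
      ≤ (∫ m, |g m| ∂μ) * (C / t ^ (N + 1)) := by
  have hB := fun m => bounds_ray hC hC0 ht le_rfl (c := g m) (b := b m) (hz m)
  refine ⟨?_, ?_⟩
  · rw [← integral_mul_const]
    exact norm_integral_le_of_norm_le (hg.abs.mul_const _) (ae_of_all _ fun m => (hB m).1)
  · rw [← integral_mul_const]
    exact norm_integral_le_of_norm_le (hg.abs.mul_const _) (ae_of_all _ fun m => (hB m).2.1)

/-- Twice differentiating in `t`, and integrating back from infinity. -/
lemma enorm_integral_ray_le (hN : 0 < N) (hg : Integrable g μ) (hb : Measurable b)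
    (hζ : Measurable ζ) (hz : ∀ m, g m ≠ 0 → ‖ζ m‖ ≤ 1) {ε : ℝ} (hε : 0 < ε) :
    ‖∫ m, g m * psn N (b m - ε • ζ m, ε) ∂μ‖ₑ ≤ ∫⁻ t in Set.Ioi (0 : ℝ),
      ‖t * ∫ m, g m * fderiv ℝ (fderiv ℝ (psn N)) (b m - t • ζ m, t)
        (-ζ m, 1) (-ζ m, 1) ∂μ‖ₑ := by
  obtain ⟨C, hC0, hC⟩ := exists_psn_bounds N
  set H0 : ℝ → ℝ := fun t => ∫ m, g m * psn N (b m - t • ζ m, t) ∂μ with hH0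
  set H1 : ℝ → ℝ := fun t => ∫ m, g m * fderiv ℝ (psn N) (b m - t • ζ m, t) (-ζ m, 1) ∂μ with hH1
  set H2 : ℝ → ℝ := fun t => ∫ m, g m * fderiv ℝ (fderiv ℝ (psn N)) (b m - t • ζ m, t)
        (-ζ m, 1) (-ζ m, 1) ∂μ with hH2
  have d0 : ∀ t, 0 < t → HasDerivAt H0 (H1 t) t := fun t ht =>
    hasDerivAt_integral_ray hg hb hζ hz ht
  have d1 : ∀ t, 0 < t → HasDerivAt H1 (H2 t) t := fun t ht =>
    hasDerivAt_integral_fderiv_ray hg hb hζ hz ht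
  set B : ℝ≥0∞ := ∫⁻ t in Set.Ioi (0 : ℝ), ‖t * H2 t‖ₑ with hB
  by_cases hBt : B = ⊤
  · rw [hBt]; exact le_top
  have hmeas : AEStronglyMeasurable (fun t => t * H2 t) (volume.restrict (Set.Ioi (0 : ℝ))) := by
    have : AEStronglyMeasurable (fun t => t * deriv H1 t) (volume.restrict (Set.Ioi (0 : ℝ))) :=
      (measurable_id.mul (measurable_deriv H1)).aestronglyMeasurable
    refine this.congr ?_
    filter_upwards [ae_restrict_mem measurableSet_Ioi] with t ht
    rw [(d1 t ht).deriv]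
  have hint : IntegrableOn (fun t => t * H2 t) (Set.Ioi 0) := ⟨hmeas, lt_top_iff_ne_top.2 hBt⟩
  have key : ∀ R, ε ≤ R → |H0 ε| ≤ |H0 R| + R * |H1 R| + B.toReal := by
    intro R hR
    have hsub : Set.Ioc ε R ⊆ Set.Ioi 0 := fun t ht => hε.trans ht.1
    have hi : IntegrableOn (fun t => (t - ε) * H2 t) (Set.Ioc ε R) := by
      refine Integrable.mono (hint.mono_set hsub) ?_ ?_
      · have : AEStronglyMeasurable (fun t => (t - ε) * deriv H1 t)
            (volume.restrict (Set.Ioc ε R)) :=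
          ((measurable_id.sub_const ε).mul (measurable_deriv H1)).aestronglyMeasurable
        refine this.congr ?_
        filter_upwards [ae_restrict_mem measurableSet_Ioc] with t ht
        rw [(d1 t (hsub ht)).deriv]
      · filter_upwards [ae_restrict_mem measurableSet_Ioc] with t ht
        rw [norm_mul, norm_mul]
        gcongr
        rw [Real.norm_of_nonneg (by linarith [ht.1]), Real.norm_of_nonneg (hsub ht).le]
        linarith
    have hd : ∀ t ∈ Set.uIcc ε R,
        HasDerivAt (fun t => (t - ε) * H1 t - H0 t) ((t - ε) * H2 t) t := by
      intro t ht
      rw [Set.uIcc_of_le hR] at ht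
      have ht0 : 0 < t := hε.trans_le ht.1
      have h := (((hasDerivAt_id t).sub_const ε).mul (d1 t ht0)).sub (d0 t ht0)
      refine h.congr_deriv ?_
      simp
    have hF := intervalIntegral.integral_eq_sub_of_hasDerivAt hd
      ((intervalIntegrable_iff_integrableOn_Ioc_of_le hR).2 hi)
    rw [intervalIntegral.integral_of_le hR] at hF
    have hle : |∫ t in Set.Ioc ε R, (t - ε) * H2 t| ≤ B.toReal := by
      rw [← Real.norm_eq_abs, ← toReal_enorm]
      refine ENNReal.toReal_mono hBt ((enorm_integral_le_lintegral_enorm _).trans ?_)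
      rw [hB]
      refine (setLIntegral_mono_ae' measurableSet_Ioc (g := fun t => ‖t * H2 t‖ₑ)
        (ae_of_all _ fun t ht => ?_)).trans (lintegral_mono_set hsub)
      rw [enorm_mul, enorm_mul]
      gcongr
      rw [Real.enorm_of_nonneg (by linarith [ht.1]), Real.enorm_of_nonneg (hsub ht).le]
      exact ENNReal.ofReal_le_ofReal (by linarith)
    have hR1 : |(R - ε) * H1 R| ≤ R * |H1 R| := by
      rw [abs_mul, abs_of_nonneg (by linarith)]
      gcongr; linarith
    have : H0 ε = (∫ t in Set.Ioc ε R, (t - ε) * H2 t) - (R - ε) * H1 R + H0 R := by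
      rw [hF]; ring
    rw [this]
    calc |(∫ t in Set.Ioc ε R, (t - ε) * H2 t) - (R - ε) * H1 R + H0 R|
        ≤ |∫ t in Set.Ioc ε R, (t - ε) * H2 t| + |(R - ε) * H1 R| + |H0 R| :=
          (abs_add_le _ _).trans (by gcongr; exact abs_sub _ _)
      _ ≤ _ := by linarith
  set G := ∫ m, |g m| ∂μ with hG
  have hlim : Tendsto (fun R : ℝ => G * (C / R ^ N) + G * (C / R ^ N) + B.toReal) atTop
      (𝓝 (G * 0 + G * 0 + B.toReal)) := by
    have h1 : Tendsto (fun R : ℝ => C / R ^ N) atTop (𝓝 0) :=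
      tendsto_const_nhds.div_atTop (tendsto_pow_atTop hN.ne')
    exact ((h1.const_mul G).add (h1.const_mul G)).add_const _
  have hfin : |H0 ε| ≤ B.toReal := by
    have := ge_of_tendsto (b := |H0 ε|) hlim (by
      filter_upwards [eventually_ge_atTop ε] with R hR
      have hR0 : 0 < R := hε.trans_le hR
      obtain ⟨h1, h2⟩ := norm_integral_ray_le (b := b) hC hC0 hg hz hR0
      have h3 : R * |H1 R| ≤ G * (C / R ^ N) := by
        calc R * |H1 R| ≤ R * (G * (C / R ^ (N + 1))) := by gcongr; exact h2
          _ = _ := by field_simp; ring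
      linarith [key R hR, show |H0 R| ≤ _ from h1])
    simpa using this
  calc ‖H0 ε‖ₑ = ENNReal.ofReal |H0 ε| := Real.enorm_eq_ofReal_abs _
    _ ≤ ENNReal.ofReal B.toReal := ENNReal.ofReal_le_ofReal hfin
    _ = B := ENNReal.ofReal_toReal hBt

end Ray

/-! ### Integration by parts against a bump function -/

/-- The quadratic coefficients obtained by eliminating the second derivative in `t`
by harmonicity. -/
def qcoef {N : ℕ} (i : Fin N) (d : Fin (N + 1)) (ζ : Fin N → ℝ) : ℝ :=
  Fin.snoc (α := fun _ => ℝ) (fun j => ζ i * ζ j - if i = j then 1 else 0) (-2 * ζ i) d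

/-- The mean-zero kernels of the reproducing formula. -/
def bker {N : ℕ} (η : (Fin N → ℝ) → ℝ) (d : Fin (N + 1)) (ζ : Fin N → ℝ) : ℝ :=
  ∑ i, fderiv ℝ (fun ζ => qcoef i d ζ * η ζ) ζ (Pi.single i 1)

lemma contDiff_qcoef {N : ℕ} (i : Fin N) (d : Fin (N + 1)) : ContDiff ℝ 3 (qcoef i d) := by
  induction d using Fin.lastCases with
  | last => unfold qcoef; simp only [Fin.snoc_last]; fun_prop
  | cast j => unfold qcoef; simp only [Fin.snoc_castSucc]; fun_prop

lemma ray_eq_sum {N : ℕ} (ζ : Fin N → ℝ) :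
    ((-ζ, 1) : (Fin N → ℝ) × ℝ) = ∑ i, (-ζ i) • hdir N i.castSucc + hdir N (Fin.last N) := by
  simp only [hdir_castSucc, hdir_last]
  refine Prod.ext ?_ ?_
  · ext j
    simp [Prod.fst_sum, Finset.sum_apply, Pi.single_apply]
  · simp [Prod.snd_sum]

lemma snd_fderiv_psn_ray {N : ℕ} {w : (Fin N → ℝ) × ℝ} (hw : w ≠ 0) (ζ : Fin N → ℝ) :
    fderiv ℝ (fderiv ℝ (psn N)) w (-ζ, 1) (-ζ, 1) =
      ∑ d, ∑ i, qcoef i d ζ * fderiv ℝ (fderiv ℝ (psn N)) w (hdir N i.castSucc) (hdir N d) := by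
  have hh := psn_harmonic hw
  have hs := psn_symm hw
  set L := fderiv ℝ (fderiv ℝ (psn N)) w
  rw [Fin.sum_univ_castSucc] at hh ⊢
  rw [ray_eq_sum]
  simp only [map_add, map_sum, map_smul, add_apply, sum_apply, smul_apply, smul_eq_mul, qcoef, Fin.snoc_last, Fin.snoc_castSucc, sub_mul, Finset.sum_sub_distrib, ite_mul, one_mul,
    zero_mul, Finset.sum_ite_eq', Finset.mem_univ, if_true]
  rw [eq_neg_of_add_eq_zero_right hh]
  have h1 : ∑ i, -ζ i * L (hdir N i.castSucc) (hdir N (Fin.last N)) =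
      ∑ i, -ζ i * L (hdir N (Fin.last N)) (hdir N i.castSucc) :=
    Finset.sum_congr rfl fun i _ => by rw [hs]
  have h2 : ∑ i, -2 * ζ i * L (hdir N i.castSucc) (hdir N (Fin.last N)) =
      2 * ∑ i, -ζ i * L (hdir N i.castSucc) (hdir N (Fin.last N)) := by
    rw [Finset.mul_sum]; exact Finset.sum_congr rfl fun i _ => by ring
  have h3 : ∑ j, ∑ i, ζ i * ζ j * L (hdir N i.castSucc) (hdir N j.castSucc) =
      ∑ j, -ζ j * ∑ i, -ζ i * L (hdir N i.castSucc) (hdir N j.castSucc) := by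
    simp only [Finset.mul_sum]
    exact Finset.sum_congr rfl fun i _ => Finset.sum_congr rfl fun i _ => by ring
  rw [h2, h3]
  simp only [mul_add, Finset.sum_add_distrib]
  rw [h1]
  ring

section Bump

variable {N : ℕ} {η : (Fin N → ℝ) → ℝ}

lemma contDiff_qcoef_mul (hη : ContDiff ℝ 3 η) (i : Fin N) (d : Fin (N + 1)) :
    ContDiff ℝ 3 (fun ζ => qcoef i d ζ * η ζ) := (contDiff_qcoef i d).mul hη

lemma contDiff_fderiv_psn_slice (N : ℕ) (b : Fin N → ℝ) {t : ℝ} (ht : 0 < t)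
    (v : (Fin N → ℝ) × ℝ) :
    ContDiff ℝ 1 fun ζ : Fin N → ℝ => fderiv ℝ (psn N) (b - t • ζ, t) v := by
  rw [contDiff_iff_contDiffAt]
  intro ζ
  have h1 : ContDiffAt ℝ 1 (fun ζ : Fin N → ℝ => ((b - t • ζ, t) : (Fin N → ℝ) × ℝ)) ζ := by
    fun_prop
  have h2 : ContDiffAt ℝ 1 (fderiv ℝ (psn N)) (b - t • ζ, t) :=
    (contDiffAt_fderiv_psn (ne_zero_of_snd_pos (w := (b - t • ζ, t)) ht)).of_le (by norm_num)
  exact (h2.comp ζ h1).clm_apply contDiffAt_const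

lemma fderiv_fderiv_psn_slice (b : Fin N → ℝ) {t : ℝ} (ht : 0 < t)
    (v : (Fin N → ℝ) × ℝ) (ζ : Fin N → ℝ) (i : Fin N) :
    fderiv ℝ (fun ζ : Fin N → ℝ => fderiv ℝ (psn N) (b - t • ζ, t) v) ζ (Pi.single i 1) =
      -t * fderiv ℝ (fderiv ℝ (psn N)) (b - t • ζ, t) (hdir N i.castSucc) v := by
  have hw := ne_zero_of_snd_pos (w := (b - t • ζ, t)) ht
  have h1 : HasFDerivAt (fun ζ : Fin N → ℝ => ((b - t • ζ, t) : (Fin N → ℝ) × ℝ))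
      ((-(t • ContinuousLinearMap.id ℝ (Fin N → ℝ))).prod 0) ζ :=
    (((hasFDerivAt_id ζ).const_smul t).const_sub b).prodMk (hasFDerivAt_const t ζ)
  have h0 := ((contDiffAt_fderiv_psn hw).differentiableAt (by norm_num)).hasFDerivAt
  have h2 := (HasFDerivAt.comp (f := fun ζ : Fin N → ℝ => ((b - t • ζ, t) : (Fin N → ℝ) × ℝ)) ζ
    h0 h1).clm_apply (hasFDerivAt_const v ζ)
  have h3 := h2.fderiv
  simp only [Function.comp_def] at h3
  rw [h3, hdir_castSucc]
  have : ((-(t • (Pi.single i 1 : Fin N → ℝ)), 0) : (Fin N → ℝ) × ℝ)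
      = (-t) • ((Pi.single i 1, 0) : (Fin N → ℝ) × ℝ) :=
    Prod.ext (neg_smul _ _).symm (smul_zero _).symm
  change fderiv ℝ (psn N) (b - t • ζ, t) 0 + fderiv ℝ (fderiv ℝ (psn N)) (b - t • ζ, t)
    (-(t • (Pi.single i 1 : Fin N → ℝ)), 0) v = _
  rw [map_zero, zero_add, this, map_smul]
  rfl

lemma integral_parts (hη : ContDiff ℝ 3 η) (hc : HasCompactSupport η) (b : Fin N → ℝ) {t : ℝ}
    (ht : 0 < t) (i : Fin N) (d : Fin (N + 1)) :
    t * ∫ ζ, qcoef i d ζ * η ζ *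
        fderiv ℝ (fderiv ℝ (psn N)) (b - t • ζ, t) (hdir N i.castSucc) (hdir N d) =
      ∫ ζ, fderiv ℝ (psn N) (b - t • ζ, t) (hdir N d) *
        fderiv ℝ (fun ζ => qcoef i d ζ * η ζ) ζ (Pi.single i 1) := by
  have hF := contDiff_fderiv_psn_slice N b ht (hdir N d)
  have hg := contDiff_qcoef_mul hη i d
  have hgc : HasCompactSupport (fun ζ => qcoef i d ζ * η ζ) := hc.mul_left
  have hF' := hF.continuous_fderiv_apply (by norm_num)
  have cF : Continuous fun ζ => fderiv ℝ (fun ζ : Fin N → ℝ => fderiv ℝ (psn N) (b - t • ζ, t)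
      (hdir N d)) ζ (Pi.single i 1) := hF'.comp (by fun_prop : Continuous fun ζ => (ζ, _))
  have cg : Continuous fun ζ => fderiv ℝ (fun ζ => qcoef i d ζ * η ζ) ζ (Pi.single i 1) :=
    (hg.continuous_fderiv_apply (by norm_num)).comp (by fun_prop : Continuous fun ζ => (ζ, _))
  have hgc' : HasCompactSupport fun ζ => fderiv ℝ (fun ζ => qcoef i d ζ * η ζ) ζ
      (Pi.single i 1) := hgc.fderiv_apply ℝ _
  rw [integral_mul_fderiv_eq_neg_fderiv_mul_of_integrable]
  · simp only [fderiv_fderiv_psn_slice b ht]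
    rw [← integral_neg, ← integral_const_mul]
    congr 1; ext ζ; ring
  · exact (cF.mul hg.continuous).integrable_of_hasCompactSupport hgc.mul_left
  · exact (hF.continuous.mul cg).integrable_of_hasCompactSupport hgc'.mul_left
  · exact (hF.continuous.mul hg.continuous).integrable_of_hasCompactSupport hgc.mul_left
  · exact fun ζ _ => hF.differentiable (by norm_num) ζ
  · exact fun ζ _ => hg.differentiable (by norm_num) ζ

lemma contDiff_bker (hη : ContDiff ℝ 3 η) (d : Fin (N + 1)) : ContDiff ℝ 1 (bker η d) := by
  unfold bker
  refine ContDiff.sum fun i _ => ?_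
  exact ((contDiff_qcoef_mul hη i d).fderiv_right (m := 1) (by norm_num)).clm_apply contDiff_const

lemma hasCompactSupport_bker (hc : HasCompactSupport η) (d : Fin (N + 1)) :
    HasCompactSupport (bker η d) := by
  refine HasCompactSupport.of_support_subset_isCompact (K := tsupport η) hc fun ζ hζ => ?_
  by_contra h
  refine hζ (Finset.sum_eq_zero fun i _ => ?_)
  have : ζ ∉ tsupport (fun ζ => qcoef i d ζ * η ζ) := fun h' => h (tsupport_mul_subset_right h')
  rw [fderiv_of_notMem_tsupport ℝ this]
  rfl

lemma bker_eq_zero (hη : tsupport η ⊆ Metric.closedBall 0 1) (d : Fin (N + 1)) {ζ : Fin N → ℝ}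
    (hζ : 1 < ‖ζ‖) : bker η d ζ = 0 := by
  refine Finset.sum_eq_zero fun i _ => ?_
  have : ζ ∉ tsupport (fun ζ => qcoef i d ζ * η ζ) := fun h' => by
    have := hη (tsupport_mul_subset_right h')
    rw [mem_closedBall_zero_iff] at this
    linarith
  rw [fderiv_of_notMem_tsupport ℝ this]
  rfl

lemma integral_bker (hη : ContDiff ℝ 3 η) (hc : HasCompactSupport η) (d : Fin (N + 1)) :
    ∫ ζ, bker η d ζ = 0 := by
  have hg := contDiff_qcoef_mul hη
  have hgc : ∀ i, HasCompactSupport (fun ζ => qcoef i d ζ * η ζ) := fun i => hc.mul_left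
  have cg : ∀ i, Continuous fun ζ => fderiv ℝ (fun ζ => qcoef i d ζ * η ζ) ζ (Pi.single i 1) :=
    fun i => ((hg i d).continuous_fderiv_apply (by norm_num)).comp
      (by fun_prop : Continuous fun ζ => (ζ, _))
  have hI : ∀ i, Integrable fun ζ => fderiv ℝ (fun ζ => qcoef i d ζ * η ζ) ζ (Pi.single i 1) :=
    fun i => (cg i).integrable_of_hasCompactSupport ((hgc i).fderiv_apply ℝ _)
  unfold bker
  rw [integral_finsetSum _ fun i _ => hI i]
  refine Finset.sum_eq_zero fun i _ => ?_
  have := integral_mul_fderiv_eq_neg_fderiv_mul_of_integrable (μ := volume) (𝕜 := ℝ)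
    (f := fun _ : Fin N → ℝ => (1 : ℝ)) (g := fun ζ => qcoef i d ζ * η ζ)
    (v := Pi.single i 1) (by simp) (by simpa using hI i)
    (by simpa using (hg i d).continuous.integrable_of_hasCompactSupport (hgc i))
    (fun _ _ => differentiableAt_const _) (fun ζ _ => (hg i d).differentiable (by norm_num) ζ)
  simpa using this

/-- Integration by parts turns the second radial derivative into a first gradient. -/
lemma integral_snd_fderiv_ray (hη : ContDiff ℝ 3 η) (hc : HasCompactSupport η) (b : Fin N → ℝ)
    {t : ℝ} (ht : 0 < t) :
    t * ∫ ζ, η ζ * fderiv ℝ (fderiv ℝ (psn N)) (b - t • ζ, t) (-ζ, 1) (-ζ, 1) =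
      ∑ d, ∫ ζ, fderiv ℝ (psn N) (b - t • ζ, t) (hdir N d) * bker η d ζ := by
  have hg := contDiff_qcoef_mul hη
  have hgc : ∀ i d, HasCompactSupport (fun ζ => qcoef i d ζ * η ζ) := fun i d => hc.mul_left
  have hF := fun d => contDiff_fderiv_psn_slice N b ht (hdir N d)
  have c2 : ∀ u v, Continuous fun ζ : Fin N → ℝ =>
      fderiv ℝ (fderiv ℝ (psn N)) (b - t • ζ, t) u v := by
    intro u v
    rw [continuous_iff_continuousAt]
    intro ζ
    have h1 : ContinuousAt (fderiv ℝ (fderiv ℝ (psn N))) (b - t • ζ, t) :=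
      (contDiffAt_fderiv_fderiv_psn (ne_zero_of_snd_pos (w := (b - t • ζ, t)) ht)).continuousAt
    have h2 : ContinuousAt (fun ζ : Fin N → ℝ => fderiv ℝ (fderiv ℝ (psn N)) (b - t • ζ, t)) ζ :=
      ContinuousAt.comp (f := fun ζ : Fin N → ℝ => ((b - t • ζ, t) : (Fin N → ℝ) × ℝ)) h1
        (by fun_prop)
    exact (h2.clm_apply continuousAt_const).clm_apply continuousAt_const
  have cg : ∀ i d, Continuous fun ζ => fderiv ℝ (fun ζ => qcoef i d ζ * η ζ) ζ (Pi.single i 1) :=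
    fun i d => ((hg i d).continuous_fderiv_apply (by norm_num)).comp
      (by fun_prop : Continuous fun ζ => (ζ, _))
  have e1 : ∀ ζ, η ζ * fderiv ℝ (fderiv ℝ (psn N)) (b - t • ζ, t) (-ζ, 1) (-ζ, 1) =
      ∑ d, ∑ i, qcoef i d ζ * η ζ *
        fderiv ℝ (fderiv ℝ (psn N)) (b - t • ζ, t) (hdir N i.castSucc) (hdir N d) := by
    intro ζ
    rw [snd_fderiv_psn_ray (ne_zero_of_snd_pos (w := (b - t • ζ, t)) ht)]
    simp only [Finset.mul_sum]
    exact Finset.sum_congr rfl fun d _ => Finset.sum_congr rfl fun i _ => by ring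
  have I1 : ∀ i d, Integrable fun ζ => qcoef i d ζ * η ζ *
        fderiv ℝ (fderiv ℝ (psn N)) (b - t • ζ, t) (hdir N i.castSucc) (hdir N d) := fun i d =>
    ((hg i d).continuous.mul (c2 _ _)).integrable_of_hasCompactSupport (hgc i d).mul_right
  have I2 : ∀ i d, Integrable fun ζ => fderiv ℝ (psn N) (b - t • ζ, t) (hdir N d) *
        fderiv ℝ (fun ζ => qcoef i d ζ * η ζ) ζ (Pi.single i 1) := fun i d =>
    ((hF d).continuous.mul (cg i d)).integrable_of_hasCompactSupport
      ((hgc i d).fderiv_apply ℝ _).mul_left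
  simp only [e1]
  rw [integral_finsetSum _ fun d _ => integrable_finsetSum _ fun i _ => I1 i d, Finset.mul_sum]
  refine Finset.sum_congr rfl fun d _ => ?_
  rw [integral_finsetSum _ fun i _ => I1 i d, Finset.mul_sum]
  simp only [bker, Finset.mul_sum]
  rw [integral_finsetSum _ fun i _ => I2 i d]
  exact Finset.sum_congr rfl fun i _ => integral_parts hη hc b ht i d

end Bump

/-! ### The reproducing formula -/

/-- The derivative, in the coordinate direction `d`, of the Poisson extension of `f`. -/
def pgrad (N : ℕ) (d : Fin (N + 1)) (f : (Fin N → ℝ) → ℝ) (y : Fin N → ℝ) (t : ℝ) : ℝ :=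
  ∫ z, f z * fderiv ℝ (psn N) (y - z, t) (hdir N d)

/-- The pairing of `ψ` with the `L¹`-normalized dilate of `φ` at height `t` around `y`. -/
def dpair {N : ℕ} (φ ψ : (Fin N → ℝ) → ℝ) (y : Fin N → ℝ) (t : ℝ) : ℝ :=
  ∫ x, ψ x * ((t ^ N)⁻¹ * φ (t⁻¹ • (x - y)))

lemma exists_bump (N : ℕ) : ∃ η : (Fin N → ℝ) → ℝ, ContDiff ℝ 3 η ∧ HasCompactSupport η ∧
    tsupport η ⊆ Metric.closedBall 0 1 ∧ ∫ ζ, η ζ = 1 := by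
  let B : ContDiffBump (0 : Fin N → ℝ) := ⟨1 / 2, 1, by norm_num, by norm_num⟩
  refine ⟨B.normed volume, B.contDiff_normed, B.hasCompactSupport_normed, ?_, B.integral_normed⟩
  rw [B.tsupport_normed_eq]

lemma integral_affine {N : ℕ} (F : (Fin N → ℝ) → ℝ) (x : Fin N → ℝ) {t : ℝ} (ht : 0 < t) :
    ∫ ζ, F (x - t • ζ) = (t ^ N)⁻¹ * ∫ y, F y := by
  rw [Measure.integral_comp_smul volume (fun u => F (x - u)) t, integral_sub_left_eq_self]
  simp [abs_of_pos (pow_pos ht N)]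

lemma norm_hdir_le {N : ℕ} (d : Fin (N + 1)) : ‖hdir N d‖ ≤ 1 := by
  induction d using Fin.lastCases with
  | last => simp [hdir_last, Prod.norm_def]
  | cast i =>
    rw [hdir_castSucc, Prod.norm_def]
    have : ‖(Pi.single i 1 : Fin N → ℝ)‖ ≤ 1 := by
      refine (pi_norm_le_iff_of_nonneg zero_le_one).2 fun j => ?_
      rw [Pi.single_apply]; split_ifs <;> simp
    simpa using this

section Reproducing

variable {N : ℕ} {η f ψ φ : (Fin N → ℝ) → ℝ}

lemma exists_fderiv_psn_bound (N : ℕ) : ∃ C : ℝ, 0 ≤ C ∧ ∀ (y : Fin N → ℝ) (t : ℝ), 0 < t →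
    ∀ d, |fderiv ℝ (psn N) (y, t) (hdir N d)| ≤ C / t ^ (N + 1) := by
  obtain ⟨C, hC0, hC⟩ := exists_psn_bounds N
  refine ⟨C, hC0, fun y t ht d => ?_⟩
  exact (ContinuousLinearMap.le_opNorm _ _).trans ((mul_le_of_le_one_right (norm_nonneg _)
      (norm_hdir_le d)).trans (hC (y, t) ht).2.1)

lemma integrable_triple (hf : Integrable f) (hψ : Integrable ψ) (hφ : Continuous φ)
    (hφc : HasCompactSupport φ) {t : ℝ} (ht : 0 < t) (d : Fin (N + 1)) :
    Integrable (fun p : ((Fin N → ℝ) × (Fin N → ℝ)) × (Fin N → ℝ) =>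
      f p.1.1 * fderiv ℝ (psn N) (p.2 - p.1.1, t) (hdir N d) *
        (ψ p.1.2 * ((t ^ N)⁻¹ * φ (t⁻¹ • (p.1.2 - p.2)))))
      ((volume.prod volume).prod volume) := by
  obtain ⟨C, hC0, hC⟩ := exists_fderiv_psn_bound N
  have hfψ : Integrable (fun p : (Fin N → ℝ) × (Fin N → ℝ) => f p.1 * ψ p.2)
      (volume.prod volume) := hf.mul_prod hψ
  set Φ : (Fin N → ℝ) → ℝ := fun u => (t ^ N)⁻¹ * φ (t⁻¹ • u) with hΦ
  have hΦi : Integrable Φ :=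
    ((hφ.integrable_of_hasCompactSupport hφc).comp_smul (inv_ne_zero ht.ne')).const_mul _
  have hΦm : Measurable Φ := by
    have := hφ.measurable
    fun_prop
  have hbase : Integrable (fun p : ((Fin N → ℝ) × (Fin N → ℝ)) × (Fin N → ℝ) =>
      f p.1.1 * ψ p.1.2 * Φ (p.1.2 - p.2)) ((volume.prod volume).prod volume) := by
    have hm : AEStronglyMeasurable (fun p : ((Fin N → ℝ) × (Fin N → ℝ)) × (Fin N → ℝ) =>
        f p.1.1 * ψ p.1.2 * Φ (p.1.2 - p.2)) ((volume.prod volume).prod volume) :=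
      hfψ.1.comp_fst.mul (hΦm.comp (by fun_prop)).aestronglyMeasurable
    rw [integrable_prod_iff hm]
    refine ⟨ae_of_all _ fun p => by
      simpa using (hΦi.comp_sub_left p.2).const_mul (f p.1 * ψ p.2), ?_⟩
    have : ∀ p : (Fin N → ℝ) × (Fin N → ℝ), ∫ y, ‖f p.1 * ψ p.2 * Φ (p.2 - y)‖
        = ‖f p.1 * ψ p.2‖ * ∫ y, ‖Φ y‖ := by
      intro p
      simp only [norm_mul (f p.1 * ψ p.2)]
      rw [integral_const_mul, integral_sub_left_eq_self (fun y => ‖Φ y‖)]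
    simp only [this]
    exact hfψ.norm.mul_const _
  have hD : Measurable fun p : ((Fin N → ℝ) × (Fin N → ℝ)) × (Fin N → ℝ) =>
      fderiv ℝ (psn N) (p.2 - p.1.1, t) (hdir N d) :=
    measurable_fderiv_psn_apply (by fun_prop) measurable_const
  have := hbase.bdd_mul (c := C / t ^ (N + 1)) hD.aestronglyMeasurable
    (ae_of_all _ fun p => hC (p.2 - p.1.1) t ht d)
  refine this.congr (ae_of_all _ fun p => ?_)
  simp only [hΦ]; ring

lemma triple_inner_eq {t : ℝ} (ht : 0 < t) (d : Fin (N + 1))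
    (p : (Fin N → ℝ) × (Fin N → ℝ)) : f p.1 * ψ p.2 *
      ∫ ζ, fderiv ℝ (psn N) (p.2 - p.1 - t • ζ, t) (hdir N d) * φ ζ =
      ∫ y, f p.1 * fderiv ℝ (psn N) (y - p.1, t) (hdir N d) *
        (ψ p.2 * ((t ^ N)⁻¹ * φ (t⁻¹ • (p.2 - y)))) := by
  have h := integral_affine (fun y => fderiv ℝ (psn N) (y - p.1, t) (hdir N d) *
    φ (t⁻¹ • (p.2 - y))) p.2 ht
  have h2 : ∀ ζ : Fin N → ℝ, fderiv ℝ (psn N) (p.2 - t • ζ - p.1, t) (hdir N d) *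
      φ (t⁻¹ • (p.2 - (p.2 - t • ζ)))
      = fderiv ℝ (psn N) (p.2 - p.1 - t • ζ, t) (hdir N d) * φ ζ := by
    intro ζ
    rw [sub_sub_cancel, inv_smul_smul₀ ht.ne', sub_right_comm]
  simp only [h2] at h
  rw [h, ← mul_assoc, ← integral_const_mul]
  congr 1; ext y; ring

lemma integrable_triple_inner (hf : Integrable f) (hψ : Integrable ψ) (hφ : Continuous φ)
    (hφc : HasCompactSupport φ) {t : ℝ} (ht : 0 < t) (d : Fin (N + 1)) :
    Integrable (fun p : (Fin N → ℝ) × (Fin N → ℝ) => f p.1 * ψ p.2 *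
      ∫ ζ, fderiv ℝ (psn N) (p.2 - p.1 - t • ζ, t) (hdir N d) * φ ζ)
      (volume.prod volume) := by
  simp only [triple_inner_eq ht]
  exact (integrable_triple hf hψ hφ hφc ht d).integral_prod_left

lemma integral_triple (hf : Integrable f) (hψ : Integrable ψ) (hφ : Continuous φ)
    (hφc : HasCompactSupport φ) {t : ℝ} (ht : 0 < t) (d : Fin (N + 1)) :
    ∫ p : (Fin N → ℝ) × (Fin N → ℝ), (f p.1 * ψ p.2 *
      ∫ ζ, fderiv ℝ (psn N) (p.2 - p.1 - t • ζ, t) (hdir N d) * φ ζ) ∂(volume.prod volume) =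
    ∫ y, pgrad N d f y t * dpair φ ψ y t := by
  simp only [triple_inner_eq ht]
  have hI := integrable_triple hf hψ hφ hφc ht d
  rw [integral_integral_swap
    (f := fun (p : (Fin N → ℝ) × (Fin N → ℝ)) y =>
      f p.1 * fderiv ℝ (psn N) (y - p.1, t) (hdir N d) *
        (ψ p.2 * ((t ^ N)⁻¹ * φ (t⁻¹ • (p.2 - y))))) hI]
  congr 1; ext y
  rw [integral_prod_mul
    (fun z => f z * fderiv ℝ (psn N) (y - z, t) (hdir N d))
    (fun x => ψ x * ((t ^ N)⁻¹ * φ (t⁻¹ • (x - y))))]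
  rfl

lemma integrable_triple_y (hf : Integrable f) (hψ : Integrable ψ) (hφ : Continuous φ)
    (hφc : HasCompactSupport φ) {t : ℝ} (ht : 0 < t) (d : Fin (N + 1)) :
    Integrable fun y => pgrad N d f y t * dpair φ ψ y t := by
  have h := (integrable_triple hf hψ hφ hφc ht d).integral_prod_right
  refine h.congr (ae_of_all _ fun y => ?_)
  exact integral_prod_mul
    (fun z => f z * fderiv ℝ (psn N) (y - z, t) (hdir N d))
    (fun x => ψ x * ((t ^ N)⁻¹ * φ (t⁻¹ • (x - y))))

lemma snd_radial_eq (hη : ContDiff ℝ 3 η) (hc : HasCompactSupport η)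
    (hs : tsupport η ⊆ Metric.closedBall 0 1) (hf : Integrable f)
    (hψ : Integrable ψ) {t : ℝ} (ht : 0 < t) :
    t * ∫ m : ((Fin N → ℝ) × (Fin N → ℝ)) × (Fin N → ℝ), f m.1.1 * ψ m.1.2 * η m.2 *
      fderiv ℝ (fderiv ℝ (psn N)) (m.1.2 - m.1.1 - t • m.2, t) (-m.2, 1) (-m.2, 1)
        ∂((volume.prod volume).prod volume) =
    ∫ y, ∑ d, pgrad N d f y t * dpair (bker η d) ψ y t := by
  have hfψ : Integrable (fun p : (Fin N → ℝ) × (Fin N → ℝ) => f p.1 * ψ p.2)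
      (volume.prod volume) := hf.mul_prod hψ
  have hg : Integrable (fun m : ((Fin N → ℝ) × (Fin N → ℝ)) × (Fin N → ℝ) =>
      f m.1.1 * ψ m.1.2 * η m.2) ((volume.prod volume).prod volume) :=
    hfψ.mul_prod (hη.continuous.integrable_of_hasCompactSupport hc)
  have hI := integrable_fderiv_fderiv_ray hg (b := fun m => m.1.2 - m.1.1) (ζ := fun m => m.2)
    (by fun_prop) (by fun_prop) (fun m hm => by
      have := hs (subset_tsupport _ (right_ne_zero_of_mul hm))
      simpa using this) ht
  rw [integral_finsetSum _ fun d _ => integrable_triple_y hf hψ (contDiff_bker hη d).continuous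
    (hasCompactSupport_bker hc d) ht d]
  simp only [← integral_triple hf hψ (contDiff_bker hη _).continuous
    (hasCompactSupport_bker hc _) ht]
  rw [← integral_finsetSum _ fun d _ => integrable_triple_inner hf hψ
    (contDiff_bker hη d).continuous (hasCompactSupport_bker hc d) ht d, integral_prod _ hI,
    ← integral_const_mul]
  congr 1; ext p
  simp only [mul_assoc, integral_const_mul]
  rw [mul_left_comm, mul_left_comm t, integral_snd_fderiv_ray hη hc _ ht]
  simp only [Finset.mul_sum]

end Reproducing

section Reproducing

variable {N : ℕ} {η f ψ : (Fin N → ℝ) → ℝ}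

lemma integral_affine_add (F : (Fin N → ℝ) → ℝ) (a : Fin N → ℝ) {t : ℝ} (ht : 0 < t) :
    ∫ u, F (a + t • u) = (t ^ N)⁻¹ * ∫ y, F y := by
  rw [Measure.integral_comp_smul volume (fun u => F (a + u)) t, integral_add_left_eq_self]
  simp [abs_of_pos (pow_pos ht N)]

lemma integral_psn_ray (ψ : (Fin N → ℝ) → ℝ) (z ζ : Fin N → ℝ) {ε : ℝ} (hε : 0 < ε) :
    ∫ x, ψ x * psn N (x - z - ε • ζ, ε) = ∫ u, psn N (u, 1) * ψ (z + ε • (u + ζ)) := by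
  have h := integral_affine_add (fun x => ψ x * psn N (x - z - ε • ζ, ε)) (z + ε • ζ) hε
  have h2 : ∀ u : Fin N → ℝ, ψ (z + ε • ζ + ε • u) * psn N (z + ε • ζ + ε • u - z - ε • ζ, ε)
      = (ε ^ N)⁻¹ * (psn N (u, 1) * ψ (z + ε • (u + ζ))) := by
    intro u
    have e1 : z + ε • ζ + ε • u - z - ε • ζ = ε • u := by abel
    have e2 : z + ε • ζ + ε • u = z + ε • (u + ζ) := by rw [smul_add]; abel
    have e3 := psn_smul (N := N) hε (w := (u, 1)) (by simp)
    rw [e1, e2, ← e3]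
    simp only [Prod.smul_mk, smul_eq_mul, mul_one]
    field_simp
  simp only [h2, integral_const_mul] at h
  exact (mul_left_cancel₀ (inv_ne_zero (pow_pos hε N).ne') h).symm

lemma integrable_rescaled (hf : Integrable f) (hη : Integrable η) (hψm : Measurable ψ) {B : ℝ}
    (hB : ∀ x, |ψ x| ≤ B) (ε : ℝ) :
    Integrable (fun m : ((Fin N → ℝ) × (Fin N → ℝ)) × (Fin N → ℝ) =>
      f m.1.1 * psn N (m.1.2, 1) * η m.2 * ψ (m.1.1 + ε • (m.1.2 + m.2)))
      ((volume.prod volume).prod volume) :=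
  ((hf.mul_prod (integrable_psn_one N)).mul_prod hη).mul_bdd (c := B)
    (hψm.comp (by fun_prop)).aestronglyMeasurable (ae_of_all _ fun m => hB _)

lemma integral_ray_rescale (hf : Integrable f) (hη : Integrable η) (hψ : Integrable ψ)
    (hψm : Measurable ψ) {B : ℝ} (hB : ∀ x, |ψ x| ≤ B) {ε : ℝ} (hε : 0 < ε) :
    ∫ m : ((Fin N → ℝ) × (Fin N → ℝ)) × (Fin N → ℝ), f m.1.1 * ψ m.1.2 * η m.2 *
      psn N (m.1.2 - m.1.1 - ε • m.2, ε) ∂((volume.prod volume).prod volume) =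
    ∫ m : ((Fin N → ℝ) × (Fin N → ℝ)) × (Fin N → ℝ),
      f m.1.1 * psn N (m.1.2, 1) * η m.2 * ψ (m.1.1 + ε • (m.1.2 + m.2))
      ∂((volume.prod volume).prod volume) := by
  obtain ⟨C, hC0, hC⟩ := exists_psn_bounds N
  have hb : ∀ y, ‖psn N (y, ε)‖ ≤ C / ε ^ N := fun y => (hC (y, ε) hε).1
  have hfψ : Integrable (fun p : (Fin N → ℝ) × (Fin N → ℝ) => f p.1 * ψ p.2)
      (volume.prod volume) := hf.mul_prod hψ
  have h1 : Integrable (fun m : ((Fin N → ℝ) × (Fin N → ℝ)) × (Fin N → ℝ) =>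
      f m.1.1 * ψ m.1.2 * η m.2 * psn N (m.1.2 - m.1.1 - ε • m.2, ε))
      ((volume.prod volume).prod volume) :=
    (hfψ.mul_prod hη).mul_bdd (c := C / ε ^ N)
      ((measurable_psn N).comp (by fun_prop)).aestronglyMeasurable (ae_of_all _ fun m => hb _)
  rw [integral_prod_symm _ h1, integral_prod_symm _ (integrable_rescaled hf hη hψm hB ε)]
  congr 1; ext ζ
  have h2 : Integrable (fun p : (Fin N → ℝ) × (Fin N → ℝ) =>
      f p.1 * ψ p.2 * η ζ * psn N (p.2 - p.1 - ε • ζ, ε)) (volume.prod volume) :=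
    (hfψ.mul_const _).mul_bdd (c := C / ε ^ N)
      ((measurable_psn N).comp (by fun_prop)).aestronglyMeasurable (ae_of_all _ fun m => hb _)
  have h3 : Integrable (fun p : (Fin N → ℝ) × (Fin N → ℝ) =>
      f p.1 * psn N (p.2, 1) * η ζ * ψ (p.1 + ε • (p.2 + ζ))) (volume.prod volume) :=
    ((hf.mul_prod (integrable_psn_one N)).mul_const _).mul_bdd (c := B)
      (hψm.comp (by fun_prop)).aestronglyMeasurable (ae_of_all _ fun m => hB _)
  rw [integral_prod _ h2, integral_prod _ h3]
  congr 1; ext z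
  have e1 : ∀ x, f z * ψ x * η ζ * psn N (x - z - ε • ζ, ε) =
      (f z * η ζ) * (ψ x * psn N (x - z - ε • ζ, ε)) := fun x => by ring
  have e2 : ∀ u, f z * psn N (u, 1) * η ζ * ψ (z + ε • (u + ζ)) =
      (f z * η ζ) * (psn N (u, 1) * ψ (z + ε • (u + ζ))) := fun x => by ring
  simp only [e1, e2, integral_const_mul, integral_psn_ray ψ z ζ hε]

lemma tendsto_integral_rescaled (hf : Integrable f) (hη : Integrable η) (hη1 : ∫ ζ, η ζ = 1)
    (hψm : Measurable ψ) {B : ℝ} (hB : ∀ x, |ψ x| ≤ B) (hψc : ∀ᵐ x, ContinuousAt ψ x) :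
    Tendsto (fun ε : ℝ => ∫ m : ((Fin N → ℝ) × (Fin N → ℝ)) × (Fin N → ℝ),
      f m.1.1 * psn N (m.1.2, 1) * η m.2 * ψ (m.1.1 + ε • (m.1.2 + m.2))
      ∂((volume.prod volume).prod volume)) (𝓝[>] 0)
      (𝓝 ((∫ u, psn N (u, 1)) * ∫ z, f z * ψ z)) := by
  have hlim : (∫ u, psn N (u, 1)) * ∫ z, f z * ψ z =
      ∫ m : ((Fin N → ℝ) × (Fin N → ℝ)) × (Fin N → ℝ),
        f m.1.1 * psn N (m.1.2, 1) * η m.2 * ψ m.1.1 ∂((volume.prod volume).prod volume) := by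
    have e : ∀ m : ((Fin N → ℝ) × (Fin N → ℝ)) × (Fin N → ℝ),
        f m.1.1 * psn N (m.1.2, 1) * η m.2 * ψ m.1.1 =
        ((f m.1.1 * ψ m.1.1) * psn N (m.1.2, 1)) * η m.2 := fun m => by ring
    simp only [e]
    rw [integral_prod_mul (fun p : (Fin N → ℝ) × (Fin N → ℝ) =>
      (f p.1 * ψ p.1) * psn N (p.2, 1)) η, integral_prod_mul (fun z => f z * ψ z)
      (fun u => psn N (u, 1)), hη1]
    ring
  rw [hlim]
  have hint : Integrable (fun m : ((Fin N → ℝ) × (Fin N → ℝ)) × (Fin N → ℝ) =>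
      f m.1.1 * psn N (m.1.2, 1) * η m.2) ((volume.prod volume).prod volume) :=
    (hf.mul_prod (integrable_psn_one N)).mul_prod hη
  refine tendsto_integral_filter_of_dominated_convergence
    (fun m => ‖f m.1.1 * psn N (m.1.2, 1) * η m.2‖ * B)
    (Eventually.of_forall fun ε => (integrable_rescaled hf hη hψm hB ε).1)
    (Eventually.of_forall fun ε => ae_of_all _ fun m => ?_) (hint.norm.mul_const _) ?_
  · rw [norm_mul]
    exact mul_le_mul_of_nonneg_left (hB _) (norm_nonneg _)
  · have hae : ∀ᵐ m : ((Fin N → ℝ) × (Fin N → ℝ)) × (Fin N → ℝ)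
        ∂((volume.prod volume).prod volume), ContinuousAt ψ m.1.1 :=
      (Measure.quasiMeasurePreserving_fst.comp Measure.quasiMeasurePreserving_fst).ae hψc
    filter_upwards [hae] with m hm
    refine Tendsto.const_mul _ (hm.tendsto.comp ?_)
    have : Continuous fun ε : ℝ => m.1.1 + ε • (m.1.2 + m.2) := by fun_prop
    have h0 := this.tendsto 0
    simp only [zero_smul, add_zero] at h0
    exact h0.mono_left nhdsWithin_le_nhds

lemma enorm_integral_rescaled_le (hN : 0 < N) (hη : ContDiff ℝ 3 η) (hc : HasCompactSupport η)
    (hs : tsupport η ⊆ Metric.closedBall 0 1) (hf : Integrable f)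
    (hψ : Integrable ψ) (hψm : Measurable ψ) {B : ℝ} (hB : ∀ x, |ψ x| ≤ B) {ε : ℝ}
    (hε : 0 < ε) :
    ‖∫ m : ((Fin N → ℝ) × (Fin N → ℝ)) × (Fin N → ℝ),
      f m.1.1 * psn N (m.1.2, 1) * η m.2 * ψ (m.1.1 + ε • (m.1.2 + m.2))
      ∂((volume.prod volume).prod volume)‖ₑ ≤
      ∫⁻ t in Set.Ioi (0 : ℝ), ∫⁻ y, ∑ d, ‖pgrad N d f y t‖ₑ * ‖dpair (bker η d) ψ y t‖ₑ := by
  have hηi := hη.continuous.integrable_of_hasCompactSupport hc (μ := volume)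
  rw [← integral_ray_rescale hf hηi hψ hψm hB hε]
  have hfψ : Integrable (fun p : (Fin N → ℝ) × (Fin N → ℝ) => f p.1 * ψ p.2)
      (volume.prod volume) := hf.mul_prod hψ
  have hg : Integrable (fun m : ((Fin N → ℝ) × (Fin N → ℝ)) × (Fin N → ℝ) =>
      f m.1.1 * ψ m.1.2 * η m.2) ((volume.prod volume).prod volume) := hfψ.mul_prod hηi
  have h1 := enorm_integral_ray_le hN hg (b := fun m => m.1.2 - m.1.1) (ζ := fun m => m.2)
    (by fun_prop) (by fun_prop) (fun m hm => by
      have := hs (subset_tsupport _ (right_ne_zero_of_mul hm))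
      simpa using this) hε
  refine h1.trans ?_
  refine setLIntegral_mono' measurableSet_Ioi fun t ht => ?_
  have h2 := snd_radial_eq hη hc hs hf hψ ht
  rw [h2]
  refine (enorm_integral_le_lintegral_enorm _).trans (lintegral_mono fun y => ?_)
  have h3 := enorm_sum_le Finset.univ (fun d => pgrad N d f y t * dpair (bker η d) ψ y t)
  simpa only [enorm_mul] using h3

/-- Calderón-type reproducing estimate: a pairing with `ψ` is controlled by the gradient of the
Poisson extension tested against dilates of the mean zero kernels `bker η d`. -/
lemma enorm_integral_mul_le (hN : 0 < N) (hη : ContDiff ℝ 3 η) (hc : HasCompactSupport η)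
    (hs : tsupport η ⊆ Metric.closedBall 0 1) (hη1 : ∫ ζ, η ζ = 1) (hf : Integrable f)
    (hψ : Integrable ψ) (hψm : Measurable ψ) {B : ℝ} (hB : ∀ x, |ψ x| ≤ B)
    (hψc : ∀ᵐ x, ContinuousAt ψ x) :
    ENNReal.ofReal (∫ u, psn N (u, 1)) * ‖∫ z, f z * ψ z‖ₑ ≤
      ∫⁻ t in Set.Ioi (0 : ℝ), ∫⁻ y, ∑ d, ‖pgrad N d f y t‖ₑ * ‖dpair (bker η d) ψ y t‖ₑ := by
  have hηi := hη.continuous.integrable_of_hasCompactSupport hc (μ := volume)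
  have hlim := (continuous_enorm.tendsto _).comp
    (tendsto_integral_rescaled hf hηi hη1 hψm hB hψc)
  rw [← Real.enorm_eq_ofReal (integral_psn_one_pos N).le, ← enorm_mul]
  refine le_of_tendsto hlim ?_
  filter_upwards [self_mem_nhdsWithin] with ε hε
  exact enorm_integral_rescaled_le hN hη hc hs hf hψ hψm hB hε

end Reproducing

/-! ### Dyadic cubes -/

section Cubes

variable {N : ℕ}

lemma mem_dcube_iff {c : Fin N → ℝ} {k : ℤ} {x y : Fin N → ℝ} :
    y ∈ dcube c k x ↔ ∀ i, ⌊(y i - c i) / (2 : ℝ) ^ k⌋ = ⌊(x i - c i) / (2 : ℝ) ^ k⌋ := Iff.rfl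

lemma dcube_eq_pi (c : Fin N → ℝ) (k : ℤ) (x : Fin N → ℝ) :
    dcube c k x = Set.univ.pi fun i =>
      Set.Ico (c i + 2 ^ k * ⌊(x i - c i) / (2 : ℝ) ^ k⌋)
        (c i + 2 ^ k * ⌊(x i - c i) / (2 : ℝ) ^ k⌋ + 2 ^ k) := by
  have h2 : (0 : ℝ) < 2 ^ k := by positivity
  ext y
  simp only [mem_dcube_iff, Set.mem_univ_pi, Set.mem_Ico]
  refine forall_congr' fun i => ?_
  rw [Int.floor_eq_iff, le_div_iff₀ h2, div_lt_iff₀ h2]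
  constructor <;> rintro ⟨h, h'⟩ <;> constructor <;> nlinarith

lemma measurableSet_dcube (c : Fin N → ℝ) (k : ℤ) (x : Fin N → ℝ) :
    MeasurableSet (dcube c k x) := by
  rw [dcube_eq_pi]
  exact MeasurableSet.univ_pi fun i => measurableSet_Ico

lemma volume_dcube (c : Fin N → ℝ) (k : ℤ) (x : Fin N → ℝ) :
    volume (dcube c k x) = ENNReal.ofReal (((2 : ℝ) ^ k) ^ N) := by
  rw [dcube_eq_pi, volume_pi_pi]
  simp only [Real.volume_Ico, add_sub_cancel_left, Finset.prod_const, Finset.card_univ,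
    Fintype.card_fin]
  rw [ENNReal.ofReal_pow (by positivity)]

lemma norm_sub_le_of_mem_dcube {c : Fin N → ℝ} {k : ℤ} {x y : Fin N → ℝ}
    (h : y ∈ dcube c k x) : ‖y - x‖ ≤ 2 ^ k := by
  have h2 : (0 : ℝ) < 2 ^ k := by positivity
  refine (pi_norm_le_iff_of_nonneg h2.le).2 fun i => ?_
  have hi := Int.abs_sub_lt_one_of_floor_eq_floor (mem_dcube_iff.1 h i)
  rw [← sub_div, sub_sub_sub_cancel_right, abs_div, abs_of_pos h2, div_lt_one h2] at hi
  exact hi.le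

lemma ae_continuousAt_indicator_dcube (c : Fin N → ℝ) (k : ℤ) (x : Fin N → ℝ) :
    ∀ᵐ y, ContinuousAt ((dcube c k x).indicator fun _ => (1 : ℝ)) y := by
  have hconv : Convex ℝ (dcube c k x) := by
    rw [dcube_eq_pi]
    exact convex_pi fun i _ => convex_Ico _ _
  have h0 := hconv.addHaar_frontier volume
  filter_upwards [compl_mem_ae_iff.2 h0] with y hy
  exact continuousOn_const.continuousAt_indicator hy

/-- The kernel of the martingale difference `Δ_k` evaluated at `x`. -/
def mker (c : ℤ → Fin N → ℝ) (k : ℤ) (x y : Fin N → ℝ) : ℝ :=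
  (((2 : ℝ) ^ (k - 1)) ^ N)⁻¹ * (dcube (c (k - 1)) (k - 1) x).indicator (fun _ => 1) y -
    (((2 : ℝ) ^ k) ^ N)⁻¹ * (dcube (c k) k x).indicator (fun _ => 1) y

lemma integrable_indicator_dcube (c : Fin N → ℝ) (k : ℤ) (x : Fin N → ℝ) :
    Integrable ((dcube c k x).indicator fun _ => (1 : ℝ)) := by
  refine (integrableOn_const (C := (1 : ℝ)) ?_).integrable_indicator (measurableSet_dcube c k x)
  rw [volume_dcube]; exact ENNReal.ofReal_ne_top

lemma avg_eq_integral (c : ℤ → Fin N → ℝ) (k : ℤ) (f : (Fin N → ℝ) → ℝ) (x : Fin N → ℝ) :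
    avg c k f x =
      ∫ y, f y * ((((2 : ℝ) ^ k) ^ N)⁻¹ * (dcube (c k) k x).indicator (fun _ => 1) y) := by
  rw [avg, ← integral_indicator (measurableSet_dcube _ _ _), div_eq_inv_mul,
    ← integral_const_mul]
  congr 1; ext y
  by_cases hy : y ∈ dcube (c k) k x <;> simp [hy, mul_comm]

lemma integrable_mul_indicator_dcube {f : (Fin N → ℝ) → ℝ} (hf : Integrable f)
    (c : Fin N → ℝ) (k : ℤ) (x : Fin N → ℝ) (a : ℝ) :
    Integrable fun y => f y * (a * (dcube c k x).indicator (fun _ => 1) y) := by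
  refine ((hf.indicator (measurableSet_dcube c k x)).const_mul a).congr (ae_of_all _ fun y => ?_)
  by_cases hy : y ∈ dcube c k x <;> simp [hy, mul_comm]

lemma mdiff_eq_integral {f : (Fin N → ℝ) → ℝ} (hf : Integrable f) (c : ℤ → Fin N → ℝ) (k : ℤ)
    (x : Fin N → ℝ) : mdiff c k f x = ∫ y, f y * mker c k x y := by
  rw [mdiff, avg_eq_integral, avg_eq_integral, ← integral_sub
    (integrable_mul_indicator_dcube hf _ _ _ _) (integrable_mul_indicator_dcube hf _ _ _ _)]
  congr 1; ext y
  rw [mker]; ring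

lemma integrable_mker (c : ℤ → Fin N → ℝ) (k : ℤ) (x : Fin N → ℝ) : Integrable (mker c k x) :=
  ((integrable_indicator_dcube _ _ _).const_mul _).sub
    ((integrable_indicator_dcube _ _ _).const_mul _)

lemma measurable_mker (c : ℤ → Fin N → ℝ) (k : ℤ) (x : Fin N → ℝ) : Measurable (mker c k x) :=
  ((measurable_const.indicator (measurableSet_dcube _ _ _)).const_mul _).sub
    ((measurable_const.indicator (measurableSet_dcube _ _ _)).const_mul _)

lemma abs_mker_le (c : ℤ → Fin N → ℝ) (k : ℤ) (x y : Fin N → ℝ) :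
    |mker c k x y| ≤ (((2 : ℝ) ^ (k - 1)) ^ N)⁻¹ + (((2 : ℝ) ^ k) ^ N)⁻¹ := by
  have h1 : (0 : ℝ) ≤ (((2 : ℝ) ^ (k - 1)) ^ N)⁻¹ := by positivity
  have h2 : (0 : ℝ) ≤ (((2 : ℝ) ^ k) ^ N)⁻¹ := by positivity
  rw [mker, abs_le]
  by_cases ha : y ∈ dcube (c (k - 1)) (k - 1) x <;> by_cases hb : y ∈ dcube (c k) k x <;>
    simp only [ha, hb, Set.indicator_of_mem, Set.indicator_of_notMem, not_false_eq_true] <;>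
    constructor <;> linarith

lemma ae_continuousAt_mker (c : ℤ → Fin N → ℝ) (k : ℤ) (x : Fin N → ℝ) :
    ∀ᵐ y, ContinuousAt (mker c k x) y := by
  filter_upwards [ae_continuousAt_indicator_dcube (c (k - 1)) (k - 1) x,
    ae_continuousAt_indicator_dcube (c k) k x] with y h1 h2
  exact (continuousAt_const.mul h1).sub (continuousAt_const.mul h2)

end Cubes

section KernelBounds

variable {N : ℕ} {φ : (Fin N → ℝ) → ℝ} {L : ℝ}

/-- The `L¹`-normalized dilate of `φ` at height `t` around `y`. -/
def dil (φ : (Fin N → ℝ) → ℝ) (y : Fin N → ℝ) (t : ℝ) (z : Fin N → ℝ) : ℝ :=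
  (t ^ N)⁻¹ * φ (t⁻¹ • (z - y))

lemma dil_eq_zero (h0 : ∀ ζ, 1 < ‖ζ‖ → φ ζ = 0) {y z : Fin N → ℝ} {t : ℝ} (ht : 0 < t)
    (h : t < ‖z - y‖) : dil φ y t z = 0 := by
  rw [dil, h0, mul_zero]
  rw [norm_smul, norm_inv, Real.norm_of_nonneg ht.le, ← div_eq_inv_mul, one_lt_div ht]
  exact h

lemma integrable_dil (hφ : Continuous φ) (hφc : HasCompactSupport φ) (y : Fin N → ℝ) {t : ℝ}
    (ht : 0 < t) : Integrable (dil φ y t) :=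
  (((hφ.integrable_of_hasCompactSupport hφc).comp_smul (inv_ne_zero ht.ne')).comp_sub_right
    y).const_mul _

lemma integral_dil (hi : ∫ ζ, φ ζ = 0) (y : Fin N → ℝ) (t : ℝ) : ∫ z, dil φ y t z = 0 := by
  simp only [dil]
  rw [integral_const_mul, integral_sub_right_eq_self (fun z => φ (t⁻¹ • z)) y,
    Measure.integral_comp_smul, hi]
  simp

lemma abs_dil_le (hL : ∀ ζ, |φ ζ| ≤ L) (y z : Fin N → ℝ) {t : ℝ} (ht : 0 < t) :
    |dil φ y t z| ≤ (t ^ N)⁻¹ * L := by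
  rw [dil, abs_mul, abs_of_pos (by positivity : (0 : ℝ) < (t ^ N)⁻¹)]
  exact mul_le_mul_of_nonneg_left (hL _) (by positivity)

lemma abs_dil_sub_le (hLip : ∀ ζ ζ', |φ ζ - φ ζ'| ≤ L * ‖ζ - ζ'‖) (y z z' : Fin N → ℝ) {t : ℝ}
    (ht : 0 < t) : |dil φ y t z - dil φ y t z'| ≤ L * (t ^ (N + 1))⁻¹ * ‖z - z'‖ := by
  rw [dil, dil, ← mul_sub, abs_mul, abs_of_pos (by positivity : (0 : ℝ) < (t ^ N)⁻¹)]
  refine (mul_le_mul_of_nonneg_left (hLip _ _) (by positivity)).trans_eq ?_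
  rw [← smul_sub, norm_smul, norm_inv, Real.norm_of_nonneg ht.le, sub_sub_sub_cancel_right,
    pow_succ, mul_inv]
  ring

lemma dpair_mker (hφ : Continuous φ) (hφc : HasCompactSupport φ) (c : ℤ → Fin N → ℝ) (k : ℤ)
    (x y : Fin N → ℝ) {t : ℝ} (ht : 0 < t) :
    dpair φ (mker c k x) y t = mdiff c k (dil φ y t) x := by
  rw [mdiff_eq_integral (integrable_dil hφ hφc y ht), dpair]
  congr 1; ext z
  rw [mul_comm, dil]

lemma avg_dil_eq_zero_of_floor (h0 : ∀ ζ, 1 < ‖ζ‖ → φ ζ = 0) (hi : ∫ ζ, φ ζ = 0)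
    (c : ℤ → Fin N → ℝ) (l : ℤ) (x y : Fin N → ℝ) {t : ℝ} (ht : 0 < t)
    (h : ∀ i, ⌊(y i - t - c l i) / (2 : ℝ) ^ l⌋ = ⌊(y i + t - c l i) / (2 : ℝ) ^ l⌋) :
    avg c l (dil φ y t) x = 0 := by
  have h2 : (0 : ℝ) < 2 ^ l := by positivity
  have hz : ∀ z, dil φ y t z ≠ 0 → ∀ i,
      ⌊(z i - c l i) / (2 : ℝ) ^ l⌋ = ⌊(y i - t - c l i) / (2 : ℝ) ^ l⌋ := by
    intro z hz i
    have hzy : ‖z - y‖ ≤ t := not_lt.1 fun hlt => hz (dil_eq_zero h0 ht hlt)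
    have hzi := (norm_le_pi_norm (z - y) i).trans hzy
    rw [Real.norm_eq_abs, Pi.sub_apply, abs_le] at hzi
    apply le_antisymm
    · rw [h i]
      exact Int.floor_mono ((div_le_div_iff_of_pos_right h2).2 (by linarith))
    · exact Int.floor_mono ((div_le_div_iff_of_pos_right h2).2 (by linarith))
  rw [avg, div_eq_zero_iff]
  left
  by_cases hx : ∀ i, ⌊(x i - c l i) / (2 : ℝ) ^ l⌋ = ⌊(y i - t - c l i) / (2 : ℝ) ^ l⌋
  · rw [setIntegral_eq_integral_of_forall_compl_eq_zero, integral_dil hi]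
    intro z hzx
    by_contra hne
    exact hzx (mem_dcube_iff.2 fun i => (hz z hne i).trans (hx i).symm)
  · refine (setIntegral_congr_fun (g := fun _ => 0) (measurableSet_dcube _ _ _)
      fun z hzx => ?_).trans (by simp)
    by_contra hne
    exact hx fun i => (mem_dcube_iff.1 hzx i).symm.trans (hz z hne i)

lemma avg_dil_eq_zero_of_lt (h0 : ∀ ζ, 1 < ‖ζ‖ → φ ζ = 0) (c : ℤ → Fin N → ℝ) (l : ℤ)
    (x y : Fin N → ℝ) {t : ℝ} (ht : 0 < t) (h : t + 2 ^ l < ‖y - x‖) :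
    avg c l (dil φ y t) x = 0 := by
  rw [avg, div_eq_zero_iff]
  left
  refine (setIntegral_congr_fun (g := fun _ => 0) (measurableSet_dcube _ _ _)
      fun z hzx => ?_).trans (by simp)
  refine dil_eq_zero h0 ht ?_
  have h1 := norm_sub_le_of_mem_dcube hzx
  have h2 := norm_sub_le_norm_sub_add_norm_sub y z x
  rw [norm_sub_rev y z] at h2
  linarith

lemma abs_avg_dil_le (hL0 : 0 ≤ L) (hL : ∀ ζ, |φ ζ| ≤ L) (h0 : ∀ ζ, 1 < ‖ζ‖ → φ ζ = 0)
    (c : ℤ → Fin N → ℝ) (l : ℤ) (x y : Fin N → ℝ) {t : ℝ} (ht : 0 < t) :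
    |avg c l (dil φ y t) x| ≤ L * 2 ^ N * (((2 : ℝ) ^ l) ^ N)⁻¹ := by
  rw [avg, abs_div, abs_of_pos (by positivity : (0 : ℝ) < ((2 : ℝ) ^ l) ^ N), div_eq_mul_inv]
  refine mul_le_mul_of_nonneg_right ?_ (by positivity)
  have hsub : dcube (c l) l x ∩ Metric.closedBall y t ⊆ dcube (c l) l x := Set.inter_subset_left
  rw [setIntegral_eq_of_subset_of_forall_sdiff_eq_zero (f := dil φ y t)
    (measurableSet_dcube _ _ _) hsub
    (fun z hz => dil_eq_zero h0 ht (by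
      have : ¬ dist z y ≤ t := fun h => hz.2 ⟨hz.1, h⟩
      rwa [dist_eq_norm, not_le] at this))]
  have hvol : volume (Metric.closedBall y t) = ENNReal.ofReal ((2 * t) ^ N) := by
    rw [Real.volume_pi_closedBall _ ht.le, Fintype.card_fin]
  have h := norm_setIntegral_le_of_norm_le_const (μ := volume) (f := dil φ y t)
    (s := dcube (c l) l x ∩ Metric.closedBall y t) (C := (t ^ N)⁻¹ * L)
    ((measure_mono Set.inter_subset_right).trans_lt (by rw [hvol]; exact ENNReal.ofReal_lt_top))
    (fun z _ => abs_dil_le hL y z ht)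
  rw [Real.norm_eq_abs] at h
  refine h.trans ?_
  have hr : volume.real (dcube (c l) l x ∩ Metric.closedBall y t) ≤ (2 * t) ^ N := by
    refine (measureReal_mono Set.inter_subset_right
      (by rw [hvol]; exact ENNReal.ofReal_ne_top)).trans_eq ?_
    rw [Measure.real, hvol, ENNReal.toReal_ofReal (by positivity)]
  refine (mul_le_mul_of_nonneg_left hr (by positivity)).trans_eq ?_
  rw [mul_pow]; field_simp

lemma abs_avg_dil_sub_le (hL0 : 0 ≤ L) (hφ : Continuous φ) (hφc : HasCompactSupport φ)
    (hLip : ∀ ζ ζ', |φ ζ - φ ζ'| ≤ L * ‖ζ - ζ'‖)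
    (c : ℤ → Fin N → ℝ) (l : ℤ) (x y : Fin N → ℝ) {t : ℝ} (ht : 0 < t) :
    |avg c l (dil φ y t) x - dil φ y t x| ≤ L * (t ^ (N + 1))⁻¹ * 2 ^ l := by
  have h2 : (0 : ℝ) < ((2 : ℝ) ^ l) ^ N := by positivity
  have hvol : volume.real (dcube (c l) l x) = ((2 : ℝ) ^ l) ^ N := by
    rw [Measure.real, volume_dcube, ENNReal.toReal_ofReal h2.le]
  have hlt : volume (dcube (c l) l x) < ⊤ := by rw [volume_dcube]; exact ENNReal.ofReal_lt_top
  have e : avg c l (dil φ y t) x - dil φ y t x =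
      (∫ z in dcube (c l) l x, (dil φ y t z - dil φ y t x)) / ((2 : ℝ) ^ l) ^ N := by
    rw [integral_sub (integrable_dil hφ hφc y ht).integrableOn (integrableOn_const hlt.ne),
      setIntegral_const, hvol, avg, smul_eq_mul, sub_div, mul_div_cancel_left₀ _ h2.ne']
  rw [e, abs_div, abs_of_pos h2, div_le_iff₀ h2]
  have h := norm_setIntegral_le_of_norm_le_const (μ := volume)
    (f := fun z => dil φ y t z - dil φ y t x) (s := dcube (c l) l x)
    (C := L * (t ^ (N + 1))⁻¹ * 2 ^ l) hlt (fun z hz =>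
      (abs_dil_sub_le hLip y z x ht).trans
        (mul_le_mul_of_nonneg_left (norm_sub_le_of_mem_dcube hz) (by positivity)))
  rwa [hvol, Real.norm_eq_abs] at h

open Classical in
/-- Indicator that the cube of radius `t` around `y` is not contained in a single cube of the
dyadic layer with sidelength `2^l` and offset `c`. -/
def chi (l : ℤ) (c y : Fin N → ℝ) (t : ℝ) : ℝ≥0∞ :=
  if ∀ i, ⌊(y i - t - c i) / (2 : ℝ) ^ l⌋ = ⌊(y i + t - c i) / (2 : ℝ) ^ l⌋ then 0 else 1

open Classical in
/-- The majorant of the kernel of the martingale difference `Δ_k` in the reproducing formula. -/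
def kmaj (N : ℕ) (c : ℤ → Fin N → ℝ) (k : ℤ) (x y : Fin N → ℝ) (t : ℝ) : ℝ≥0∞ :=
  if t < 2 ^ k then
    if ‖y - x‖ < 3 * 2 ^ k then
      ENNReal.ofReal (((2 : ℝ) ^ k) ^ N)⁻¹ * (chi (k - 1) (c (k - 1)) y t + chi k (c k) y t)
    else 0
  else if ‖y - x‖ < 3 * t then ENNReal.ofReal (2 ^ k * (t ^ (N + 1))⁻¹) else 0

lemma enorm_avg_dil_le_chi (hL0 : 0 ≤ L) (hL : ∀ ζ, |φ ζ| ≤ L) (h0 : ∀ ζ, 1 < ‖ζ‖ → φ ζ = 0)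
    (hi : ∫ ζ, φ ζ = 0) (c : ℤ → Fin N → ℝ) (l : ℤ) (x y : Fin N → ℝ) {t : ℝ} (ht : 0 < t) :
    ‖avg c l (dil φ y t) x‖ₑ ≤
      ENNReal.ofReal (L * 2 ^ N * (((2 : ℝ) ^ l) ^ N)⁻¹) * chi l (c l) y t := by
  unfold chi
  split_ifs with h
  · rw [avg_dil_eq_zero_of_floor h0 hi c l x y ht h]; simp
  · rw [mul_one, Real.enorm_eq_ofReal_abs]
    exact ENNReal.ofReal_le_ofReal (abs_avg_dil_le hL0 hL h0 c l x y ht)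

lemma enorm_dpair_mker_le (hφ : Continuous φ) (hφc : HasCompactSupport φ) (hL0 : 0 ≤ L)
    (hL : ∀ ζ, |φ ζ| ≤ L) (h0 : ∀ ζ, 1 < ‖ζ‖ → φ ζ = 0)
    (hi : ∫ ζ, φ ζ = 0) (hLip : ∀ ζ ζ', |φ ζ - φ ζ'| ≤ L * ‖ζ - ζ'‖)
    (c : ℤ → Fin N → ℝ) (k : ℤ) (x y : Fin N → ℝ) {t : ℝ} (ht : 0 < t) :
    ‖dpair φ (mker c k x) y t‖ₑ ≤ ENNReal.ofReal (L * 4 ^ N + 2 * L) * kmaj N c k x y t := by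
  rw [dpair_mker hφ hφc c k x y ht]
  have hk : (2 : ℝ) ^ (k - 1) * 2 = 2 ^ k := by rw [zpow_sub_one₀ two_ne_zero]; field_simp
  have hkp : (0 : ℝ) < 2 ^ (k - 1) := by positivity
  unfold kmaj
  by_cases htk : t < 2 ^ k
  · rw [if_pos htk]
    by_cases hxy : ‖y - x‖ < 3 * 2 ^ k
    · rw [if_pos hxy, mdiff]
      refine enorm_sub_le.trans ((add_le_add
        (enorm_avg_dil_le_chi hL0 hL h0 hi c (k - 1) x y ht)
        (enorm_avg_dil_le_chi hL0 hL h0 hi c k x y ht)).trans ?_)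
      rw [← mul_assoc, ← ENNReal.ofReal_mul (by positivity), mul_add]
      have hp : (0 : ℝ) < (((2 : ℝ) ^ k) ^ N)⁻¹ := by positivity
      have h24 : (2 : ℝ) ^ N ≤ 4 ^ N := pow_le_pow_left₀ (by norm_num) (by norm_num) _
      have e4 : (2 : ℝ) ^ N * (((2 : ℝ) ^ (k - 1)) ^ N)⁻¹ = 4 ^ N * (((2 : ℝ) ^ k) ^ N)⁻¹ := by
        rw [← hk, mul_pow, (by norm_num : (4 : ℝ) = 2 * 2), mul_pow]; field_simp
      refine add_le_add (mul_le_mul_left ?_ _) (mul_le_mul_left ?_ _) <;>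
        refine ENNReal.ofReal_le_ofReal ?_
      · rw [mul_assoc, e4, ← mul_assoc]
        exact mul_le_mul_of_nonneg_right (by linarith) hp.le
      · refine mul_le_mul_of_nonneg_right ?_ hp.le
        nlinarith
    · rw [mdiff, avg_dil_eq_zero_of_lt h0 c k x y ht (by linarith),
        avg_dil_eq_zero_of_lt h0 c (k - 1) x y ht (by linarith)]
      simp
  · rw [if_neg htk]
    by_cases hxy : ‖y - x‖ < 3 * t
    · rw [if_pos hxy, mdiff, Real.enorm_eq_ofReal_abs, ← ENNReal.ofReal_mul (by positivity)]
      refine ENNReal.ofReal_le_ofReal ?_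
      have h1 := abs_avg_dil_sub_le hL0 hφ hφc hLip c (k - 1) x y ht
      have h2 := abs_avg_dil_sub_le hL0 hφ hφc hLip c k x y ht
      have hq : 0 ≤ L * (t ^ (N + 1))⁻¹ := by positivity
      have h3 : L * (t ^ (N + 1))⁻¹ * 2 ^ (k - 1) ≤ L * (t ^ (N + 1))⁻¹ * 2 ^ k :=
        mul_le_mul_of_nonneg_left (by linarith) hq
      have h4 : 0 ≤ L * 4 ^ N * (2 ^ k * (t ^ (N + 1))⁻¹) := by positivity
      rw [abs_le] at h1 h2 ⊢
      constructor <;> nlinarith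
    · rw [mdiff, avg_dil_eq_zero_of_lt h0 c k x y ht (by linarith),
        avg_dil_eq_zero_of_lt h0 c (k - 1) x y ht (by linarith)]
      simp

end KernelBounds

lemma exists_bker_bound {N : ℕ} {η : (Fin N → ℝ) → ℝ} (hη : ContDiff ℝ 3 η)
    (hc : HasCompactSupport η) : ∃ L : ℝ, 0 ≤ L ∧ ∀ d, (∀ ζ, |bker η d ζ| ≤ L) ∧
      ∀ ζ ζ', |bker η d ζ - bker η d ζ'| ≤ L * ‖ζ - ζ'‖ := by
  have h : ∀ d, ∃ L : ℝ, 0 ≤ L ∧ (∀ ζ, |bker η d ζ| ≤ L) ∧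
      ∀ ζ ζ', |bker η d ζ - bker η d ζ'| ≤ L * ‖ζ - ζ'‖ := by
    intro d
    have hd := contDiff_bker hη d
    obtain ⟨B, hB⟩ := (hasCompactSupport_bker hc d).exists_bound_of_continuous hd.continuous
    obtain ⟨K, hK⟩ := hd.lipschitzWith_of_hasCompactSupport (hasCompactSupport_bker hc d)
      one_ne_zero
    refine ⟨max B K, le_max_of_le_right K.2, fun ζ => (hB ζ).trans (le_max_left _ _),
      fun ζ ζ' => ?_⟩
    have := hK.dist_le_mul ζ ζ'
    rw [Real.dist_eq, dist_eq_norm] at this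
    exact this.trans (mul_le_mul_of_nonneg_right (le_max_right _ _) (norm_nonneg _))
  choose L hL0 hL1 hL2 using h
  have hle : ∀ d, L d ≤ ∑ d, L d := fun d =>
    Finset.single_le_sum (fun i _ => hL0 i) (Finset.mem_univ d)
  exact ⟨∑ d, L d, Finset.sum_nonneg fun i _ => hL0 i, fun d => ⟨fun ζ => (hL1 d ζ).trans (hle d),
    fun ζ ζ' => (hL2 d ζ ζ').trans (mul_le_mul_of_nonneg_right (hle d) (norm_nonneg _))⟩⟩

/-- Pointwise control of martingale differences by the gradient of the Poisson extension. -/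
theorem exists_enorm_mdiff_le {N : ℕ} (hN : 0 < N) : ∃ C : ℝ, ∀ (f : (Fin N → ℝ) → ℝ),
    Integrable f → ∀ (c : ℤ → Fin N → ℝ) (k : ℤ) (x : Fin N → ℝ),
    ‖mdiff c k f x‖ₑ ≤ ENNReal.ofReal C * ∫⁻ t in Set.Ioi (0 : ℝ), ∫⁻ y,
      (∑ d, ‖pgrad N d f y t‖ₑ) * kmaj N c k x y t := by
  obtain ⟨η, hη, hc, hs, hη1⟩ := exists_bump N
  obtain ⟨L, hL0, hL⟩ := exists_bker_bound hη hc
  set a := ∫ u, psn N (u, 1) with ha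
  have ha0 : 0 < a := integral_psn_one_pos N
  refine ⟨a⁻¹ * (L * 4 ^ N + 2 * L), fun f hf c k x => ?_⟩
  have h := enorm_integral_mul_le hN hη hc hs hη1 hf (integrable_mker c k x)
    (measurable_mker c k x) (abs_mker_le c k x) (ae_continuousAt_mker c k x)
  rw [← mdiff_eq_integral hf, ← ha] at h
  have h2 : ∫⁻ t in Set.Ioi (0 : ℝ), ∫⁻ y, ∑ d, ‖pgrad N d f y t‖ₑ *
      ‖dpair (bker η d) (mker c k x) y t‖ₑ ≤ ENNReal.ofReal (L * 4 ^ N + 2 * L) *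
      ∫⁻ t in Set.Ioi (0 : ℝ), ∫⁻ y, (∑ d, ‖pgrad N d f y t‖ₑ) * kmaj N c k x y t := by
    rw [← lintegral_const_mul' _ _ ENNReal.ofReal_ne_top]
    refine setLIntegral_mono' measurableSet_Ioi fun t ht => ?_
    rw [← lintegral_const_mul' _ _ ENNReal.ofReal_ne_top]
    refine lintegral_mono fun y => ?_
    rw [Finset.sum_mul, Finset.mul_sum]
    refine Finset.sum_le_sum fun d _ => ?_
    rw [mul_left_comm]
    exact mul_le_mul_right (enorm_dpair_mker_le (contDiff_bker hη d).continuous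
      (hasCompactSupport_bker hc d) hL0 (hL d).1 (fun ζ => bker_eq_zero hs d)
      (integral_bker hη hc d) (hL d).2 c k x y ht) _
  rw [ENNReal.ofReal_mul (by positivity), mul_assoc, ENNReal.ofReal_inv_of_pos ha0,
    ← ENNReal.div_eq_inv_mul, ENNReal.le_div_iff_mul_le (Or.inl (by simpa using ha0))
    (Or.inl ENNReal.ofReal_ne_top), mul_comm]
  exact h.trans h2

/-! ### Boundary probabilities for random dyadic lattices -/

/-- The offsets for which the interval `(y - t, y + t]` contains an endpoint of the grid with
mesh `T`. -/
def cutSet (T y t : ℝ) : Set ℝ := {c | ⌊(y - t - c) / T⌋ ≠ ⌊(y + t - c) / T⌋}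

lemma measurableSet_cutSet (T y t : ℝ) : MeasurableSet (cutSet T y t) :=
  (measurableSet_eq_fun (by fun_prop) (by fun_prop)).compl

lemma cutSet_subset {T y t : ℝ} (hT : 0 < T) (ht : 0 < t) :
    cutSet T y t ⊆ ⋃ m : ℤ, (fun c => c + m • T) ⁻¹' Set.Ioc (y - t) (y + t) := by
  intro c hc
  have hlt : ⌊(y - t - c) / T⌋ < ⌊(y + t - c) / T⌋ := by
    refine lt_of_le_of_ne (Int.floor_mono ?_) hc
    exact (div_le_div_iff_of_pos_right hT).2 (by linarith)
  refine Set.mem_iUnion.2 ⟨⌊(y + t - c) / T⌋, ?_⟩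
  have h1 := Int.floor_lt.1 hlt
  have h2 := Int.floor_le ((y + t - c) / T)
  rw [div_lt_iff₀ hT] at h1
  rw [le_div_iff₀ hT] at h2
  simp only [Set.mem_preimage, Set.mem_Ioc, zsmul_eq_mul]
  constructor <;> linarith

lemma volume_cutSet_inter_Ico_le {T y t : ℝ} (hT : 0 < T) (ht : 0 < t) (s : ℝ) :
    volume (cutSet T y t ∩ Set.Ico s (s + T)) ≤ ENNReal.ofReal (2 * t) := by
  have h1 : cutSet T y t ∩ Set.Ico s (s + T) ⊆ ⋃ m : ℤ, (fun c => c + m • T) ⁻¹'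
      (Set.Ioc (y - t) (y + t) ∩ Set.Ico (s + m • T) (s + (m + 1) • T)) := by
    rintro c ⟨hc, hcs⟩
    obtain ⟨m, hm⟩ := Set.mem_iUnion.1 (cutSet_subset hT ht hc)
    refine Set.mem_iUnion.2 ⟨m, hm, ?_⟩
    simp only [Set.mem_Ico, zsmul_eq_mul, Int.cast_add, Int.cast_one] at hcs ⊢
    constructor <;> nlinarith
  calc volume (cutSet T y t ∩ Set.Ico s (s + T))
      ≤ ∑' m : ℤ, volume ((fun c => c + m • T) ⁻¹'
        (Set.Ioc (y - t) (y + t) ∩ Set.Ico (s + m • T) (s + (m + 1) • T))) :=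
        (measure_mono h1).trans (measure_iUnion_le _)
    _ = ∑' m : ℤ, volume (Set.Ioc (y - t) (y + t) ∩ Set.Ico (s + m • T) (s + (m + 1) • T)) := by
        simp only [measure_preimage_add_right]
    _ = volume (⋃ m : ℤ, Set.Ioc (y - t) (y + t) ∩ Set.Ico (s + m • T) (s + (m + 1) • T)) := by
        refine (measure_iUnion ?_ fun m => measurableSet_Ioc.inter measurableSet_Ico).symm
        intro m m' hmm
        exact ((Set.pairwise_disjoint_Ico_add_zsmul s T hmm).mono Set.inter_subset_right
          Set.inter_subset_right)
    _ ≤ ENNReal.ofReal (2 * t) := by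
        refine (measure_mono (Set.iUnion_subset fun m => Set.inter_subset_left)).trans_eq ?_
        rw [Real.volume_Ioc]; congr 1; ring

lemma volume_cutSet_inter_Ico_nat_mul_le {T y t : ℝ} (hT : 0 < T) (ht : 0 < t) (s : ℝ) (m : ℕ) :
    volume (cutSet T y t ∩ Set.Ico s (s + m * T)) ≤ m * ENNReal.ofReal (2 * t) := by
  induction m with
  | zero => simp
  | succ m ih =>
    have hm : (0 : ℝ) ≤ m * T := by positivity
    have e : Set.Ico s (s + (m + 1 : ℕ) * T) =
        Set.Ico s (s + m * T) ∪ Set.Ico (s + m * T) (s + m * T + T) := by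
      rw [Set.Ico_union_Ico_eq_Ico (by linarith) (by linarith)]
      congr 1; push_cast; ring
    rw [e, Set.inter_union_distrib_left, Nat.cast_succ, add_mul, one_mul]
    exact (measure_union_le _ _).trans (add_le_add ih (volume_cutSet_inter_Ico_le hT ht _))

/-- The sum of the first `k` digit contributions of `v` in the random offset. -/
def digitSum (k : ℕ) (v : ℝ) : ℝ :=
  ∑ j ∈ Finset.range k, (if ⌊v * 2 ^ (j + 1)⌋ % 2 = 1 then (2 : ℝ) ^ j else 0)

lemma measurable_digitSum (k : ℕ) : Measurable (digitSum k) := by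
  refine Finset.measurable_sum _ fun j _ => Measurable.ite ?_ measurable_const measurable_const
  have h : Measurable fun v : ℝ => ⌊v * 2 ^ (j + 1)⌋ := by fun_prop
  exact h (MeasurableSet.of_discrete (s := {m : ℤ | m % 2 = 1}))

lemma digitSum_succ_left {k : ℕ} {w : ℝ} (h0 : 0 ≤ w) (h1 : w < 1) :
    digitSum (k + 1) (w / 2) = 2 * digitSum k w := by
  have hf : ⌊w⌋ = 0 := Int.floor_eq_zero_iff.2 ⟨h0, h1⟩
  rw [digitSum, Finset.sum_range_succ', digitSum, Finset.mul_sum]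
  have e : ∀ j : ℕ, w / 2 * 2 ^ (j + 1 + 1) = w * 2 ^ (j + 1) := fun j => by
    rw [pow_succ 2 (j + 1)]; ring
  simp only [e]
  norm_num [hf]
  refine Finset.sum_congr rfl fun j _ => ?_
  split_ifs
  · rw [pow_succ]; ring
  · rfl

lemma digitSum_succ_right {k : ℕ} {w : ℝ} (h0 : 0 ≤ w) (h1 : w < 1) :
    digitSum (k + 1) ((w + 1) / 2) = 1 + 2 * digitSum k w := by
  have hf : ⌊w⌋ = 0 := Int.floor_eq_zero_iff.2 ⟨h0, h1⟩
  rw [digitSum, Finset.sum_range_succ', digitSum, Finset.mul_sum, add_comm]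
  have e : ∀ j : ℕ, ⌊(w + 1) / 2 * 2 ^ (j + 1 + 1)⌋ % 2 = ⌊w * 2 ^ (j + 1)⌋ % 2 := fun j => by
    have : (w + 1) / 2 * 2 ^ (j + 1 + 1) = w * 2 ^ (j + 1) + ((2 ^ (j + 1) : ℤ) : ℝ) := by
      push_cast; rw [pow_succ 2 (j + 1)]; ring
    rw [this, Int.floor_add_intCast, pow_succ]
    omega
  simp only [e]
  congr 1
  · norm_num [hf]
  · refine Finset.sum_congr rfl fun j _ => ?_
    split_ifs
    · rw [pow_succ]; ring
    · simp

lemma sum_range_two_mul {M : Type*} [AddCommMonoid M] (g : ℕ → M) (m : ℕ) :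
    ∑ c ∈ Finset.range (2 * m), g c =
      ∑ c ∈ Finset.range m, g (2 * c) + ∑ c ∈ Finset.range m, g (1 + 2 * c) := by
  induction m with
  | zero => simp
  | succ m ih =>
    rw [Nat.mul_succ, Finset.sum_range_succ, Finset.sum_range_succ, ih, Finset.sum_range_succ,
      Finset.sum_range_succ, add_comm 1 (2 * m)]
    abel

lemma lintegral_comp_two_mul (G : ℝ → ℝ≥0∞) (hG : Measurable G) :
    ∫⁻ v, G (2 * v) = 2⁻¹ * ∫⁻ w, G w := by
  have h := lintegral_map (μ := volume) hG (measurable_const_mul (2 : ℝ))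
  rw [Real.map_volume_mul_left two_ne_zero, lintegral_smul_measure] at h
  rw [← h, smul_eq_mul]
  congr 1
  rw [abs_of_pos (by norm_num), ENNReal.ofReal_inv_of_pos (by norm_num)]
  simp

lemma lintegral_digitSum (k : ℕ) (g : ℝ → ℝ≥0∞) (hg : Measurable g) :
    ∫⁻ v in Set.Ico (0 : ℝ) 1, g (digitSum k v) =
      (2 ^ k)⁻¹ * ∑ c ∈ Finset.range (2 ^ k), g c := by
  induction k generalizing g with
  | zero => simp [digitSum]
  | succ k ih =>
    set G : (ℝ → ℝ≥0∞) → ℝ → ℝ≥0∞ := fun h =>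
      (Set.Ico (0 : ℝ) 1).indicator (fun w => h (digitSum k w)) with hG
    have hGm : ∀ h, Measurable h → Measurable (G h) := fun h hh =>
      (hh.comp (measurable_digitSum k)).indicator measurableSet_Ico
    have hg0 : Measurable fun s => g (2 * s) := by fun_prop
    have hg1 : Measurable fun s => g (1 + 2 * s) := by fun_prop
    have key : ∀ v, (Set.Ico (0 : ℝ) 1).indicator (fun v => g (digitSum (k + 1) v)) v =
        G (fun s => g (2 * s)) (2 * v) + G (fun s => g (1 + 2 * s)) (2 * (v - 2⁻¹)) := by
      intro v
      simp only [hG, Set.indicator_apply, Set.mem_Ico]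
      by_cases h0 : 0 ≤ v ∧ v < 1
      · rw [if_pos h0]
        by_cases h1 : v < 1 / 2
        · rw [if_pos ⟨by linarith, by linarith⟩, if_neg (by rintro ⟨h, -⟩; linarith), add_zero,
            ← digitSum_succ_left (by linarith) (by linarith)]
          congr 2; ring
        · rw [if_neg (by rintro ⟨-, h⟩; linarith), if_pos ⟨by linarith, by linarith⟩, zero_add,
            ← digitSum_succ_right (by linarith) (by linarith)]
          congr 2; ring
      · rw [if_neg h0, if_neg (fun h => h0 ⟨by linarith, by linarith⟩),
          if_neg (fun h => h0 ⟨by linarith, by linarith⟩), add_zero]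
    rw [← lintegral_indicator measurableSet_Ico]
    simp only [key]
    have hGm0 : Measurable fun v => G (fun s => g (2 * s)) (2 * v) :=
      (hGm _ hg0).comp (measurable_const_mul 2)
    rw [lintegral_add_left hGm0, lintegral_comp_two_mul _ (hGm _ hg0),
      lintegral_sub_right_eq_self (fun v => G (fun s => g (1 + 2 * s)) (2 * v)),
      lintegral_comp_two_mul _ (hGm _ hg1)]
    simp only [hG]
    rw [lintegral_indicator measurableSet_Ico, lintegral_indicator measurableSet_Ico, ih _ hg0,
      ih _ hg1, pow_succ' 2 k, pow_succ' 2 k, sum_range_two_mul, ← mul_assoc, ← mul_assoc,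
      ENNReal.mul_inv (by simp) (by simp), ← mul_add]
    push_cast
    rfl

lemma lintegral_indicator_randOffset1_le {y t : ℝ} (ht : 0 < t) (l : ℤ) :
    ∫⁻ p : ℝ × ℝ, (cutSet (2 ^ l) y t).indicator 1 (randOffset1 p.1 p.2 l)
      ∂((volume.restrict (Set.Ico (0 : ℝ) 1)).prod (volume.restrict (Set.Ico (0 : ℝ) 1))) ≤
      ENNReal.ofReal (2 * t / 2 ^ l) := by
  set S := cutSet ((2 : ℝ) ^ l) y t with hS
  have hSm : MeasurableSet S := measurableSet_cutSet _ _ _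
  have hSi : Measurable (S.indicator (1 : ℝ → ℝ≥0∞)) := measurable_one.indicator hSm
  have h2 : (0 : ℝ) < 2 ^ l := by positivity
  have hro : ∀ u v, randOffset1 u v l = u - 1 - digitSum l.toNat v := fun u v => rfl
  simp only [hro]
  have hdm := measurable_digitSum l.toNat
  have hpt : ∀ c : ℕ, ∫⁻ u in Set.Ico (0 : ℝ) 1, S.indicator 1 (u - 1 - c) =
      volume (S ∩ Set.Ico (-1 - c : ℝ) (-c)) := by
    intro c
    have e : ∀ u : ℝ, (Set.Ico (0 : ℝ) 1).indicator (fun u => S.indicator 1 (u - 1 - c)) u =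
        (S ∩ Set.Ico (-1 - c : ℝ) (-c)).indicator (1 : ℝ → ℝ≥0∞) (u - (1 + c)) := by
      intro u
      rw [← sub_sub, Set.inter_comm, ← Set.indicator_indicator]
      have : u ∈ Set.Ico (0 : ℝ) 1 ↔ u - 1 - c ∈ Set.Ico (-1 - c : ℝ) (-c) := by
        simp only [Set.mem_Ico]
        constructor <;> rintro ⟨h, h'⟩ <;> constructor <;> linarith
      by_cases hu : u ∈ Set.Ico (0 : ℝ) 1
      · rw [Set.indicator_of_mem hu, Set.indicator_of_mem (this.1 hu)]
      · rw [Set.indicator_of_notMem hu, Set.indicator_of_notMem (mt this.2 hu)]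
    rw [← lintegral_indicator measurableSet_Ico]
    simp only [e]
    rw [lintegral_sub_right_eq_self, lintegral_indicator_one (hSm.inter measurableSet_Ico)]
  rw [lintegral_prod _ (by fun_prop)]
  have hin : ∀ u : ℝ, ∫⁻ v in Set.Ico (0 : ℝ) 1, S.indicator 1 (u - 1 - digitSum l.toNat v) =
      (2 ^ l.toNat)⁻¹ * ∑ c ∈ Finset.range (2 ^ l.toNat),
        (S.indicator 1 (u - 1 - (c : ℝ)) : ℝ≥0∞) := fun u =>
    lintegral_digitSum l.toNat (fun s => S.indicator 1 (u - 1 - s)) (by fun_prop)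
  simp only [hin]
  rw [lintegral_const_mul _ (by fun_prop), lintegral_finsetSum _ (fun c _ => by fun_prop)]
  simp only [hpt]
  have hsum : ∀ m : ℕ, ∑ c ∈ Finset.range m, volume (S ∩ Set.Ico (-1 - c : ℝ) (-c)) =
      volume (S ∩ Set.Ico (-m : ℝ) 0) := by
    intro m
    induction m with
    | zero => simp
    | succ m ih =>
      rw [Finset.sum_range_succ, ih, ← measure_union _ (hSm.inter measurableSet_Ico),
        ← Set.inter_union_distrib_left, Set.union_comm, Set.Ico_union_Ico_eq_Ico (by linarith)
        (by simp)]
      · congr 3; push_cast; ring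
      · refine Set.disjoint_left.2 fun a ha hb => ?_
        have := ha.2.1; have := hb.2.2; linarith
  rw [hsum]
  rcases le_or_gt l 0 with hl | hl
  · obtain ⟨m, rfl⟩ : ∃ m : ℕ, l = -m := ⟨(-l).toNat, by omega⟩
    have h := volume_cutSet_inter_Ico_nat_mul_le (y := y) h2 ht (-1) (2 ^ m)
    have e1 : (-1 : ℝ) + (2 ^ m : ℕ) * 2 ^ (-m : ℤ) = 0 := by
      rw [zpow_neg]; push_cast; rw [zpow_natCast, mul_inv_cancel₀ (by positivity)]; norm_num
    have e0 : (-(m : ℤ)).toNat = 0 := by omega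
    rw [e1] at h
    rw [e0]
    simp only [pow_zero, inv_one, one_mul, Nat.cast_one]
    refine h.trans_eq ?_
    have e2 : ((2 ^ m : ℕ) : ℝ≥0∞) = ENNReal.ofReal (2 ^ m) := by
      rw [ENNReal.ofReal_pow (by norm_num)]; simp
    rw [zpow_neg, zpow_natCast, div_inv_eq_mul, mul_comm (2 * t) (2 ^ m), e2,
      ← ENNReal.ofReal_mul (by positivity)]
  · obtain ⟨m, rfl⟩ : ∃ m : ℕ, l = m := ⟨l.toNat, by omega⟩
    have h := volume_cutSet_inter_Ico_le (y := y) h2 ht (-(2 ^ m : ℕ))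
    have e1 : (-(2 ^ m : ℕ) : ℝ) + 2 ^ (m : ℤ) = 0 := by simp
    rw [e1] at h
    rw [Int.toNat_natCast]
    refine (mul_le_mul_right h _).trans_eq ?_
    rw [zpow_natCast, ENNReal.ofReal_div_of_pos (by positivity), mul_comm, ← div_eq_mul_inv,
      ENNReal.ofReal_pow (by norm_num)]
    simp

lemma chi_le_sum {N : ℕ} (l : ℤ) (c y : Fin N → ℝ) (t : ℝ) :
    chi l c y t ≤ ∑ i, (cutSet (2 ^ l) (y i) t).indicator 1 (c i) := by
  unfold chi
  split_ifs with h
  · simp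
  · push Not at h
    obtain ⟨i, hi⟩ := h
    refine le_trans ?_ (Finset.single_le_sum (f := fun i =>
      ((cutSet (2 ^ l) (y i) t).indicator 1 (c i) : ℝ≥0∞)) (fun _ _ => zero_le)
      (Finset.mem_univ i))
    have : c i ∈ cutSet (2 ^ l) (y i) t := hi
    simp [this]

lemma measurable_randOffset1 (l : ℤ) : Measurable fun p : ℝ × ℝ => randOffset1 p.1 p.2 l := by
  have := measurable_digitSum l.toNat
  have h : (fun p : ℝ × ℝ => randOffset1 p.1 p.2 l) =
    fun p => p.1 - 1 - digitSum l.toNat p.2 := rfl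
  rw [h]; fun_prop

instance : IsProbabilityMeasure (volume.restrict (Set.Ico (0 : ℝ) 1)) :=
  ⟨by simp⟩

lemma lintegral_chi_le {N : ℕ} (l : ℤ) (y : Fin N → ℝ) {t : ℝ} (ht : 0 < t) :
    ∫⁻ ω, chi l (randOffset ω l) y t ∂randMeasure N ≤
      N * ENNReal.ofReal (2 * t / 2 ^ l) := by
  have hm : ∀ i, Measurable fun p : ℝ × ℝ =>
      ((cutSet (2 ^ l) (y i) t).indicator 1 (randOffset1 p.1 p.2 l) : ℝ≥0∞) := fun i =>
    (measurable_one.indicator (measurableSet_cutSet _ _ _)).comp (measurable_randOffset1 l)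
  refine (lintegral_mono fun ω => chi_le_sum l (randOffset ω l) y t).trans ?_
  have hm' : ∀ i, Measurable fun ω : RSpace N =>
      ((cutSet (2 ^ l) (y i) t).indicator 1 (randOffset ω l i) : ℝ≥0∞) := fun i =>
    (hm i).comp (measurable_pi_apply i)
  rw [lintegral_finsetSum _ (fun i _ => hm' i)]
  refine (Finset.sum_le_card_nsmul _ _ (ENNReal.ofReal (2 * t / 2 ^ l)) fun i _ => ?_).trans_eq
    (by simp)
  have hmp := measurePreserving_eval (fun _ : Fin N =>
    (volume.restrict (Set.Ico (0 : ℝ) 1)).prod (volume.restrict (Set.Ico (0 : ℝ) 1))) i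
  exact (hmp.lintegral_comp (hm i)).trans_le (lintegral_indicator_randOffset1_le ht l)

/-! ### A maximal function over balls of dyadic radius -/

section Maximal

variable {N : ℕ}

/-- The maximal function over centred sup-norm balls of dyadic radius (normalized by the
`N`-th power of the radius). -/
def maxFn (h : (Fin N → ℝ) → ℝ≥0∞) (x : Fin N → ℝ) : ℝ≥0∞ :=
  ⨆ j : ℤ, ENNReal.ofReal (((2 : ℝ) ^ j) ^ N)⁻¹ * ∫⁻ y in Metric.ball x (2 ^ j), h y

lemma measurable_lintegral_ball {M : Type*} [MeasurableSpace M] {h : (Fin N → ℝ) → ℝ≥0∞}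
    (hh : Measurable h) {a : M → Fin N → ℝ} (ha : Measurable a) {r : M → ℝ} (hr : Measurable r) :
    Measurable fun m => ∫⁻ y in Metric.ball (a m) (r m), h y := by
  have e : ∀ m, ∫⁻ y in Metric.ball (a m) (r m), h y
      = ∫⁻ y, Set.indicator {q : M × (Fin N → ℝ) | dist q.2 (a q.1) < r q.1}
          (fun q => h q.2) (m, y) := by
    intro m
    rw [← lintegral_indicator Metric.isOpen_ball.measurableSet]
    rfl
  simp only [e]
  refine Measurable.lintegral_prod_right ?_
  exact (hh.comp measurable_snd).indicator (measurableSet_lt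
    (measurable_snd.dist (ha.comp measurable_fst)) (hr.comp measurable_fst))

lemma measurable_maxFn {h : (Fin N → ℝ) → ℝ≥0∞} (hh : Measurable h) : Measurable (maxFn h) :=
  Measurable.iSup fun _ => (measurable_lintegral_ball hh measurable_id measurable_const).const_mul _

lemma volume_ball_mul_zpow (x : Fin N → ℝ) {τ : ℝ} (hτ : 0 < τ) (j : ℤ) :
    volume (Metric.ball x (τ * 2 ^ j)) =
      ENNReal.ofReal ((2 * τ) ^ N) * ENNReal.ofReal (((2 : ℝ) ^ j) ^ N) := by
  rw [Real.volume_pi_ball x (by positivity), ← ENNReal.ofReal_mul (by positivity), ← mul_pow,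
    Fintype.card_fin]
  congr 2; ring

lemma zpow_mul_inv_cancel_ennreal (j : ℤ) :
    ENNReal.ofReal (((2 : ℝ) ^ j) ^ N)⁻¹ * ENNReal.ofReal (((2 : ℝ) ^ j) ^ N) = 1 := by
  rw [← ENNReal.ofReal_mul (by positivity), inv_mul_cancel₀ (by positivity), ENNReal.ofReal_one]

lemma lintegral_ball_le_maxFn (h : (Fin N → ℝ) → ℝ≥0∞) (x : Fin N → ℝ) (j : ℤ) :
    ∫⁻ y in Metric.ball x (2 ^ j), h y ≤ ENNReal.ofReal (((2 : ℝ) ^ j) ^ N) * maxFn h x := by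
  have h1 := le_iSup (fun j : ℤ =>
    ENNReal.ofReal (((2 : ℝ) ^ j) ^ N)⁻¹ * ∫⁻ y in Metric.ball x (2 ^ j), h y) j
  calc ∫⁻ y in Metric.ball x (2 ^ j), h y
      = ENNReal.ofReal (((2 : ℝ) ^ j) ^ N) *
        (ENNReal.ofReal (((2 : ℝ) ^ j) ^ N)⁻¹ * ∫⁻ y in Metric.ball x (2 ^ j), h y) := by
        rw [← mul_assoc, mul_comm (ENNReal.ofReal _), zpow_mul_inv_cancel_ennreal, one_mul]
    _ ≤ _ := by gcongr; exact h1

lemma volume_lt_maxFn_trunc_le {h : (Fin N → ℝ) → ℝ≥0∞} {l : ℝ≥0∞} (J : ℤ) :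
    l * volume {x : Fin N → ℝ | ∃ j ≤ J, l <
      ENNReal.ofReal (((2 : ℝ) ^ j) ^ N)⁻¹ * ∫⁻ y in Metric.ball x (2 ^ j), h y}
      ≤ ENNReal.ofReal (10 ^ N) * ∫⁻ y, h y := by
  set t := {x : Fin N → ℝ | ∃ j ≤ J, l <
      ENNReal.ofReal (((2 : ℝ) ^ j) ^ N)⁻¹ * ∫⁻ y in Metric.ball x (2 ^ j), h y} with ht
  have hex : ∀ x : Fin N → ℝ, ∃ j ≤ J, x ∈ t → l <
      ENNReal.ofReal (((2 : ℝ) ^ j) ^ N)⁻¹ * ∫⁻ y in Metric.ball x (2 ^ j), h y := by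
    intro x
    by_cases hx : x ∈ t
    · obtain ⟨j, hj, hlt⟩ := hx
      exact ⟨j, hj, fun _ => hlt⟩
    · exact ⟨J, le_rfl, fun h => absurd h hx⟩
  choose j hjJ hj using hex
  obtain ⟨u, hut, hud, hcov⟩ := Vitali.exists_disjoint_subfamily_covering_enlargement_ball t
    (fun x => x) (fun x => (2 : ℝ) ^ j x) (2 ^ J)
    (fun x _ => zpow_le_zpow_right₀ (by norm_num) (hjJ x)) 5 (by norm_num)
  have hcount : u.Countable := hud.countable_of_isOpen (fun _ _ => Metric.isOpen_ball)
    fun x _ => ⟨x, Metric.mem_ball_self (by positivity)⟩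
  have hsub : t ⊆ ⋃ x ∈ u, Metric.ball x (5 * 2 ^ j x) := by
    intro x hx
    obtain ⟨b, hb, hsb⟩ := hcov x hx
    exact Set.mem_biUnion hb (hsb (Metric.mem_ball_self (by positivity)))
  have : Countable u := hcount.to_subtype
  calc l * volume t ≤ l * ∑' x : u, volume (Metric.ball (x : Fin N → ℝ) (5 * 2 ^ j x)) := by
        gcongr
        exact (measure_mono hsub).trans (measure_biUnion_le _ hcount _)
    _ = ∑' x : u, l * volume (Metric.ball (x : Fin N → ℝ) (5 * 2 ^ j x)) := by
        rw [ENNReal.tsum_mul_left]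
    _ ≤ ∑' x : u, ENNReal.ofReal (10 ^ N) *
          ∫⁻ y in Metric.ball (x : Fin N → ℝ) (2 ^ j x), h y := by
        refine ENNReal.tsum_le_tsum fun x => ?_
        rw [volume_ball_mul_zpow _ (by norm_num)]
        have h1 := (hj x (hut x.2)).le
        calc l * (ENNReal.ofReal ((2 * 5) ^ N) * ENNReal.ofReal (((2 : ℝ) ^ j x) ^ N))
            ≤ (ENNReal.ofReal (((2 : ℝ) ^ j x) ^ N)⁻¹ *
              ∫⁻ y in Metric.ball (x : Fin N → ℝ) (2 ^ j x), h y) *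
              (ENNReal.ofReal ((2 * 5) ^ N) * ENNReal.ofReal (((2 : ℝ) ^ j x) ^ N)) := by
              gcongr
          _ = (ENNReal.ofReal (((2 : ℝ) ^ j x) ^ N)⁻¹ * ENNReal.ofReal (((2 : ℝ) ^ j x) ^ N)) *
              (ENNReal.ofReal ((2 * 5) ^ N) *
              ∫⁻ y in Metric.ball (x : Fin N → ℝ) (2 ^ j x), h y) := by ring
          _ = _ := by rw [zpow_mul_inv_cancel_ennreal, one_mul]; norm_num
    _ = ENNReal.ofReal (10 ^ N) * ∫⁻ y in ⋃ x : u, Metric.ball (x : Fin N → ℝ) (2 ^ j x), h y := by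
        rw [ENNReal.tsum_mul_left, lintegral_iUnion
          (fun _ => Metric.isOpen_ball.measurableSet)]
        intro x y hxy
        exact hud x.2 y.2 fun e => hxy (Subtype.ext e)
    _ ≤ _ := by gcongr; exact Measure.restrict_le_self

lemma mul_volume_lt_maxFn_le (h : (Fin N → ℝ) → ℝ≥0∞) (l : ℝ≥0∞) :
    l * volume {x | l < maxFn h x} ≤ ENNReal.ofReal (10 ^ N) * ∫⁻ y, h y := by
  have e : {x | l < maxFn h x} = ⋃ m : ℕ, {x : Fin N → ℝ | ∃ j ≤ (m : ℤ), l <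
      ENNReal.ofReal (((2 : ℝ) ^ j) ^ N)⁻¹ * ∫⁻ y in Metric.ball x (2 ^ j), h y} := by
    ext x
    simp only [Set.mem_ofPred_eq, Set.mem_iUnion, maxFn, lt_iSup_iff]
    constructor
    · rintro ⟨j, hj⟩; exact ⟨j.toNat, j, Int.self_le_toNat j, hj⟩
    · rintro ⟨m, j, -, hj⟩; exact ⟨j, hj⟩
  have hmono : Monotone fun m : ℕ => {x : Fin N → ℝ | ∃ j ≤ (m : ℤ), l <
      ENNReal.ofReal (((2 : ℝ) ^ j) ^ N)⁻¹ * ∫⁻ y in Metric.ball x (2 ^ j), h y} := by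
    rintro m m' hmm x ⟨j, hj, hlt⟩
    exact ⟨j, hj.trans (by exact_mod_cast hmm), hlt⟩
  rw [e, hmono.measure_iUnion, ENNReal.mul_iSup]
  exact iSup_le fun m => volume_lt_maxFn_trunc_le m

lemma rpow_eq_lintegral {s : ℝ} (hs : 0 < s) (x : ℝ≥0∞) :
    x ^ s = ∫⁻ t in Set.Ioi (0 : ℝ), Set.indicator {t : ℝ | ENNReal.ofReal t < x}
      (fun t => ENNReal.ofReal (s * t ^ (s - 1))) t := by
  have key : ∀ a : ℝ, 0 ≤ a → ∫⁻ t in Set.Ioo (0 : ℝ) a, ENNReal.ofReal (s * t ^ (s - 1))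
      = ENNReal.ofReal (a ^ s) := by
    intro a ha
    have hint : IntervalIntegrable (fun t : ℝ => s * t ^ (s - 1)) volume 0 a :=
      (intervalIntegral.intervalIntegrable_rpow' (by linarith)).const_mul _
    rw [restrict_Ioo_eq_restrict_Ioc, ← ofReal_integral_eq_lintegral_ofReal hint.1,
      ← intervalIntegral.integral_of_le ha, intervalIntegral.integral_const_mul,
      integral_rpow (Or.inl (by linarith))]
    · congr 1
      rw [sub_add_cancel, Real.zero_rpow hs.ne']; field_simp; ring
    · filter_upwards [ae_restrict_mem measurableSet_Ioc] with t ht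
      have := ht.1.le
      positivity
  have hm : MeasurableSet {t : ℝ | ENNReal.ofReal t < x} :=
    measurableSet_lt ENNReal.measurable_ofReal measurable_const
  rw [lintegral_indicator hm, Measure.restrict_restrict hm]
  induction x with
  | top =>
    rw [ENNReal.top_rpow_of_pos hs]
    refine (ENNReal.eq_top_of_forall_nnreal_le fun r => ?_).symm
    have h1 := key ((r : ℝ) ^ s⁻¹) (by positivity)
    rw [← Real.rpow_mul r.coe_nonneg, inv_mul_cancel₀ hs.ne', Real.rpow_one, ENNReal.ofReal_coe_nnreal] at h1
    rw [← h1]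
    exact lintegral_mono_set fun t ht => ⟨ENNReal.ofReal_lt_top, ht.1⟩
  | coe a =>
    have e : {t : ℝ | ENNReal.ofReal t < (a : ℝ≥0∞)} ∩ Set.Ioi 0 = Set.Ioo 0 (a : ℝ) := by
      ext t
      simp only [Set.mem_inter_iff, Set.mem_ofPred_eq, Set.mem_Ioi, Set.mem_Ioo]
      rw [and_comm]
      refine and_congr_right fun ht => ?_
      rw [← ENNReal.ofReal_coe_nnreal, ENNReal.ofReal_lt_ofReal_iff_of_nonneg ht.le]
    rw [e, key _ a.coe_nonneg, ← ENNReal.ofReal_rpow_of_nonneg a.coe_nonneg hs.le, ENNReal.ofReal_coe_nnreal]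

lemma lintegral_rpow_eq_layer {α : Type*} [MeasurableSpace α] {μ : Measure α} [SFinite μ] {s : ℝ}
    (hs : 0 < s) {G H : α → ℝ≥0∞} (hG : Measurable G) (hH : Measurable H) :
    ∫⁻ a, H a * G a ^ s ∂μ = ∫⁻ t in Set.Ioi (0 : ℝ), ENNReal.ofReal (s * t ^ (s - 1)) *
      ∫⁻ a in {a | ENNReal.ofReal t < G a}, H a ∂μ := by
  have hS : MeasurableSet {q : α × ℝ | ENNReal.ofReal q.2 < G q.1} :=
    measurableSet_lt (ENNReal.measurable_ofReal.comp measurable_snd) (hG.comp measurable_fst)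
  have hF : Measurable (Function.uncurry fun (a : α) (t : ℝ) =>
      {q : α × ℝ | ENNReal.ofReal q.2 < G q.1}.indicator
        (fun q => H q.1 * ENNReal.ofReal (s * q.2 ^ (s - 1))) (a, t)) := by
    have : Measurable ({q : α × ℝ | ENNReal.ofReal q.2 < G q.1}.indicator
        (fun q => H q.1 * ENNReal.ofReal (s * q.2 ^ (s - 1)))) := by
      refine Measurable.indicator ?_ hS
      fun_prop
    exact this
  calc ∫⁻ a, H a * G a ^ s ∂μ = ∫⁻ a, (∫⁻ t in Set.Ioi (0 : ℝ),
        {q : α × ℝ | ENNReal.ofReal q.2 < G q.1}.indicator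
        (fun q => H q.1 * ENNReal.ofReal (s * q.2 ^ (s - 1))) (a, t)) ∂μ := by
        refine lintegral_congr fun a => ?_
        rw [rpow_eq_lintegral hs, ← lintegral_const_mul]
        · refine lintegral_congr fun t => ?_
          by_cases h : ENNReal.ofReal t < G a
          · rw [Set.indicator_of_mem (show t ∈ {t : ℝ | ENNReal.ofReal t < G a} from h),
              Set.indicator_of_mem (show (a, t) ∈ {q : α × ℝ | ENNReal.ofReal q.2 < G q.1} from h)]
          · rw [Set.indicator_of_notMem (show t ∉ {t : ℝ | ENNReal.ofReal t < G a} from h),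
              Set.indicator_of_notMem
                (show (a, t) ∉ {q : α × ℝ | ENNReal.ofReal q.2 < G q.1} from h), mul_zero]
        · exact Measurable.indicator (by fun_prop)
            (measurableSet_lt ENNReal.measurable_ofReal measurable_const)
    _ = ∫⁻ t in Set.Ioi (0 : ℝ), (∫⁻ a, {q : α × ℝ | ENNReal.ofReal q.2 < G q.1}.indicator
        (fun q => H q.1 * ENNReal.ofReal (s * q.2 ^ (s - 1))) (a, t) ∂μ) :=
        lintegral_lintegral_swap hF.aemeasurable
    _ = _ := by
        refine lintegral_congr fun t => ?_
        rw [← lintegral_const_mul _ hH, ← lintegral_indicator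
          (measurableSet_lt measurable_const hG)]
        refine lintegral_congr fun a => ?_
        by_cases h : ENNReal.ofReal t < G a
        · rw [Set.indicator_of_mem (show a ∈ {a | ENNReal.ofReal t < G a} from h),
              Set.indicator_of_mem (show (a, t) ∈ {q : α × ℝ | ENNReal.ofReal q.2 < G q.1} from h),
              mul_comm]
        · rw [Set.indicator_of_notMem (show a ∉ {a | ENNReal.ofReal t < G a} from h),
              Set.indicator_of_notMem
                (show (a, t) ∉ {q : α × ℝ | ENNReal.ofReal q.2 < G q.1} from h)]

lemma maxFn_le_add (h : (Fin N → ℝ) → ℝ≥0∞) (l : ℝ≥0∞) (x : Fin N → ℝ) :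
    maxFn h x ≤ maxFn ({y | l < h y}.indicator h) x + ENNReal.ofReal (2 ^ N) * l := by
  refine iSup_le fun j => ?_
  have h1 : ∫⁻ y in Metric.ball x (2 ^ j), h y ≤
      (∫⁻ y in Metric.ball x (2 ^ j), {y | l < h y}.indicator h y) +
        l * (ENNReal.ofReal (2 ^ N) * ENNReal.ofReal (((2 : ℝ) ^ j) ^ N)) := by
    have hv := volume_ball_mul_zpow x one_pos j
    rw [one_mul, mul_one] at hv
    rw [← hv, ← setLIntegral_const, ← lintegral_add_right _ measurable_const]
    refine lintegral_mono fun y => ?_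
    by_cases hy : l < h y
    · rw [Set.indicator_of_mem (show y ∈ {y | l < h y} from hy)]; exact le_self_add
    · rw [Set.indicator_of_notMem (show y ∉ {y | l < h y} from hy), zero_add]; exact not_lt.1 hy
  calc _ ≤ ENNReal.ofReal (((2 : ℝ) ^ j) ^ N)⁻¹ *
        ((∫⁻ y in Metric.ball x (2 ^ j), {y | l < h y}.indicator h y) +
        l * (ENNReal.ofReal (2 ^ N) * ENNReal.ofReal (((2 : ℝ) ^ j) ^ N))) := by gcongr
    _ = ENNReal.ofReal (((2 : ℝ) ^ j) ^ N)⁻¹ *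
        (∫⁻ y in Metric.ball x (2 ^ j), {y | l < h y}.indicator h y) +
        ENNReal.ofReal (2 ^ N) * l *
        (ENNReal.ofReal (((2 : ℝ) ^ j) ^ N)⁻¹ * ENNReal.ofReal (((2 : ℝ) ^ j) ^ N)) := by ring
    _ ≤ _ := by
        rw [zpow_mul_inv_cancel_ennreal, mul_one]
        gcongr
        exact le_iSup (fun j : ℤ => ENNReal.ofReal (((2 : ℝ) ^ j) ^ N)⁻¹ *
          ∫⁻ y in Metric.ball x (2 ^ j), {y | l < h y}.indicator h y) j

lemma volume_lt_maxFn_le {h : (Fin N → ℝ) → ℝ≥0∞} (hh : Measurable h) {t : ℝ} (ht : 0 < t) :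
    volume {x | ENNReal.ofReal t < maxFn h x} ≤
      ENNReal.ofReal (2 * 10 ^ N / t) *
        ∫⁻ y in {y | ENNReal.ofReal t < ENNReal.ofReal (2 ^ (N + 1)) * h y}, h y := by
  have hc : (0 : ℝ) < t / 2 ^ (N + 1) := by positivity
  have hsub : {x | ENNReal.ofReal t < maxFn h x} ⊆ {x | ENNReal.ofReal (t / 2) <
      maxFn ({y | ENNReal.ofReal (t / 2 ^ (N + 1)) < h y}.indicator h) x} := by
    intro x hx
    have h1 := lt_of_lt_of_le (show ENNReal.ofReal t < maxFn h x from hx)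
      (maxFn_le_add h (ENNReal.ofReal (t / 2 ^ (N + 1))) x)
    rw [← ENNReal.ofReal_mul (by positivity)] at h1
    have e : t = t / 2 + 2 ^ N * (t / 2 ^ (N + 1)) := by
      rw [pow_succ]; field_simp; norm_num
    nth_rewrite 1 [e] at h1
    rw [ENNReal.ofReal_add (by positivity) (by positivity)] at h1
    exact lt_of_add_lt_add_right h1
  have h2 := mul_volume_lt_maxFn_le ({y | ENNReal.ofReal (t / 2 ^ (N + 1)) < h y}.indicator h)
    (ENNReal.ofReal (t / 2))
  rw [lintegral_indicator (measurableSet_lt measurable_const hh)] at h2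
  have e3 : {y | ENNReal.ofReal t < ENNReal.ofReal (2 ^ (N + 1)) * h y} =
      {y | ENNReal.ofReal (t / 2 ^ (N + 1)) < h y} := by
    ext y
    simp only [Set.mem_ofPred_eq]
    rw [ENNReal.ofReal_div_of_pos (by positivity), ENNReal.div_lt_iff, mul_comm]
    · left; simp
    · left; simp
  rw [e3]
  calc _ ≤ volume {x | ENNReal.ofReal (t / 2) <
      maxFn ({y | ENNReal.ofReal (t / 2 ^ (N + 1)) < h y}.indicator h) x} := measure_mono hsub
    _ = ENNReal.ofReal (2 / t) * (ENNReal.ofReal (t / 2) * volume {x | ENNReal.ofReal (t / 2) <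
      maxFn ({y | ENNReal.ofReal (t / 2 ^ (N + 1)) < h y}.indicator h) x}) := by
        rw [← mul_assoc, ← ENNReal.ofReal_mul (by positivity)]
        have : 2 / t * (t / 2) = 1 := by field_simp
        rw [this, ENNReal.ofReal_one, one_mul]
    _ ≤ ENNReal.ofReal (2 / t) * (ENNReal.ofReal (10 ^ N) *
        ∫⁻ y in {y | ENNReal.ofReal (t / 2 ^ (N + 1)) < h y}, h y) := by gcongr
    _ = _ := by
        rw [← mul_assoc, ← ENNReal.ofReal_mul (by positivity)]
        congr 2; ring

/-- The strong type `(p, p)` maximal inequality. -/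
theorem exists_lintegral_maxFn_rpow_le (N : ℕ) {p : ℝ} (hp : 1 < p) : ∃ C : ℝ,
    ∀ h : (Fin N → ℝ) → ℝ≥0∞, Measurable h →
      ∫⁻ x, maxFn h x ^ p ≤ ENNReal.ofReal C * ∫⁻ x, h x ^ p := by
  refine ⟨p * (p - 1)⁻¹ * (2 * 10 ^ N) * ((2 : ℝ) ^ (N + 1)) ^ (p - 1), fun h hh => ?_⟩
  have hp0 : 0 < p := by linarith
  have hp1 : 0 < p - 1 := by linarith
  set K : ℝ := 2 * 10 ^ N
  have hK : 0 < K := by positivity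
  calc ∫⁻ x, maxFn h x ^ p = ∫⁻ x, 1 * maxFn h x ^ p := by simp
    _ = ∫⁻ t in Set.Ioi (0 : ℝ), ENNReal.ofReal (p * t ^ (p - 1)) *
        ∫⁻ a in {a | ENNReal.ofReal t < maxFn h a}, 1 :=
        lintegral_rpow_eq_layer hp0 (measurable_maxFn hh) measurable_const
    _ ≤ ∫⁻ t in Set.Ioi (0 : ℝ), ENNReal.ofReal (p * (p - 1)⁻¹ * K) *
        (ENNReal.ofReal ((p - 1) * t ^ (p - 1 - 1)) *
        ∫⁻ y in {y | ENNReal.ofReal t < ENNReal.ofReal (2 ^ (N + 1)) * h y}, h y) := by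
        refine setLIntegral_mono' measurableSet_Ioi fun t ht => ?_
        have ht0 : 0 < t := ht
        rw [setLIntegral_one]
        refine (mul_le_mul_right (volume_lt_maxFn_le hh ht0) _).trans_eq ?_
        rw [← mul_assoc, ← mul_assoc, ← ENNReal.ofReal_mul (by positivity),
          ← ENNReal.ofReal_mul (by positivity)]
        congr 2
        rw [Real.rpow_sub_one ht0.ne' (p - 1)]
        field_simp
        rfl
    _ = ENNReal.ofReal (p * (p - 1)⁻¹ * K) *
        ∫⁻ y, h y * (ENNReal.ofReal (2 ^ (N + 1)) * h y) ^ (p - 1) := by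
        rw [lintegral_const_mul' _ _ ENNReal.ofReal_ne_top,
          lintegral_rpow_eq_layer hp1 (hh.const_mul _) hh]
    _ = _ := by
        rw [ENNReal.ofReal_mul (q := ((2 : ℝ) ^ (N + 1)) ^ (p - 1)) (by positivity),
          mul_assoc (ENNReal.ofReal _), ← lintegral_const_mul _ (hh.pow_const _)]
        congr 1
        refine lintegral_congr fun y => ?_
        rw [ENNReal.mul_rpow_of_nonneg _ _ hp1.le, ENNReal.ofReal_rpow_of_pos (by positivity)]
        have e : h y ^ p = h y * h y ^ (p - 1) := by
          conv_lhs => rw [show p = 1 + (p - 1) by ring,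
            ENNReal.rpow_add_of_nonneg _ _ zero_le_one hp1.le, ENNReal.rpow_one]
        rw [e]; ring

end Maximal

/-! ### Weights -/

section Weights

variable {N : ℕ}

/-- The mass of `h` near `(y, t)`. -/
def bmass (h : (Fin N → ℝ) → ℝ≥0∞) (y : Fin N → ℝ) (t : ℝ) : ℝ≥0∞ :=
  ∫⁻ z in Metric.ball y (t / N), h z

/-- The exponent of the maximal inequality. -/
def pexp (N : ℕ) : ℝ := 1 + 1 / (4 * N)

/-- The weight on the upper half-space attached to a function `B`. -/
def wgt (B : (Fin N → ℝ) → ℝ≥0∞) (y : Fin N → ℝ) (t : ℝ) : ℝ≥0∞ :=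
  ENNReal.ofReal (t ^ (-((N : ℝ) + 1 / 4))) * bmass (fun z => B z ^ (pexp N)⁻¹) y t ^ pexp N

/-- The weight on `ℝ^N` attached to a function `B`. -/
def mwgt (B : (Fin N → ℝ) → ℝ≥0∞) (x : Fin N → ℝ) : ℝ≥0∞ :=
  maxFn (fun z => B z ^ (pexp N)⁻¹) x ^ pexp N

lemma one_lt_pexp (hN : 0 < N) : 1 < pexp N := by
  unfold pexp
  have : (0 : ℝ) < N := by exact_mod_cast hN
  have : 0 < 1 / (4 * (N : ℝ)) := by positivity
  linarith

lemma natCast_mul_pexp (hN : 0 < N) : (N : ℝ) * pexp N = N + 1 / 4 := by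
  unfold pexp
  have : (0 : ℝ) < N := by exact_mod_cast hN
  field_simp

lemma measurable_bmass {h : (Fin N → ℝ) → ℝ≥0∞} (hh : Measurable h) :
    Measurable fun q : (Fin N → ℝ) × ℝ => bmass h q.1 q.2 :=
  measurable_lintegral_ball hh measurable_fst (measurable_snd.div_const _)

lemma measurable_wgt {B : (Fin N → ℝ) → ℝ≥0∞} (hB : Measurable B) :
    Measurable fun q : (Fin N → ℝ) × ℝ => wgt B q.1 q.2 := by
  have := measurable_bmass (hB.pow_const (pexp N)⁻¹)
  unfold wgt
  exact Measurable.mul (by fun_prop) (this.pow_const _)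

lemma measurable_mwgt {B : (Fin N → ℝ) → ℝ≥0∞} (hB : Measurable B) : Measurable (mwgt B) :=
  (measurable_maxFn (hB.pow_const _)).pow_const _

lemma exists_lintegral_mwgt_le (hN : 0 < N) : ∃ C : ℝ, ∀ B : (Fin N → ℝ) → ℝ≥0∞, Measurable B →
    ∫⁻ x, mwgt B x ≤ ENNReal.ofReal C * ∫⁻ x, B x := by
  obtain ⟨C, hC⟩ := exists_lintegral_maxFn_rpow_le N (one_lt_pexp hN)
  refine ⟨C, fun B hB => (hC _ (hB.pow_const _)).trans_eq ?_⟩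
  congr 1
  refine lintegral_congr fun x => ?_
  rw [← ENNReal.rpow_mul, inv_mul_cancel₀ (by linarith [one_lt_pexp hN]), ENNReal.rpow_one]

lemma bmass_ne_top (hN : 0 < N) {B : (Fin N → ℝ) → ℝ≥0∞} (hi : ∫⁻ x, B x ≠ ⊤)
    (y : Fin N → ℝ) (t : ℝ) : bmass (fun z => B z ^ (pexp N)⁻¹) y t ≠ ⊤ := by
  have hp := one_lt_pexp hN
  have h1 : bmass (fun z => B z ^ (pexp N)⁻¹) y t ≤ ∫⁻ z in Metric.ball y (t / N), (1 + B z) := by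
    refine lintegral_mono fun z => ?_
    rcases le_total (B z) 1 with h | h
    · exact (ENNReal.rpow_le_one h (by positivity)).trans le_self_add
    · refine le_trans ?_ le_add_self
      conv_rhs => rw [← ENNReal.rpow_one (B z)]
      exact ENNReal.rpow_le_rpow_of_exponent_le h (inv_le_one_of_one_le₀ hp.le)
  refine ne_top_of_le_ne_top ?_ h1
  rw [lintegral_add_left measurable_const, setLIntegral_one]
  exact ENNReal.add_ne_top.2 ⟨measure_ball_lt_top.ne,
    ne_top_of_le_ne_top hi (setLIntegral_le_lintegral _ _)⟩

lemma bmass_pos (hN : 0 < N) {B : (Fin N → ℝ) → ℝ≥0∞} (hB : Measurable B) (h0 : ∀ x, B x ≠ 0)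
    (y : Fin N → ℝ) {t : ℝ} (ht : 0 < t) : 0 < bmass (fun z => B z ^ (pexp N)⁻¹) y t := by
  have hp := one_lt_pexp hN
  have hN' : (0 : ℝ) < N := by exact_mod_cast hN
  unfold bmass
  rw [setLIntegral_pos_iff (hB.pow_const _)]
  have e : Function.support (fun z => B z ^ (pexp N)⁻¹) = Set.univ := by
    ext z
    simp only [Function.mem_support, ne_eq, Set.mem_univ, iff_true]
    rw [ENNReal.rpow_eq_zero_iff_of_pos (by positivity)]
    exact h0 z
  rw [e, Set.univ_inter]
  exact Metric.measure_ball_pos _ _ (by positivity)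

lemma wgt_ne_top (hN : 0 < N) {B : (Fin N → ℝ) → ℝ≥0∞} (hi : ∫⁻ x, B x ≠ ⊤)
    (y : Fin N → ℝ) (t : ℝ) : wgt B y t ≠ ⊤ :=
  ENNReal.mul_ne_top ENNReal.ofReal_ne_top (ENNReal.rpow_ne_top_of_nonneg
    (by linarith [one_lt_pexp hN]) (bmass_ne_top hN hi y t))

lemma wgt_ne_zero (hN : 0 < N) {B : (Fin N → ℝ) → ℝ≥0∞} (hB : Measurable B) (h0 : ∀ x, B x ≠ 0)
    (hi : ∫⁻ x, B x ≠ ⊤) (y : Fin N → ℝ) {t : ℝ} (ht : 0 < t) : wgt B y t ≠ 0 := by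
  refine mul_ne_zero ?_ ?_
  · simp only [ne_eq, ENNReal.ofReal_eq_zero, not_le]; positivity
  · exact (ENNReal.rpow_pos (bmass_pos hN hB h0 y ht) (bmass_ne_top hN hi y t)).ne'

lemma setLIntegral_bmass_le (hN : 0 < N) {h : (Fin N → ℝ) → ℝ≥0∞} (hh : Measurable h)
    (x : Fin N → ℝ) {t ρ R : ℝ} (ht : 0 < t)
    (hsub : ∀ y ∈ Metric.ball x ρ, Metric.ball y (t / N) ⊆ Metric.ball x R) :
    ∫⁻ y in Metric.ball x ρ, bmass h y t ≤
      ENNReal.ofReal ((2 * t) ^ N) * ∫⁻ z in Metric.ball x R, h z := by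
  have hN' : (0 : ℝ) < N := by exact_mod_cast hN
  have hN1 : (1 : ℝ) ≤ N := by exact_mod_cast hN
  have hS : MeasurableSet {q : (Fin N → ℝ) × (Fin N → ℝ) | dist q.2 q.1 < t / N} :=
    measurableSet_lt (measurable_snd.dist measurable_fst) measurable_const
  calc ∫⁻ y in Metric.ball x ρ, bmass h y t
      ≤ ∫⁻ y in Metric.ball x ρ, ∫⁻ z in Metric.ball x R,
        {q : (Fin N → ℝ) × (Fin N → ℝ) | dist q.2 q.1 < t / N}.indicator (fun q => h q.2) (y, z) := by
        refine setLIntegral_mono' Metric.isOpen_ball.measurableSet fun y hy => ?_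
        unfold bmass
        rw [← lintegral_indicator Metric.isOpen_ball.measurableSet,
          ← lintegral_indicator Metric.isOpen_ball.measurableSet]
        refine lintegral_mono fun z => ?_
        by_cases hz : z ∈ Metric.ball y (t / N)
        · rw [Set.indicator_of_mem hz, Set.indicator_of_mem (hsub y hy hz),
            Set.indicator_of_mem (by exact hz)]
        · rw [Set.indicator_of_notMem hz]; exact bot_le
    _ = ∫⁻ z in Metric.ball x R, ∫⁻ y in Metric.ball x ρ,
        {q : (Fin N → ℝ) × (Fin N → ℝ) | dist q.2 q.1 < t / N}.indicator (fun q => h q.2) (y, z) :=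
        lintegral_lintegral_swap
          ((hh.comp measurable_snd).indicator hS).aemeasurable
    _ ≤ ∫⁻ z in Metric.ball x R, ENNReal.ofReal ((2 * t) ^ N) * h z := by
        refine lintegral_mono fun z => ?_
        refine (setLIntegral_le_lintegral _ _).trans ?_
        have e : ∀ y, {q : (Fin N → ℝ) × (Fin N → ℝ) | dist q.2 q.1 < t / N}.indicator
            (fun q => h q.2) (y, z) = (Metric.ball z (t / N)).indicator (fun _ => h z) y := by
          intro y
          by_cases hy : dist z y < t / N
          · rw [Set.indicator_of_mem (by exact hy),
              Set.indicator_of_mem (by rw [Metric.mem_ball, dist_comm]; exact hy)]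
          · rw [Set.indicator_of_notMem (by exact hy),
              Set.indicator_of_notMem (by rw [Metric.mem_ball, dist_comm]; exact hy)]
        simp only [e]
        rw [lintegral_indicator Metric.isOpen_ball.measurableSet, setLIntegral_const, mul_comm,
          Real.volume_pi_ball _ (by positivity), Fintype.card_fin]
        gcongr
        exact div_le_self ht.le hN1
    _ = _ := lintegral_const_mul _ hh

lemma wgt_const_identity (hN : 0 < N) {t : ℝ} (ht : 0 < t) (j : ℤ) :
    t ^ (-((N : ℝ) + 1 / 4)) * (2 * t) ^ N * (((2 : ℝ) ^ j) ^ N) ^ pexp N =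
      2 ^ N * t ^ (-(1 / 4 : ℝ)) * ((2 : ℝ) ^ j) ^ ((N : ℝ) + 1 / 4) := by
  have hj : (0 : ℝ) < 2 ^ j := by positivity
  rw [← Real.rpow_natCast ((2 : ℝ) ^ j) N, ← Real.rpow_mul hj.le,
    natCast_mul_pexp hN, mul_pow, neg_add, Real.rpow_add ht, Real.rpow_neg ht.le (N : ℝ),
    Real.rpow_natCast t]
  field_simp

lemma rpow_pexp_eq (hN : 0 < N) (a : ℝ≥0∞) : a ^ pexp N = a * a ^ (pexp N - 1) := by
  conv_lhs => rw [show pexp N = 1 + (pexp N - 1) by ring,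
    ENNReal.rpow_add_of_nonneg _ _ zero_le_one (by linarith [one_lt_pexp hN]), ENNReal.rpow_one]

lemma setLIntegral_bmass_rpow_le (hN : 0 < N) {h : (Fin N → ℝ) → ℝ≥0∞} (hh : Measurable h)
    (x : Fin N → ℝ) {t ρ R : ℝ} (ht : 0 < t)
    (hsub : ∀ y ∈ Metric.ball x ρ, Metric.ball y (t / N) ⊆ Metric.ball x R) :
    ∫⁻ y in Metric.ball x ρ, bmass h y t ^ pexp N ≤
      ENNReal.ofReal ((2 * t) ^ N) * (∫⁻ z in Metric.ball x R, h z) ^ pexp N := by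
  have hp := one_lt_pexp hN
  set K := ∫⁻ z in Metric.ball x R, h z with hK
  have hm : Measurable fun y => bmass h y t :=
    measurable_lintegral_ball hh measurable_id measurable_const
  have h1 : ∀ y ∈ Metric.ball x ρ, bmass h y t ^ pexp N ≤ K ^ (pexp N - 1) * bmass h y t := by
    intro y hy
    rw [rpow_pexp_eq hN, mul_comm]
    exact mul_le_mul_left (ENNReal.rpow_le_rpow (lintegral_mono_set (hsub y hy)) (by linarith)) _
  have h2 : ∫⁻ y in Metric.ball x ρ, bmass h y t ^ pexp N ≤
      ∫⁻ y in Metric.ball x ρ, K ^ (pexp N - 1) * bmass h y t :=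
    setLIntegral_mono' Metric.isOpen_ball.measurableSet h1
  rw [lintegral_const_mul _ hm] at h2
  have h3 := mul_le_mul_right (setLIntegral_bmass_le hN hh x ht hsub) (K ^ (pexp N - 1))
  have h4 : K ^ (pexp N - 1) * (ENNReal.ofReal ((2 * t) ^ N) * K) =
      ENNReal.ofReal ((2 * t) ^ N) * K ^ pexp N := by
    rw [rpow_pexp_eq hN K, mul_left_comm, mul_comm K]
  exact (h2.trans h3).trans_eq h4

/-- Averages of the weight are controlled by the maximal function. -/
lemma setLIntegral_wgt_le (hN : 0 < N) {B : (Fin N → ℝ) → ℝ≥0∞} (hB : Measurable B)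
    (x : Fin N → ℝ) {t ρ : ℝ} (ht : 0 < t) (j : ℤ) (hρ : ρ + t / N ≤ 2 ^ j) :
    ∫⁻ y in Metric.ball x ρ, wgt B y t ≤
      ENNReal.ofReal (2 ^ N * t ^ (-(1 / 4 : ℝ)) * ((2 : ℝ) ^ j) ^ ((N : ℝ) + 1 / 4)) *
        mwgt B x := by
  have hp := one_lt_pexp hN
  have hh : Measurable fun z => B z ^ (pexp N)⁻¹ := hB.pow_const _
  have hsub : ∀ y ∈ Metric.ball x ρ, Metric.ball y (t / N) ⊆ Metric.ball x (2 ^ j) := by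
    intro y hy
    refine Metric.ball_subset_ball' ?_
    have := Metric.mem_ball.1 hy
    linarith
  unfold wgt mwgt
  rw [lintegral_const_mul' _ _ ENNReal.ofReal_ne_top]
  refine (mul_le_mul_right ((setLIntegral_bmass_rpow_le hN hh x ht hsub).trans
    (mul_le_mul_right (ENNReal.rpow_le_rpow (lintegral_ball_le_maxFn _ x j)
      (by linarith)) _)) _).trans_eq ?_
  rw [ENNReal.mul_rpow_of_nonneg _ _ (by linarith), ENNReal.ofReal_rpow_of_pos (by positivity),
    ← mul_assoc, ← mul_assoc, ← ENNReal.ofReal_mul (by positivity),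
    ← ENNReal.ofReal_mul (by positivity), wgt_const_identity hN ht j]

/-- A lower bound for the weight. -/
lemma exists_inv_wgt_le (hN : 0 < N) : ∃ C : ℝ, ∀ B : (Fin N → ℝ) → ℝ≥0∞, Measurable B →
    (∀ x, B x ≠ 0) → ∫⁻ x, B x ≠ ⊤ → ∀ y, ∀ t, 0 < t →
    (wgt B y t)⁻¹ ≤ ENNReal.ofReal (C * t ^ (-(N : ℝ))) *
      ∫⁻ z in Metric.ball y (t / N), (B z)⁻¹ := by
  have hp := one_lt_pexp hN
  have hN' : (0 : ℝ) < N := by exact_mod_cast hN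
  have hN1 : (1 : ℝ) ≤ N := by exact_mod_cast hN
  set p := pexp N with hpdef
  have hp0 : 0 < p := by linarith
  refine ⟨((2 / N : ℝ) ^ (2 * (N : ℝ) + 1 / 4))⁻¹, fun B hB h0 hi y t ht => ?_⟩
  set J := bmass (fun z => B z ^ p⁻¹) y t with hJ
  have hBt : ∀ᵐ z, B z ≠ ⊤ := (ae_lt_top hB hi).mono fun _ h => h.ne
  set P : ℝ := 1 + p⁻¹
  set Q : ℝ := p + 1
  have hPQ : P.HolderConjugate Q := by
    rw [Real.holderConjugate_iff]
    constructor
    · have : 0 < p⁻¹ := by positivity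
      simp only [P]; linarith
    · simp only [P, Q]; field_simp
  have hP0 : 0 < P := by positivity
  have hQ0 : 0 < Q := by positivity
  have hold := ENNReal.lintegral_mul_le_Lp_mul_Lq (volume.restrict (Metric.ball y (t / N))) hPQ
    (f := fun z => B z ^ (p⁻¹ / P)) (g := fun z => (B z)⁻¹ ^ (Q⁻¹))
    (hB.pow_const _).aemeasurable (hB.inv.pow_const _).aemeasurable
  have hl : ∫⁻ z in Metric.ball y (t / N), ((fun z => B z ^ (p⁻¹ / P)) * fun z => (B z)⁻¹ ^ (Q⁻¹)) z
      = ENNReal.ofReal ((2 * (t / N)) ^ N) := by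
    rw [lintegral_congr_ae (g := fun _ => 1), setLIntegral_one,
      Real.volume_pi_ball _ (by positivity), Fintype.card_fin]
    filter_upwards [ae_restrict_of_ae hBt] with z hz
    simp only [Pi.mul_apply]
    have e : p⁻¹ / P = Q⁻¹ := by simp only [P, Q]; field_simp
    rw [e, ← ENNReal.mul_rpow_of_nonneg _ _ (by positivity), ENNReal.mul_inv_cancel (h0 z) hz,
      ENNReal.one_rpow]
  rw [hl] at hold
  have e1 : ∀ z, (B z ^ (p⁻¹ / P)) ^ P = B z ^ p⁻¹ := fun z => by
    rw [← ENNReal.rpow_mul, div_mul_cancel₀ _ hP0.ne']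
  have e2 : ∀ z, ((B z)⁻¹ ^ (Q⁻¹)) ^ Q = (B z)⁻¹ := fun z => by
    rw [← ENNReal.rpow_mul, inv_mul_cancel₀ hQ0.ne', ENNReal.rpow_one]
  simp only [e1, e2] at hold
  have hold2 := ENNReal.rpow_le_rpow hold hQ0.le
  rw [ENNReal.mul_rpow_of_nonneg _ _ hQ0.le, ← ENNReal.rpow_mul, ← ENNReal.rpow_mul,
    one_div_mul_cancel hQ0.ne', ENNReal.rpow_one,
    show 1 / P * Q = p by simp only [P, Q]; field_simp,
    ENNReal.ofReal_rpow_of_pos (by positivity)] at hold2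
  change _ ≤ J ^ p * _ at hold2
  set K := ∫⁻ z in Metric.ball y (t / N), (B z)⁻¹
  have hJ0 : J ^ p ≠ 0 := (ENNReal.rpow_pos (bmass_pos hN hB h0 y ht) (bmass_ne_top hN hi y t)).ne'
  have hJt : J ^ p ≠ ⊤ := ENNReal.rpow_ne_top_of_nonneg hp0.le (bmass_ne_top hN hi y t)
  have e3 : ((2 * (t / N)) ^ N : ℝ) ^ Q =
      (2 / N : ℝ) ^ (2 * (N : ℝ) + 1 / 4) * t ^ (2 * (N : ℝ) + 1 / 4) := by
    rw [← Real.mul_rpow (by positivity) (by positivity), ← Real.rpow_natCast,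
      ← Real.rpow_mul (by positivity)]
    congr 1
    · ring
    · simp only [Q]; rw [mul_add, natCast_mul_pexp hN]; ring
  have hb : (0 : ℝ) < (2 / N : ℝ) ^ (2 * (N : ℝ) + 1 / 4) := by positivity
  unfold wgt
  rw [ENNReal.mul_inv (Or.inr hJt) (Or.inr hJ0), ← ENNReal.ofReal_inv_of_pos (by positivity)]
  calc ENNReal.ofReal (t ^ (-((N : ℝ) + 1 / 4)))⁻¹ * (J ^ p)⁻¹
      = ENNReal.ofReal (((2 / N : ℝ) ^ (2 * (N : ℝ) + 1 / 4))⁻¹ * t ^ (-(N : ℝ))) *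
        (ENNReal.ofReal (((2 * (t / N)) ^ N : ℝ) ^ Q) * (J ^ p)⁻¹) := by
        rw [← mul_assoc, ← ENNReal.ofReal_mul (by positivity), e3]
        congr 2
        have e4 : t ^ (2 * (N : ℝ) + 1 / 4) = t ^ (N : ℝ) * t ^ ((N : ℝ) + 1 / 4) := by
          rw [← Real.rpow_add ht]; congr 1; ring
        rw [e4, Real.rpow_neg ht.le, Real.rpow_neg ht.le]
        field_simp
    _ ≤ _ := by
        gcongr
        calc _ ≤ J ^ p * K * (J ^ p)⁻¹ := by gcongr
          _ = J ^ p * (J ^ p)⁻¹ * K := by ring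
          _ = K := by rw [ENNReal.mul_inv_cancel hJ0 hJt, one_mul]

end Weights

/-! ### Estimates for the majorant of the kernel -/

section KernelEstimates

variable {N : ℕ}

lemma measurable_comp_of_countable {ι A γ M : Type*} [Countable ι] [MeasurableSpace ι]
    [MeasurableSingletonClass ι] [MeasurableSpace A] [MeasurableSpace γ] [MeasurableSpace M]
    {f : ι → A → γ} (hf : ∀ i, Measurable (f i)) {k : M → ι} (hk : Measurable k) {a : M → A}
    (ha : Measurable a) : Measurable fun m => f (k m) (a m) :=
  (measurable_from_prod_countable_right (f := fun q : ι × A => f q.1 q.2) hf).comp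
    (hk.prodMk ha)

lemma measurable_randOffset (k : ℤ) : Measurable fun ω : RSpace N => randOffset ω k :=
  measurable_pi_lambda _ fun i => (measurable_randOffset1 k).comp (measurable_pi_apply i)

lemma measurable_chi (l : ℤ) {M : Type*} [MeasurableSpace M] {c y : M → Fin N → ℝ} {t : M → ℝ}
    (hc : Measurable c) (hy : Measurable y) (ht : Measurable t) :
    Measurable fun m => chi l (c m) (y m) (t m) := by
  classical
  unfold chi
  refine Measurable.ite ?_ measurable_const measurable_const
  rw [Set.ofPred_forall]
  refine MeasurableSet.iInter fun i => measurableSet_eq_fun ?_ ?_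
  · exact Int.measurable_floor.comp (((((measurable_pi_apply i).comp hy).sub ht).sub
      ((measurable_pi_apply i).comp hc)).div_const _)
  · exact Int.measurable_floor.comp (((((measurable_pi_apply i).comp hy).add ht).sub
      ((measurable_pi_apply i).comp hc)).div_const _)

lemma measurable_kmaj {M : Type*} [MeasurableSpace M] {ω : M → RSpace N} {k : M → ℤ}
    {x y : M → Fin N → ℝ} {t : M → ℝ} (hω : Measurable ω) (hk : Measurable k) (hx : Measurable x)
    (hy : Measurable y) (ht : Measurable t) :
    Measurable fun m => kmaj N (randOffset (ω m)) (k m) (x m) (y m) (t m) := by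
  refine measurable_comp_of_countable
    (f := fun k (q : RSpace N × (Fin N → ℝ) × (Fin N → ℝ) × ℝ) =>
      kmaj N (randOffset q.1) k q.2.1 q.2.2.1 q.2.2.2) (fun k => ?_) hk
    (hω.prodMk (hx.prodMk (hy.prodMk ht)))
  have mt : Measurable fun q : RSpace N × (Fin N → ℝ) × (Fin N → ℝ) × ℝ => q.2.2.2 := by fun_prop
  have md : Measurable fun q : RSpace N × (Fin N → ℝ) × (Fin N → ℝ) × ℝ => ‖q.2.2.1 - q.2.1‖ := by
    fun_prop
  have mc : ∀ l, Measurable fun q : RSpace N × (Fin N → ℝ) × (Fin N → ℝ) × ℝ =>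
      chi l (randOffset q.1 l) q.2.2.1 q.2.2.2 := fun l =>
    measurable_chi l ((measurable_randOffset l).comp measurable_fst) (by fun_prop) (by fun_prop)
  unfold kmaj
  refine Measurable.ite (measurableSet_lt mt measurable_const) (Measurable.ite
    (measurableSet_lt md measurable_const) (((mc _).add (mc _)).const_mul _) measurable_const)
    (Measurable.ite (measurableSet_lt md (mt.const_mul 3)) (by fun_prop) measurable_const)

open Classical in
/-- The auxiliary factor in the Schur test. -/
def afac (k : ℤ) (t : ℝ) : ℝ := if t < 2 ^ k then Real.sqrt (t / 2 ^ k) else 1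

lemma afac_pos (k : ℤ) {t : ℝ} (ht : 0 < t) : 0 < afac k t := by
  unfold afac; split_ifs <;> positivity

lemma measurable_afac {M : Type*} [MeasurableSpace M] {k : M → ℤ} {t : M → ℝ} (hk : Measurable k)
    (ht : Measurable t) : Measurable fun m => afac (k m) (t m) := by
  refine measurable_comp_of_countable (f := afac) (fun k => ?_) hk ht
  unfold afac
  exact Measurable.ite (measurableSet_lt measurable_id measurable_const) (by fun_prop)
    measurable_const

lemma chi_le_one (l : ℤ) (c y : Fin N → ℝ) (t : ℝ) : chi l c y t ≤ 1 := by
  unfold chi; split_ifs <;> simp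

open Classical in
/-- The size of the Schur integrals at scale `2 ^ k`. -/
def tfac (k : ℤ) (t : ℝ) : ℝ := if t < 2 ^ k then Real.sqrt (t / 2 ^ k) else 2 ^ k / t

lemma volume_setOf_norm_sub_lt (y : Fin N → ℝ) {r : ℝ} (hr : 0 < r) :
    volume {x : Fin N → ℝ | ‖y - x‖ < r} = ENNReal.ofReal ((2 * r) ^ N) := by
  have : {x : Fin N → ℝ | ‖y - x‖ < r} = Metric.ball y r := by
    ext x; rw [Metric.mem_ball, dist_eq_norm, norm_sub_rev]; rfl
  rw [this, Real.volume_pi_ball _ hr, Fintype.card_fin]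

lemma lintegral_ite_const {α : Type*} [MeasurableSpace α] {μ : Measure α} (p : α → Prop)
    [DecidablePred p] (hp : MeasurableSet {x | p x}) (b : ℝ≥0∞) :
    ∫⁻ x, (if p x then b else 0) ∂μ = b * μ {x | p x} := by
  rw [← setLIntegral_const, ← lintegral_indicator hp]
  refine lintegral_congr fun x => ?_
  by_cases h : p x
  · rw [if_pos h, Set.indicator_of_mem (by exact h)]
  · rw [if_neg h, Set.indicator_of_notMem (by exact h)]

lemma lintegral_kmaj_left (c : ℤ → Fin N → ℝ) (k : ℤ) (y : Fin N → ℝ) {t : ℝ} (ht : 0 < t) :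
    ∫⁻ x, kmaj N c k x y t = if t < 2 ^ k then
      ENNReal.ofReal (6 ^ N) * (chi (k - 1) (c (k - 1)) y t + chi k (c k) y t)
    else ENNReal.ofReal (6 ^ N * (2 ^ k / t)) := by
  have hT : (0 : ℝ) < 2 ^ k := by positivity
  have hms : ∀ r : ℝ, MeasurableSet {x : Fin N → ℝ | ‖y - x‖ < r} := fun r =>
    measurableSet_lt (by fun_prop) measurable_const
  unfold kmaj
  split_ifs with h
  · rw [lintegral_ite_const _ (hms _), volume_setOf_norm_sub_lt y (by positivity),
      mul_right_comm, ← ENNReal.ofReal_mul (by positivity)]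
    congr 2
    rw [show (2 : ℝ) * (3 * 2 ^ k) = 6 * 2 ^ k by ring, mul_pow]
    field_simp
  · rw [lintegral_ite_const _ (hms _), volume_setOf_norm_sub_lt y (by positivity),
      ← ENNReal.ofReal_mul (by positivity)]
    congr 1
    rw [show (2 : ℝ) * (3 * t) = 6 * t by ring, mul_pow, pow_succ]
    field_simp

lemma lintegral_randMeasure_kmaj_le (hN : 0 < N) (k : ℤ) (y : Fin N → ℝ) {t : ℝ} (ht : 0 < t) :
    (∫⁻ ω, (∫⁻ x, kmaj N (randOffset ω) k x y t) ∂randMeasure N) * ENNReal.ofReal (afac k t)⁻¹ ≤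
      ENNReal.ofReal (6 ^ (N + 1) * N) * ENNReal.ofReal (tfac k t) := by
  have hT : (0 : ℝ) < 2 ^ k := by positivity
  have hN1 : (1 : ℝ) ≤ N := by exact_mod_cast hN
  have : IsProbabilityMeasure (randMeasure N) := by unfold randMeasure; infer_instance
  simp only [lintegral_kmaj_left _ k y ht]
  unfold afac tfac
  rw [← ENNReal.ofReal_mul (by positivity)]
  split_ifs with h
  · have hm : Measurable fun ω : RSpace N => chi (k - 1) (randOffset ω (k - 1)) y t :=
      measurable_chi _ (measurable_randOffset _) measurable_const measurable_const
    have e : ∫⁻ ω, ENNReal.ofReal (6 ^ N) * (chi (k - 1) (randOffset ω (k - 1)) y t +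
        chi k (randOffset ω k) y t) ∂randMeasure N ≤ ENNReal.ofReal (6 ^ (N + 1) * N * (t / 2 ^ k)) := by
      rw [lintegral_const_mul' _ _ ENNReal.ofReal_ne_top, lintegral_add_left hm]
      refine (mul_le_mul_right (add_le_add (lintegral_chi_le (k - 1) y ht)
        (lintegral_chi_le k y ht)) _).trans_eq ?_
      rw [← mul_add, ← ENNReal.ofReal_add (by positivity) (by positivity),
        ← ENNReal.ofReal_natCast N, ← ENNReal.ofReal_mul (by positivity),
        ← ENNReal.ofReal_mul (by positivity)]
      congr 1
      rw [zpow_sub_one₀ two_ne_zero, pow_succ]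
      field_simp
      norm_num
    refine (mul_le_mul_left e _).trans_eq ?_
    rw [← ENNReal.ofReal_mul (by positivity)]
    congr 1
    have hs : 0 < Real.sqrt (t / 2 ^ k) := by positivity
    have := Real.mul_self_sqrt (show 0 ≤ t / 2 ^ k by positivity)
    rw [mul_assoc, ← div_eq_mul_inv]
    congr 1
    rw [div_eq_iff hs.ne', this]
  · simp only [lintegral_const, measure_univ, mul_one, inv_one, ENNReal.ofReal_one]
    refine ENNReal.ofReal_le_ofReal ?_
    rw [pow_succ]
    have h1 : 0 ≤ (6 : ℝ) ^ N * (2 ^ k / t) := by positivity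
    nlinarith

lemma exists_tsum_tfac_le : ∃ C : ℝ, ∀ t : ℝ, 0 < t →
    ∑' k : ℤ, ENNReal.ofReal (tfac k t) ≤ ENNReal.ofReal C := by
  set q : ℝ := Real.sqrt (1 / 2) with hq
  have hq0 : 0 < q := by positivity
  have hq2 : q ^ 2 = 1 / 2 := Real.sq_sqrt (by norm_num)
  have hq1 : q < 1 := by nlinarith
  have hsum : Summable fun k : ℤ => q ^ k.natAbs := by
    refine Summable.of_nat_of_neg ?_ ?_
    · simpa using summable_geometric_of_lt_one hq0.le hq1
    · simpa using summable_geometric_of_lt_one hq0.le hq1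
  refine ⟨q⁻¹ * ∑' k : ℤ, q ^ k.natAbs, fun t ht => ?_⟩
  obtain ⟨m, hm1, hm2⟩ := exists_mem_Ico_zpow ht one_lt_two
  have hb : ∀ k : ℤ, tfac k t ≤ q⁻¹ * q ^ (k - m).natAbs := by
    intro k
    have hk : (0 : ℝ) < 2 ^ k := by positivity
    unfold tfac
    split_ifs with h
    · have hmk : m < k := (zpow_lt_zpow_iff_right₀ one_lt_two).1 (hm1.trans_lt h)
      obtain ⟨i, hi⟩ := Int.eq_ofNat_of_zero_le (show 0 ≤ k - (m + 1) by lia)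
      have e1 : (k - m).natAbs = i + 1 := by lia
      rw [e1, pow_succ, mul_comm, mul_assoc, mul_inv_cancel₀ hq0.ne', mul_one,
        Real.sqrt_le_left (by positivity), ← pow_mul, mul_comm i, pow_mul, hq2, div_le_iff₀ hk]
      have : k = (m + 1) + i := by lia
      rw [this, zpow_add₀ two_ne_zero, zpow_natCast, one_div_pow]
      field_simp
      exact hm2.le
    · have hkm : k ≤ m := by
        by_contra hc
        have : m + 1 ≤ k := by lia
        exact h (hm2.trans_le (zpow_le_zpow_right₀ one_le_two this))
      obtain ⟨i, hi⟩ := Int.eq_ofNat_of_zero_le (show 0 ≤ m - k by lia)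
      have e1 : (k - m).natAbs = i := by lia
      have e2 : m = k + i := by lia
      rw [e1]
      have h1 : (2 : ℝ) ^ k / t ≤ q ^ i * q ^ i := by
        rw [← mul_pow, ← sq, hq2, div_le_iff₀ ht]
        rw [e2, zpow_add₀ two_ne_zero, zpow_natCast] at hm1
        rw [one_div_pow, one_div_mul_eq_div, le_div_iff₀ (by positivity)]
        exact hm1
      have h2 : q ^ i ≤ 1 := pow_le_one₀ hq0.le hq1.le
      have h3 : 1 ≤ q⁻¹ := (one_le_inv₀ hq0).2 hq1.le
      have h4 : 0 < q ^ i := by positivity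
      nlinarith
  calc ∑' k : ℤ, ENNReal.ofReal (tfac k t)
      ≤ ∑' k : ℤ, ENNReal.ofReal (q⁻¹ * q ^ (k - m).natAbs) :=
        ENNReal.tsum_le_tsum fun k => ENNReal.ofReal_le_ofReal (hb k)
    _ = ∑' k : ℤ, ENNReal.ofReal (q⁻¹ * q ^ k.natAbs) :=
        (Equiv.subRight m).tsum_eq (fun k : ℤ => ENNReal.ofReal (q⁻¹ * q ^ k.natAbs))
    _ = ENNReal.ofReal (∑' k : ℤ, q⁻¹ * q ^ k.natAbs) :=
        (ENNReal.ofReal_tsum_of_nonneg (fun k => by positivity) (hsum.mul_left _)).symm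
    _ = _ := by rw [tsum_mul_left]

/-- The first Schur estimate. -/
lemma exists_lintegral_kmaj_left_le (hN : 0 < N) : ∃ C : ℝ, ∀ (y : Fin N → ℝ) (t : ℝ), 0 < t →
    ∫⁻ lam : ℤ × RSpace N, (∫⁻ x, kmaj N (randOffset lam.2) lam.1 x y t) *
      ENNReal.ofReal (afac lam.1 t)⁻¹ ∂((Measure.count : Measure ℤ).prod (randMeasure N)) ≤
      ENNReal.ofReal C := by
  obtain ⟨C, hC⟩ := exists_tsum_tfac_le
  refine ⟨6 ^ (N + 1) * N * C, fun y t ht => ?_⟩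
  have hm : Measurable fun lam : ℤ × RSpace N => (∫⁻ x, kmaj N (randOffset lam.2) lam.1 x y t) *
      ENNReal.ofReal (afac lam.1 t)⁻¹ := by
    refine Measurable.mul ?_ ?_
    · refine Measurable.lintegral_prod_right' (f := fun q : (ℤ × RSpace N) × (Fin N → ℝ) =>
        kmaj N (randOffset q.1.2) q.1.1 q.2 y t) ?_
      exact measurable_kmaj (by fun_prop) (by fun_prop) (by fun_prop) (by fun_prop) (by fun_prop)
    · exact (measurable_afac measurable_fst measurable_const).inv.ennreal_ofReal
  rw [lintegral_prod _ hm.aemeasurable, lintegral_count]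
  calc _ = ∑' k : ℤ, (∫⁻ ω, (∫⁻ x, kmaj N (randOffset ω) k x y t) ∂randMeasure N) *
        ENNReal.ofReal (afac k t)⁻¹ := by
        congr 1; ext k
        exact lintegral_mul_const' (ENNReal.ofReal (afac k t)⁻¹)
          (fun ω => ∫⁻ x, kmaj N (randOffset ω) k x y t) ENNReal.ofReal_ne_top
    _ ≤ ∑' k : ℤ, ENNReal.ofReal (6 ^ (N + 1) * N) * ENNReal.ofReal (tfac k t) :=
        ENNReal.tsum_le_tsum fun k => lintegral_randMeasure_kmaj_le hN k y ht
    _ ≤ _ := by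
        rw [ENNReal.tsum_mul_left, ENNReal.ofReal_mul (p := 6 ^ (N + 1) * (N : ℝ)) (by positivity)]
        exact mul_le_mul_right (hC t ht) _

end KernelEstimates

/-! ### The second Schur estimate -/

section SecondSchur

variable {N : ℕ}

open Classical in
/-- The radial profile bounding the second Schur integral. -/
def gfac (k : ℤ) (t : ℝ) : ℝ :=
  if t < 2 ^ k then ((2 : ℝ) ^ k) ^ (-(1 / 4 : ℝ)) * t ^ (-(3 / 4 : ℝ)) else 2 ^ k * t ^ (-2 : ℝ)

lemma lintegral_kmaj_mul_wgt_le (hN : 0 < N) {B : (Fin N → ℝ) → ℝ≥0∞} (hB : Measurable B)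
    (c : ℤ → Fin N → ℝ) (k : ℤ) (x : Fin N → ℝ) {t : ℝ} (ht : 0 < t) :
    ∫⁻ y, kmaj N c k x y t * (wgt B y t * ENNReal.ofReal (afac k t / t)) ≤
      ENNReal.ofReal (2 * 2 ^ N * (8 : ℝ) ^ ((N : ℝ) + 1 / 4)) *
        (ENNReal.ofReal (gfac k t) * mwgt B x) := by
  have hT : (0 : ℝ) < 2 ^ k := by positivity
  have hN1 : (1 : ℝ) ≤ N := by exact_mod_cast hN
  have htN : t / N ≤ t := div_le_self ht.le hN1
  have key : ∀ (a ρ : ℝ) (j : ℤ), 0 ≤ a → ρ + t / N ≤ 2 ^ j →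
      (∀ y, kmaj N c k x y t ≤ (Metric.ball x ρ).indicator (fun _ => ENNReal.ofReal a) y) →
      a * (2 ^ N * t ^ (-(1 / 4 : ℝ)) * ((2 : ℝ) ^ j) ^ ((N : ℝ) + 1 / 4)) * (afac k t / t) ≤
        2 * 2 ^ N * (8 : ℝ) ^ ((N : ℝ) + 1 / 4) * gfac k t →
      ∫⁻ y, kmaj N c k x y t * (wgt B y t * ENNReal.ofReal (afac k t / t)) ≤
      ENNReal.ofReal (2 * 2 ^ N * (8 : ℝ) ^ ((N : ℝ) + 1 / 4)) *
        (ENNReal.ofReal (gfac k t) * mwgt B x) := by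
    intro a ρ j ha hρ hk hle
    have haf := afac_pos k ht
    calc ∫⁻ y, kmaj N c k x y t * (wgt B y t * ENNReal.ofReal (afac k t / t))
        ≤ ∫⁻ y, (Metric.ball x ρ).indicator (fun y => ENNReal.ofReal a *
            (wgt B y t * ENNReal.ofReal (afac k t / t))) y := by
          refine lintegral_mono fun y => ?_
          by_cases hy : y ∈ Metric.ball x ρ
          · rw [Set.indicator_of_mem hy]
            have := hk y
            rw [Set.indicator_of_mem hy] at this
            exact mul_le_mul_left this _
          · have := hk y
            rw [Set.indicator_of_notMem hy] at this ⊢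
            rw [nonpos_iff_eq_zero.1 this, zero_mul]
      _ = ENNReal.ofReal a * ((∫⁻ y in Metric.ball x ρ, wgt B y t) *
            ENNReal.ofReal (afac k t / t)) := by
          rw [lintegral_indicator Metric.isOpen_ball.measurableSet,
            lintegral_const_mul' _ _ ENNReal.ofReal_ne_top,
            lintegral_mul_const' _ _ ENNReal.ofReal_ne_top]
      _ ≤ ENNReal.ofReal a * ((ENNReal.ofReal (2 ^ N * t ^ (-(1 / 4 : ℝ)) *
            ((2 : ℝ) ^ j) ^ ((N : ℝ) + 1 / 4)) * mwgt B x) * ENNReal.ofReal (afac k t / t)) := by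
          gcongr
          exact setLIntegral_wgt_le hN hB x ht j hρ
      _ = ENNReal.ofReal (a * (2 ^ N * t ^ (-(1 / 4 : ℝ)) *
            ((2 : ℝ) ^ j) ^ ((N : ℝ) + 1 / 4)) * (afac k t / t)) * mwgt B x := by
          rw [ENNReal.ofReal_mul (q := afac k t / t) (by positivity), ENNReal.ofReal_mul ha]
          ring
      _ ≤ _ := by
          rw [← mul_assoc (ENNReal.ofReal (2 * 2 ^ N * _)), ← ENNReal.ofReal_mul (by positivity)]
          gcongr
  by_cases h : t < 2 ^ k
  · refine key (2 * (((2 : ℝ) ^ k) ^ N)⁻¹) (3 * 2 ^ k) (k + 2) (by positivity) ?_ ?_ ?_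
    · rw [zpow_add₀ two_ne_zero]; norm_num; linarith
    · intro y
      unfold kmaj
      rw [if_pos h]
      split_ifs with h2
      · rw [Set.indicator_of_mem (by rwa [Metric.mem_ball, dist_eq_norm]), mul_comm,
          ENNReal.ofReal_mul zero_le_two]
        gcongr
        calc _ ≤ (1 : ℝ≥0∞) + 1 := add_le_add (chi_le_one _ _ _ _) (chi_le_one _ _ _ _)
          _ = ENNReal.ofReal 2 := by norm_num
      · exact zero_le
    · unfold gfac afac
      rw [if_pos h, if_pos h, zpow_add₀ two_ne_zero, Real.sqrt_eq_rpow,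
        Real.div_rpow ht.le hT.le, Real.mul_rpow hT.le (by norm_num)]
      generalize (2 : ℝ) ^ k = T at *
      have e1 : T ^ ((N : ℝ) + 1 / 4) = T ^ N * T ^ (1 / 4 : ℝ) := by
        rw [Real.rpow_add hT, Real.rpow_natCast]
      have e2 : T ^ (1 / 2 : ℝ) = T ^ (1 / 4 : ℝ) * T ^ (1 / 4 : ℝ) := by
        rw [← Real.rpow_add hT]; norm_num
      have e3 : t ^ (1 / 2 : ℝ) = t ^ (-(3 / 4) : ℝ) * t ^ (1 / 4 : ℝ) * t := by
        nth_rw 4 [← Real.rpow_one t]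
        rw [← Real.rpow_add ht, ← Real.rpow_add ht]; norm_num
      have e4 : ((2 : ℝ) ^ (2 : ℤ)) ^ ((N : ℝ) + 1 / 4) ≤ 8 ^ ((N : ℝ) + 1 / 4) :=
        Real.rpow_le_rpow (by positivity) (by norm_num) (by positivity)
      rw [e1, e2, e3, Real.rpow_neg ht.le (1 / 4), Real.rpow_neg hT.le (1 / 4)]
      have p1 : 0 < T ^ (1 / 4 : ℝ) := by positivity
      have p2 : 0 < t ^ (1 / 4 : ℝ) := by positivity
      have p3 : 0 < t ^ (-(3 / 4) : ℝ) := by positivity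
      have p4 : 0 < T ^ N := by positivity
      generalize T ^ (1 / 4 : ℝ) = a at *
      generalize t ^ (1 / 4 : ℝ) = b at *
      generalize t ^ (-(3 / 4) : ℝ) = d at *
      generalize T ^ N = e at *
      generalize ((2 : ℝ) ^ (2 : ℤ)) ^ ((N : ℝ) + 1 / 4) = f at *
      generalize (8 : ℝ) ^ ((N : ℝ) + 1 / 4) = g at *
      calc _ = 2 * 2 ^ N * f * (a⁻¹ * d) := by field_simp
        _ ≤ _ := by gcongr
  · obtain ⟨m, hm1, hm2⟩ := exists_mem_Ico_zpow (x := 4 * t) (by positivity) one_lt_two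
    refine key (2 ^ k * (t ^ (N + 1))⁻¹) (3 * t) (m + 1) (by positivity) ?_ ?_ ?_
    · linarith
    · intro y
      unfold kmaj
      rw [if_neg h]
      split_ifs with h2
      · rw [Set.indicator_of_mem (by rwa [Metric.mem_ball, dist_eq_norm])]
      · exact zero_le
    · have hm3 : (2 : ℝ) ^ (m + 1) ≤ 8 * t := by
        rw [zpow_add_one₀ two_ne_zero]; linarith
      have e4 : ((2 : ℝ) ^ (m + 1)) ^ ((N : ℝ) + 1 / 4) ≤ (8 * t) ^ ((N : ℝ) + 1 / 4) :=
        Real.rpow_le_rpow (by positivity) hm3 (by positivity)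
      rw [Real.mul_rpow (by norm_num) ht.le, Real.rpow_add ht, Real.rpow_natCast] at e4
      unfold gfac afac
      rw [if_neg h, if_neg h, Real.rpow_neg ht.le (1 / 4), Real.rpow_neg ht.le 2]
      have p2 : 0 < t ^ (1 / 4 : ℝ) := by positivity
      have p5 : 0 < (8 : ℝ) ^ ((N : ℝ) + 1 / 4) := by positivity
      have e5 : t ^ (2 : ℝ) = t ^ 2 := by norm_cast
      rw [e5]
      generalize t ^ (1 / 4 : ℝ) = b at *
      generalize (8 : ℝ) ^ ((N : ℝ) + 1 / 4) = g at *
      calc _ ≤ 2 ^ k * (t ^ (N + 1))⁻¹ * (2 ^ N * b⁻¹ * (g * (t ^ N * b))) * (1 / t) := by gcongr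
        _ = 1 * (2 ^ N * g * (2 ^ k * (t ^ 2)⁻¹)) := by rw [pow_succ]; field_simp
        _ ≤ 2 * (2 ^ N * g * (2 ^ k * (t ^ 2)⁻¹)) := by gcongr; norm_num
        _ = _ := by ring

lemma lintegral_gfac_le (k : ℤ) :
    ∫⁻ t in Set.Ioi (0 : ℝ), ENNReal.ofReal (gfac k t) ≤ 5 := by
  have hT : (0 : ℝ) < 2 ^ k := by positivity
  have h1 : ∫⁻ t in Set.Ioi (0 : ℝ), (Set.Iio ((2 : ℝ) ^ k)).indicator
      (fun t => ENNReal.ofReal (((2 : ℝ) ^ k) ^ (-(1 / 4 : ℝ)) * t ^ (-(3 / 4 : ℝ)))) t = 4 := by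
    have := rpow_eq_lintegral (s := 1 / 4) (by norm_num) (ENNReal.ofReal (2 ^ k))
    have e : ∀ t : ℝ, 0 < t → (Set.Iio ((2 : ℝ) ^ k)).indicator
      (fun t => ENNReal.ofReal (((2 : ℝ) ^ k) ^ (-(1 / 4 : ℝ)) * t ^ (-(3 / 4 : ℝ)))) t =
        ENNReal.ofReal (4 * ((2 : ℝ) ^ k) ^ (-(1 / 4 : ℝ))) *
        {t : ℝ | ENNReal.ofReal t < ENNReal.ofReal (2 ^ k)}.indicator
          (fun t => ENNReal.ofReal (1 / 4 * t ^ ((1 / 4 : ℝ) - 1))) t := by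
      intro t ht
      by_cases h : t < 2 ^ k
      · rw [Set.indicator_of_mem (by exact h), Set.indicator_of_mem
          (by exact (ENNReal.ofReal_lt_ofReal_iff hT).2 h), ← ENNReal.ofReal_mul (by positivity)]
        congr 1
        rw [show (1 / 4 : ℝ) - 1 = -(3 / 4) by norm_num]
        ring
      · rw [Set.indicator_of_notMem (by exact h), Set.indicator_of_notMem
          (by exact fun h' => h ((ENNReal.ofReal_lt_ofReal_iff hT).1 h')), mul_zero]
    rw [setLIntegral_congr_fun measurableSet_Ioi (fun t ht => e t ht),
      lintegral_const_mul' _ _ ENNReal.ofReal_ne_top, ← this,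
      ENNReal.ofReal_rpow_of_pos hT, ← ENNReal.ofReal_mul (by positivity), mul_assoc,
      ← Real.rpow_add hT]
    norm_num
  have h2 : ∫⁻ t in Set.Ioi ((2 : ℝ) ^ k), ENNReal.ofReal (2 ^ k * t ^ (-2 : ℝ)) = 1 := by
    rw [← ofReal_integral_eq_lintegral_ofReal, integral_const_mul,
      integral_Ioi_rpow_of_lt (by norm_num) hT]
    · rw [show (-2 : ℝ) + 1 = -1 by norm_num, Real.rpow_neg_one]
      field_simp
      norm_num
    · exact (integrableOn_Ioi_rpow_of_lt (by norm_num) hT).const_mul _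
    · refine (ae_restrict_iff' measurableSet_Ioi).2 (Eventually.of_forall fun t ht => ?_)
      have : 0 < t := hT.trans ht
      positivity
  calc ∫⁻ t in Set.Ioi (0 : ℝ), ENNReal.ofReal (gfac k t)
      ≤ ∫⁻ t in Set.Ioi (0 : ℝ), ((Set.Iio ((2 : ℝ) ^ k)).indicator
          (fun t => ENNReal.ofReal (((2 : ℝ) ^ k) ^ (-(1 / 4 : ℝ)) * t ^ (-(3 / 4 : ℝ)))) t +
          (Set.Ici ((2 : ℝ) ^ k)).indicator (fun t => ENNReal.ofReal (2 ^ k * t ^ (-2 : ℝ))) t) := by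
        refine lintegral_mono fun t => ?_
        unfold gfac
        dsimp only
        split_ifs with h
        · rw [Set.indicator_of_mem (by exact h)]
          exact le_self_add
        · rw [Set.indicator_of_mem (s := Set.Ici ((2 : ℝ) ^ k)) (by exact not_lt.1 h)]
          exact le_add_self
    _ = 4 + ∫⁻ t in Set.Ioi (0 : ℝ), (Set.Ici ((2 : ℝ) ^ k)).indicator
          (fun t => ENNReal.ofReal (2 ^ k * t ^ (-2 : ℝ))) t := by
        rw [lintegral_add_left (Measurable.indicator (by fun_prop) measurableSet_Iio), h1]
    _ ≤ 4 + 1 := by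
        gcongr
        rw [lintegral_indicator measurableSet_Ici, Measure.restrict_restrict measurableSet_Ici,
          ← h2, restrict_Ioi_eq_restrict_Ici]
        exact lintegral_mono_set Set.inter_subset_left
    _ = 5 := by norm_num

/-- The second Schur estimate. -/
lemma exists_lintegral_kmaj_right_le (hN : 0 < N) : ∃ C : ℝ, ∀ B : (Fin N → ℝ) → ℝ≥0∞,
    Measurable B → ∀ (c : ℤ → Fin N → ℝ) (k : ℤ) (x : Fin N → ℝ),
    ∫⁻ t in Set.Ioi (0 : ℝ), ∫⁻ y, kmaj N c k x y t *
      (wgt B y t * ENNReal.ofReal (afac k t / t)) ≤ ENNReal.ofReal C * mwgt B x := by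
  refine ⟨2 * 2 ^ N * (8 : ℝ) ^ ((N : ℝ) + 1 / 4) * 5, fun B hB c k x => ?_⟩
  calc _ ≤ ∫⁻ t in Set.Ioi (0 : ℝ), ENNReal.ofReal (2 * 2 ^ N * (8 : ℝ) ^ ((N : ℝ) + 1 / 4)) *
        (ENNReal.ofReal (gfac k t) * mwgt B x) :=
        setLIntegral_mono' measurableSet_Ioi fun t ht => lintegral_kmaj_mul_wgt_le hN hB c k x ht
    _ = ENNReal.ofReal (2 * 2 ^ N * (8 : ℝ) ^ ((N : ℝ) + 1 / 4)) *
        ((∫⁻ t in Set.Ioi (0 : ℝ), ENNReal.ofReal (gfac k t)) * mwgt B x) := by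
        rw [lintegral_const_mul' _ _ ENNReal.ofReal_ne_top, lintegral_mul_const'']
        refine Measurable.aemeasurable ?_
        unfold gfac
        exact (Measurable.ite measurableSet_Iio (by fun_prop) (by fun_prop)).ennreal_ofReal
    _ ≤ ENNReal.ofReal (2 * 2 ^ N * (8 : ℝ) ^ ((N : ℝ) + 1 / 4)) * (5 * mwgt B x) := by
        gcongr
        exact lintegral_gfac_le k
    _ = _ := by
        rw [ENNReal.ofReal_mul (q := 5) (by positivity), ENNReal.ofReal_ofNat, ← mul_assoc _ 5]

end SecondSchur

/-! ### The square function estimate for nonnegative densities -/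

section PositiveEstimate

lemma sq_lintegral_mul_le {α : Type*} [MeasurableSpace α] {ν : Measure α} {g k φ : α → ℝ≥0∞}
    (hg : Measurable g) (hk : Measurable k) (hφ : Measurable φ)
    (h0 : ∀ᵐ a ∂ν, φ a ≠ 0 ∧ φ a ≠ ⊤) :
    (∫⁻ a, g a * k a ∂ν) ^ 2 ≤ (∫⁻ a, g a ^ 2 * k a * (φ a)⁻¹ ∂ν) * ∫⁻ a, k a * φ a ∂ν := by
  have hold := ENNReal.lintegral_mul_le_Lp_mul_Lq ν Real.HolderConjugate.two_two
    (f := fun a => g a * (k a ^ (1 / 2 : ℝ) * ((φ a)⁻¹) ^ (1 / 2 : ℝ)))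
    (g := fun a => k a ^ (1 / 2 : ℝ) * φ a ^ (1 / 2 : ℝ))
    (hg.mul ((hk.pow_const _).mul (hφ.inv.pow_const _))).aemeasurable
    ((hk.pow_const _).mul (hφ.pow_const _)).aemeasurable
  have hs : ∀ a : ℝ≥0∞, a ^ (1 / 2 : ℝ) * a ^ (1 / 2 : ℝ) = a := fun a => by
    rw [← ENNReal.rpow_add_of_nonneg _ _ (by norm_num) (by norm_num)]; norm_num
  have hs2 : ∀ a : ℝ≥0∞, (a ^ (1 / 2 : ℝ)) ^ 2 = a := fun a => by rw [sq, hs]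
  have e1 : ∫⁻ a, g a * k a ∂ν = ∫⁻ a, ((fun a => g a * (k a ^ (1 / 2 : ℝ) *
      ((φ a)⁻¹) ^ (1 / 2 : ℝ))) * fun a => k a ^ (1 / 2 : ℝ) * φ a ^ (1 / 2 : ℝ)) a ∂ν := by
    refine lintegral_congr_ae ?_
    filter_upwards [h0] with a ha
    have : ((φ a)⁻¹) ^ (1 / 2 : ℝ) * φ a ^ (1 / 2 : ℝ) = 1 := by
      rw [← ENNReal.mul_rpow_of_nonneg _ _ (by norm_num), ENNReal.inv_mul_cancel ha.1 ha.2,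
        ENNReal.one_rpow]
    calc g a * k a = g a * (k a ^ (1 / 2 : ℝ) * k a ^ (1 / 2 : ℝ)) *
          (((φ a)⁻¹) ^ (1 / 2 : ℝ) * φ a ^ (1 / 2 : ℝ)) := by rw [this, hs, mul_one]
      _ = _ := by simp only [Pi.mul_apply]; ring
  rw [← e1] at hold
  have hold2 := pow_le_pow_left₀ zero_le hold 2
  rw [mul_pow, hs2, hs2] at hold2
  refine hold2.trans_eq ?_
  congr 1 <;> refine lintegral_congr fun a => ?_
  · rw [ENNReal.rpow_two, mul_pow, mul_pow, hs2, hs2, mul_assoc]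
  · rw [ENNReal.rpow_two, mul_pow, hs2, hs2]

lemma lintegral_sqrt_mul_le {α : Type*} [MeasurableSpace α] {ν : Measure α} {a b : α → ℝ≥0∞}
    (ha : Measurable a) (hb : Measurable b) :
    ∫⁻ x, (a x * b x) ^ (1 / 2 : ℝ) ∂ν ≤ (∫⁻ x, a x ∂ν) ^ (1 / 2 : ℝ) * (∫⁻ x, b x ∂ν) ^ (1 / 2 : ℝ) := by
  have hold := ENNReal.lintegral_mul_le_Lp_mul_Lq ν Real.HolderConjugate.two_two
    (f := fun x => a x ^ (1 / 2 : ℝ)) (g := fun x => b x ^ (1 / 2 : ℝ))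
    (ha.pow_const _).aemeasurable (hb.pow_const _).aemeasurable
  have hs : ∀ a : ℝ≥0∞, (a ^ (1 / 2 : ℝ)) ^ (2 : ℝ) = a := fun a => by
    rw [← ENNReal.rpow_mul]; norm_num
  simp only [hs] at hold
  refine le_trans (le_of_eq (lintegral_congr fun x => ?_)) hold
  rw [Pi.mul_apply, ENNReal.mul_rpow_of_nonneg _ _ (by norm_num)]

/-- The half-space measure `dt dy`. -/
def hsMeas (N : ℕ) : Measure (ℝ × (Fin N → ℝ)) :=
  (volume.restrict (Set.Ioi (0 : ℝ))).prod volume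

instance (N : ℕ) : SFinite (hsMeas N) := by unfold hsMeas; infer_instance

lemma ae_hsMeas_pos (N : ℕ) : ∀ᵐ p ∂hsMeas N, 0 < p.1 := by
  have h : ∀ᵐ t ∂(volume.restrict (Set.Ioi (0 : ℝ))), 0 < t :=
    (ae_restrict_iff' measurableSet_Ioi).2 (Eventually.of_forall fun t ht => ht)
  exact Measure.quasiMeasurePreserving_fst.ae h

variable {N : ℕ}

lemma lintegral_hsMeas {h : ℝ × (Fin N → ℝ) → ℝ≥0∞} (hh : Measurable h) :
    ∫⁻ p, h p ∂hsMeas N = ∫⁻ t in Set.Ioi (0 : ℝ), ∫⁻ y, h (t, y) :=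
  lintegral_prod _ hh.aemeasurable

/-- The square of the conical square function of a nonnegative density. -/
def coneSq (e : ℝ × (Fin N → ℝ) → ℝ≥0∞) (x : Fin N → ℝ) : ℝ≥0∞ :=
  ∫⁻ p, {p : ℝ × (Fin N → ℝ) | ‖p.2 - x‖ < p.1 / N}.indicator
    (fun p => ENNReal.ofReal (p.1 ^ (1 - (N : ℝ))) * e p) p ∂hsMeas N

lemma measurable_coneSq_integrand {e : ℝ × (Fin N → ℝ) → ℝ≥0∞} (he : Measurable e)
    {M : Type*} [MeasurableSpace M] {x : M → Fin N → ℝ} {r : M → ℝ × (Fin N → ℝ)}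
    (hx : Measurable x) (hr : Measurable r) :
    Measurable fun m => {p : ℝ × (Fin N → ℝ) | ‖p.2 - x m‖ < p.1 / N}.indicator
        (fun p => ENNReal.ofReal (p.1 ^ (1 - (N : ℝ))) * e p) (r m) := by
  have : Measurable (Set.indicator {m | ‖(r m).2 - x m‖ < (r m).1 / N}
      (fun m => ENNReal.ofReal ((r m).1 ^ (1 - (N : ℝ))) * e (r m))) :=
    Measurable.indicator (Measurable.mul (by fun_prop) (he.comp hr))
      (measurableSet_lt (by fun_prop) (by fun_prop))
  exact this

lemma measurable_coneSq {e : ℝ × (Fin N → ℝ) → ℝ≥0∞} (he : Measurable e) :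
    Measurable (coneSq e) :=
  (measurable_coneSq_integrand he measurable_fst measurable_snd).lintegral_prod_right'

lemma exists_lintegral_inv_wgt_le (hN : 0 < N) : ∃ C : ℝ, ∀ e : ℝ × (Fin N → ℝ) → ℝ≥0∞,
    Measurable e → ∀ B : (Fin N → ℝ) → ℝ≥0∞, Measurable B → (∀ x, B x ≠ 0) → ∫⁻ x, B x ≠ ⊤ →
    ∫⁻ p, e p * (ENNReal.ofReal p.1 * (wgt B p.2 p.1)⁻¹) ∂hsMeas N ≤
      ENNReal.ofReal C * ∫⁻ z, (B z)⁻¹ * coneSq e z := by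
  obtain ⟨C, hC⟩ := exists_inv_wgt_le hN
  refine ⟨C, fun e he B hB h0 hi => ?_⟩
  calc _ ≤ ∫⁻ p, ENNReal.ofReal C * ∫⁻ z, (B z)⁻¹ *
        {p : ℝ × (Fin N → ℝ) | ‖p.2 - z‖ < p.1 / N}.indicator
        (fun p => ENNReal.ofReal (p.1 ^ (1 - (N : ℝ))) * e p) p ∂volume ∂hsMeas N := by
        refine lintegral_mono_ae ?_
        filter_upwards [ae_hsMeas_pos N] with p hp
        have h1 : ∫⁻ z, (B z)⁻¹ * {p : ℝ × (Fin N → ℝ) | ‖p.2 - z‖ < p.1 / N}.indicator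
            (fun p => ENNReal.ofReal (p.1 ^ (1 - (N : ℝ))) * e p) p =
            (∫⁻ z in Metric.ball p.2 (p.1 / N), (B z)⁻¹) *
              (ENNReal.ofReal (p.1 ^ (1 - (N : ℝ))) * e p) := by
          rw [← lintegral_mul_const _ (f := fun z => (B z)⁻¹) hB.inv,
            ← lintegral_indicator Metric.isOpen_ball.measurableSet]
          refine lintegral_congr fun z => ?_
          by_cases hz : ‖p.2 - z‖ < p.1 / N
          · rw [Set.indicator_of_mem (by exact hz), Set.indicator_of_mem
              (by rwa [Metric.mem_ball', dist_eq_norm])]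
          · rw [Set.indicator_of_notMem (by exact hz), Set.indicator_of_notMem
              (by rwa [Metric.mem_ball', dist_eq_norm]), mul_zero]
        rw [h1]
        calc _ ≤ e p * (ENNReal.ofReal p.1 * (ENNReal.ofReal (C * p.1 ^ (-(N : ℝ))) *
              ∫⁻ z in Metric.ball p.2 (p.1 / N), (B z)⁻¹)) := by
              gcongr
              exact hC B hB h0 hi p.2 p.1 hp
          _ = _ := by
              rw [mul_comm C, ENNReal.ofReal_mul (by positivity), sub_eq_add_neg,
                Real.rpow_add hp, Real.rpow_one, ENNReal.ofReal_mul hp.le]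
              ring
    _ = ENNReal.ofReal C * ∫⁻ z, ∫⁻ p, (B z)⁻¹ *
        {p : ℝ × (Fin N → ℝ) | ‖p.2 - z‖ < p.1 / N}.indicator
        (fun p => ENNReal.ofReal (p.1 ^ (1 - (N : ℝ))) * e p) p ∂hsMeas N := by
        rw [lintegral_const_mul' _ _ ENNReal.ofReal_ne_top, lintegral_lintegral_swap]
        have hm : Measurable fun q : (ℝ × (Fin N → ℝ)) × (Fin N → ℝ) =>
            {p : ℝ × (Fin N → ℝ) | ‖p.2 - q.2‖ < p.1 / N}.indicator
            (fun p => ENNReal.ofReal (p.1 ^ (1 - (N : ℝ))) * e p) q.1 :=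
          measurable_coneSq_integrand he measurable_snd measurable_fst
        have hb : Measurable fun q : (ℝ × (Fin N → ℝ)) × (Fin N → ℝ) => (B q.2)⁻¹ :=
          (hB.comp measurable_snd).inv
        exact (hb.mul hm).aemeasurable
    _ = _ := by
        unfold coneSq
        congr 1
        refine lintegral_congr fun z => ?_
        have hm : Measurable ({p : ℝ × (Fin N → ℝ) | ‖p.2 - z‖ < p.1 / N}.indicator
            (fun p => ENNReal.ofReal (p.1 ^ (1 - (N : ℝ))) * e p)) :=
          Measurable.indicator (Measurable.mul (by fun_prop) he)
            (measurableSet_lt (by fun_prop) (by fun_prop))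
        exact lintegral_const_mul (B z)⁻¹ hm

/-- The measure on the indices `(k, ω)` of the random dyadic martingale differences. -/
def lamMeas (N : ℕ) : Measure (ℤ × RSpace N) := (Measure.count : Measure ℤ).prod (randMeasure N)

instance (N : ℕ) : SFinite (lamMeas N) := by unfold lamMeas; infer_instance

lemma exists_lintegral_schur_le (hN : 0 < N) : ∃ C : ℝ, ∀ e : ℝ × (Fin N → ℝ) → ℝ≥0∞,
    Measurable e → ∀ B : (Fin N → ℝ) → ℝ≥0∞, Measurable B → (∀ x, B x ≠ 0) → ∫⁻ x, B x ≠ ⊤ →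
    ∫⁻ x, ∫⁻ lam, ∫⁻ p, e p * kmaj N (randOffset lam.2) lam.1 x p.2 p.1 *
        (wgt B p.2 p.1 * ENNReal.ofReal (afac lam.1 p.1 / p.1))⁻¹ ∂hsMeas N ∂lamMeas N ≤
      ENNReal.ofReal C * ∫⁻ p, e p * (ENNReal.ofReal p.1 * (wgt B p.2 p.1)⁻¹) ∂hsMeas N := by
  obtain ⟨C, hC⟩ := exists_lintegral_kmaj_left_le hN
  refine ⟨C, fun e he B hB h0 hi => ?_⟩
  have mk : Measurable fun q : (Fin N → ℝ) × (ℤ × RSpace N) × (ℝ × (Fin N → ℝ)) =>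
      kmaj N (randOffset q.2.1.2) q.2.1.1 q.1 q.2.2.2 q.2.2.1 :=
    measurable_kmaj (by fun_prop) (by fun_prop) (by fun_prop) (by fun_prop) (by fun_prop)
  have mw : Measurable fun q : (Fin N → ℝ) × (ℤ × RSpace N) × (ℝ × (Fin N → ℝ)) =>
      wgt B q.2.2.2 q.2.2.1 :=
    (measurable_wgt hB).comp (g := fun q : (Fin N → ℝ) × ℝ => wgt B q.1 q.2)
      (f := fun q : (Fin N → ℝ) × (ℤ × RSpace N) × (ℝ × (Fin N → ℝ)) => (q.2.2.2, q.2.2.1))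
      (by fun_prop)
  have ma : Measurable fun q : (Fin N → ℝ) × (ℤ × RSpace N) × (ℝ × (Fin N → ℝ)) =>
      afac q.2.1.1 q.2.2.1 := measurable_afac (by fun_prop) (by fun_prop)
  have hm : Measurable fun q : (Fin N → ℝ) × (ℤ × RSpace N) × (ℝ × (Fin N → ℝ)) =>
      e q.2.2 * kmaj N (randOffset q.2.1.2) q.2.1.1 q.1 q.2.2.2 q.2.2.1 *
        (wgt B q.2.2.2 q.2.2.1 * ENNReal.ofReal (afac q.2.1.1 q.2.2.1 / q.2.2.1))⁻¹ :=
    ((he.comp (by fun_prop)).mul mk).mul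
      (mw.mul (ma.div (by fun_prop)).ennreal_ofReal).inv
  have s1 : ∫⁻ x, ∫⁻ lam, ∫⁻ p, e p * kmaj N (randOffset lam.2) lam.1 x p.2 p.1 *
        (wgt B p.2 p.1 * ENNReal.ofReal (afac lam.1 p.1 / p.1))⁻¹ ∂hsMeas N ∂lamMeas N =
      ∫⁻ lam, ∫⁻ p, ∫⁻ x, e p * kmaj N (randOffset lam.2) lam.1 x p.2 p.1 *
        (wgt B p.2 p.1 * ENNReal.ofReal (afac lam.1 p.1 / p.1))⁻¹ ∂volume ∂hsMeas N ∂lamMeas N := by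
    rw [lintegral_lintegral_swap]
    · refine lintegral_congr fun lam => ?_
      rw [lintegral_lintegral_swap]
      exact (hm.comp (f := fun r : (Fin N → ℝ) × (ℝ × (Fin N → ℝ)) => (r.1, lam, r.2))
        (by fun_prop)).aemeasurable
    · exact (Measurable.lintegral_prod_right' (hm.comp
        (f := fun r : ((Fin N → ℝ) × (ℤ × RSpace N)) × (ℝ × (Fin N → ℝ)) => (r.1.1, r.1.2, r.2))
        (by fun_prop))).aemeasurable
  have s2 : ∫⁻ lam, ∫⁻ p, ∫⁻ x, e p * kmaj N (randOffset lam.2) lam.1 x p.2 p.1 *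
        (wgt B p.2 p.1 * ENNReal.ofReal (afac lam.1 p.1 / p.1))⁻¹ ∂volume ∂hsMeas N ∂lamMeas N =
      ∫⁻ p, ∫⁻ lam, ∫⁻ x, e p * kmaj N (randOffset lam.2) lam.1 x p.2 p.1 *
        (wgt B p.2 p.1 * ENNReal.ofReal (afac lam.1 p.1 / p.1))⁻¹ ∂volume ∂lamMeas N ∂hsMeas N := by
    rw [lintegral_lintegral_swap]
    exact (Measurable.lintegral_prod_right' (hm.comp
        (f := fun r : ((ℤ × RSpace N) × (ℝ × (Fin N → ℝ))) × (Fin N → ℝ) => (r.2, r.1.1, r.1.2))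
        (by fun_prop))).aemeasurable
  rw [s1, s2, ← lintegral_const_mul' _ _ ENNReal.ofReal_ne_top]
  refine lintegral_mono_ae ?_
  filter_upwards [ae_hsMeas_pos N] with p hp
  have hw0 := wgt_ne_zero hN hB h0 hi p.2 hp
  have hwt := wgt_ne_top hN hi p.2 p.1
  have mk2 : Measurable fun q : (ℤ × RSpace N) × (Fin N → ℝ) =>
      kmaj N (randOffset q.1.2) q.1.1 q.2 p.2 p.1 :=
    measurable_kmaj (by fun_prop) (by fun_prop) (by fun_prop) (by fun_prop) (by fun_prop)
  calc _ = ∫⁻ lam, (e p * (ENNReal.ofReal p.1 * (wgt B p.2 p.1)⁻¹)) *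
        ((∫⁻ x, kmaj N (randOffset lam.2) lam.1 x p.2 p.1) *
          ENNReal.ofReal (afac lam.1 p.1)⁻¹) ∂lamMeas N := by
        refine lintegral_congr fun lam => ?_
        have haf := afac_pos lam.1 hp
        have e1 : (wgt B p.2 p.1 * ENNReal.ofReal (afac lam.1 p.1 / p.1))⁻¹ =
            ENNReal.ofReal p.1 * (wgt B p.2 p.1)⁻¹ * ENNReal.ofReal (afac lam.1 p.1)⁻¹ := by
          rw [ENNReal.mul_inv (Or.inl hw0) (Or.inl hwt), ← ENNReal.ofReal_inv_of_pos (by positivity),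
            inv_div, div_eq_mul_inv, ENNReal.ofReal_mul hp.le]
          ring
        have mk3 : Measurable fun x => kmaj N (randOffset lam.2) lam.1 x p.2 p.1 :=
          measurable_kmaj (by fun_prop) (by fun_prop) (by fun_prop) (by fun_prop) (by fun_prop)
        rw [lintegral_mul_const _ (mk3.const_mul _), lintegral_const_mul _ mk3, e1]
        ring
    _ = (e p * (ENNReal.ofReal p.1 * (wgt B p.2 p.1)⁻¹)) *
        ∫⁻ lam, ((∫⁻ x, kmaj N (randOffset lam.2) lam.1 x p.2 p.1) *
          ENNReal.ofReal (afac lam.1 p.1)⁻¹) ∂lamMeas N :=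
        lintegral_const_mul _ (mk2.lintegral_prod_right'.mul
          (measurable_afac measurable_fst measurable_const).inv.ennreal_ofReal)
    _ ≤ _ := by
        rw [mul_comm]
        exact mul_le_mul_left (hC p.2 p.1 hp) _

end PositiveEstimate

section PositiveTheorem

variable {N : ℕ}

lemma inv_mul_le_sqrt {a b : ℝ≥0∞} (h : a ^ (1 / 2 : ℝ) ≤ b) :
    b⁻¹ * a ≤ a ^ (1 / 2 : ℝ) := by
  have hs : a = a ^ (1 / 2 : ℝ) * a ^ (1 / 2 : ℝ) := by
    rw [← ENNReal.rpow_add_of_nonneg _ _ (by norm_num) (by norm_num)]; norm_num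
  calc b⁻¹ * a = (b⁻¹ * a ^ (1 / 2 : ℝ)) * a ^ (1 / 2 : ℝ) := by rw [mul_assoc, ← hs]
    _ ≤ (b⁻¹ * b) * a ^ (1 / 2 : ℝ) := by gcongr
    _ ≤ 1 * a ^ (1 / 2 : ℝ) := by gcongr; exact ENNReal.inv_mul_le_one b
    _ = _ := one_mul _

lemma exists_lintegral_sqrt_le_of_weight (hN : 0 < N) : ∃ C : ℝ, ∀ {I : Type*} [MeasurableSpace I]
    (μ : Measure I) [SFinite μ] (G : I → ℝ × (Fin N → ℝ) → ℝ≥0∞),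
    Measurable (fun q : I × (ℝ × (Fin N → ℝ)) => G q.1 q.2) →
    ∀ B : (Fin N → ℝ) → ℝ≥0∞, Measurable B → (∀ x, B x ≠ 0) → ∫⁻ x, B x ≠ ⊤ →
    (∀ x, coneSq (fun p => ∫⁻ i, G i p ^ 2 ∂μ) x ^ (1 / 2 : ℝ) ≤ B x) →
    ∫⁻ x, (∫⁻ lam, ∫⁻ i, (∫⁻ p, G i p * kmaj N (randOffset lam.2) lam.1 x p.2 p.1 ∂hsMeas N) ^ 2
      ∂μ ∂lamMeas N) ^ (1 / 2 : ℝ) ≤ ENNReal.ofReal C * ∫⁻ x, B x := by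
  obtain ⟨C1, hC1⟩ := exists_lintegral_kmaj_right_le hN
  obtain ⟨C2, hC2⟩ := exists_lintegral_mwgt_le hN
  obtain ⟨C3, hC3⟩ := exists_lintegral_schur_le hN
  obtain ⟨C4, hC4⟩ := exists_lintegral_inv_wgt_le hN
  refine ⟨(max C1 0 * max C2 0 * (max C3 0 * max C4 0)) ^ (1 / 2 : ℝ),
    fun μ _ G hG B hB h0 hi hAB => ?_⟩
  set e : ℝ × (Fin N → ℝ) → ℝ≥0∞ := fun p => ∫⁻ i, G i p ^ 2 ∂μ with he_def
  have he : Measurable e := (hG.pow_const 2).lintegral_prod_left'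
  have mk : Measurable fun q : (Fin N → ℝ) × (ℤ × RSpace N) × (ℝ × (Fin N → ℝ)) =>
      kmaj N (randOffset q.2.1.2) q.2.1.1 q.1 q.2.2.2 q.2.2.1 :=
    measurable_kmaj (by fun_prop) (by fun_prop) (by fun_prop) (by fun_prop) (by fun_prop)
  have mw : Measurable fun q : (Fin N → ℝ) × (ℤ × RSpace N) × (ℝ × (Fin N → ℝ)) =>
      wgt B q.2.2.2 q.2.2.1 :=
    (measurable_wgt hB).comp (g := fun q : (Fin N → ℝ) × ℝ => wgt B q.1 q.2)
      (f := fun q : (Fin N → ℝ) × (ℤ × RSpace N) × (ℝ × (Fin N → ℝ)) => (q.2.2.2, q.2.2.1))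
      (by fun_prop)
  have ma : Measurable fun q : (Fin N → ℝ) × (ℤ × RSpace N) × (ℝ × (Fin N → ℝ)) =>
      afac q.2.1.1 q.2.2.1 := measurable_afac (by fun_prop) (by fun_prop)
  have mφ : Measurable fun q : (Fin N → ℝ) × (ℤ × RSpace N) × (ℝ × (Fin N → ℝ)) =>
      wgt B q.2.2.2 q.2.2.1 * ENNReal.ofReal (afac q.2.1.1 q.2.2.1 / q.2.2.1) :=
    mw.mul (ma.div (by fun_prop)).ennreal_ofReal
  have hm : Measurable fun q : (Fin N → ℝ) × (ℤ × RSpace N) × (ℝ × (Fin N → ℝ)) =>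
      e q.2.2 * kmaj N (randOffset q.2.1.2) q.2.1.1 q.1 q.2.2.2 q.2.2.1 *
        (wgt B q.2.2.2 q.2.2.1 * ENNReal.ofReal (afac q.2.1.1 q.2.2.1 / q.2.2.1))⁻¹ :=
    ((he.comp (by fun_prop)).mul mk).mul mφ.inv
  set U : (Fin N → ℝ) → ℝ≥0∞ := fun x => ∫⁻ lam, ∫⁻ p,
    e p * kmaj N (randOffset lam.2) lam.1 x p.2 p.1 *
      (wgt B p.2 p.1 * ENNReal.ofReal (afac lam.1 p.1 / p.1))⁻¹ ∂hsMeas N ∂lamMeas N with hU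
  have mU : Measurable U := by
    refine Measurable.lintegral_prod_right' (f := fun r : (Fin N → ℝ) × (ℤ × RSpace N) => ∫⁻ p,
      e p * kmaj N (randOffset r.2.2) r.2.1 r.1 p.2 p.1 *
      (wgt B p.2 p.1 * ENNReal.ofReal (afac r.2.1 p.1 / p.1))⁻¹ ∂hsMeas N) ?_
    exact Measurable.lintegral_prod_right' (hm.comp
        (f := fun r : ((Fin N → ℝ) × (ℤ × RSpace N)) × (ℝ × (Fin N → ℝ)) => (r.1.1, r.1.2, r.2))
        (by fun_prop))
  have pw : ∀ x, ∫⁻ lam, ∫⁻ i, (∫⁻ p, G i p * kmaj N (randOffset lam.2) lam.1 x p.2 p.1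
      ∂hsMeas N) ^ 2 ∂μ ∂lamMeas N ≤ ENNReal.ofReal C1 * mwgt B x * U x := by
    intro x
    rw [hU]
    have mkx : ∀ lam : ℤ × RSpace N, Measurable fun p : ℝ × (Fin N → ℝ) =>
        kmaj N (randOffset lam.2) lam.1 x p.2 p.1 := fun lam =>
      measurable_kmaj (by fun_prop) (by fun_prop) (by fun_prop) (by fun_prop) (by fun_prop)
    have mφx : ∀ lam : ℤ × RSpace N, Measurable fun p : ℝ × (Fin N → ℝ) =>
        wgt B p.2 p.1 * ENNReal.ofReal (afac lam.1 p.1 / p.1) := fun lam =>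
      mφ.comp (f := fun p : ℝ × (Fin N → ℝ) => (x, lam, p)) (by fun_prop)
    have mpart : Measurable fun r : ℤ × RSpace N => ∫⁻ p,
        e p * kmaj N (randOffset r.2) r.1 x p.2 p.1 *
        (wgt B p.2 p.1 * ENNReal.ofReal (afac r.1 p.1 / p.1))⁻¹ ∂hsMeas N :=
      Measurable.lintegral_prod_right' (hm.comp
        (f := fun r : (ℤ × RSpace N) × (ℝ × (Fin N → ℝ)) => (x, r.1, r.2)) (by fun_prop))
    rw [← lintegral_const_mul _ mpart]
    refine lintegral_mono fun lam => ?_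
    have hkφ : ∫⁻ p, kmaj N (randOffset lam.2) lam.1 x p.2 p.1 *
        (wgt B p.2 p.1 * ENNReal.ofReal (afac lam.1 p.1 / p.1)) ∂hsMeas N ≤
        ENNReal.ofReal C1 * mwgt B x := by
      exact (lintegral_hsMeas ((mkx lam).mul (mφx lam))).trans_le
        (hC1 B hB (randOffset lam.2) lam.1 x)
    have mGx : Measurable fun q : _ × (ℝ × (Fin N → ℝ)) => G q.1 q.2 ^ 2 *
        kmaj N (randOffset lam.2) lam.1 x q.2.2 q.2.1 *
        (wgt B q.2.2 q.2.1 * ENNReal.ofReal (afac lam.1 q.2.1 / q.2.1))⁻¹ :=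
      ((hG.pow_const 2).mul ((mkx lam).comp measurable_snd)).mul
        ((mφx lam).comp measurable_snd).inv
    calc _ ≤ ∫⁻ i, (∫⁻ p, G i p ^ 2 * kmaj N (randOffset lam.2) lam.1 x p.2 p.1 *
          (wgt B p.2 p.1 * ENNReal.ofReal (afac lam.1 p.1 / p.1))⁻¹ ∂hsMeas N) *
          (ENNReal.ofReal C1 * mwgt B x) ∂μ := by
          refine lintegral_mono fun i => ?_
          refine (sq_lintegral_mul_le (hG.of_uncurry_left (f := G)) (mkx lam) (mφx lam) ?_).trans
            (mul_le_mul_right hkφ _)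
          filter_upwards [ae_hsMeas_pos N] with p hp
          have := afac_pos lam.1 hp
          exact ⟨mul_ne_zero (wgt_ne_zero hN hB h0 hi p.2 hp)
            (ENNReal.ofReal_pos.2 (by positivity)).ne',
            ENNReal.mul_ne_top (wgt_ne_top hN hi p.2 p.1) ENNReal.ofReal_ne_top⟩
      _ = ENNReal.ofReal C1 * mwgt B x * ∫⁻ i, (∫⁻ p, G i p ^ 2 *
          kmaj N (randOffset lam.2) lam.1 x p.2 p.1 *
          (wgt B p.2 p.1 * ENNReal.ofReal (afac lam.1 p.1 / p.1))⁻¹ ∂hsMeas N) ∂μ := by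
          rw [lintegral_mul_const _ mGx.lintegral_prod_right', mul_comm]
      _ = _ := by
          rw [lintegral_lintegral_swap mGx.aemeasurable]
          congr 1
          refine lintegral_congr fun p => ?_
          have mi : Measurable fun i => G i p ^ 2 := (hG.of_uncurry_right (f := G)).pow_const 2
          rw [lintegral_mul_const _ (mi.mul_const _), lintegral_mul_const _ mi]
  have iU : ∫⁻ x, U x ≤ ENNReal.ofReal C3 * (ENNReal.ofReal C4 * ∫⁻ x, B x) := by
    refine (hC3 e he B hB h0 hi).trans ?_
    gcongr
    refine (hC4 e he B hB h0 hi).trans ?_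
    gcongr with z
    exact (inv_mul_le_sqrt (hAB z)).trans (hAB z)
  calc _ ≤ ∫⁻ x, (ENNReal.ofReal C1 * mwgt B x * U x) ^ (1 / 2 : ℝ) :=
        lintegral_mono fun x => ENNReal.rpow_le_rpow (pw x) (by norm_num)
    _ ≤ (∫⁻ x, ENNReal.ofReal C1 * mwgt B x) ^ (1 / 2 : ℝ) * (∫⁻ x, U x) ^ (1 / 2 : ℝ) :=
        lintegral_sqrt_mul_le ((measurable_mwgt hB).const_mul _) mU
    _ ≤ (ENNReal.ofReal C1 * (ENNReal.ofReal C2 * ∫⁻ x, B x)) ^ (1 / 2 : ℝ) *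
        (ENNReal.ofReal C3 * (ENNReal.ofReal C4 * ∫⁻ x, B x)) ^ (1 / 2 : ℝ) := by
        rw [lintegral_const_mul' _ _ ENNReal.ofReal_ne_top]
        gcongr
        exact hC2 B hB
    _ = _ := by
        have hC : ∀ c : ℝ, ENNReal.ofReal c = ENNReal.ofReal (max c 0) := fun c => by
          rcases le_total c 0 with h | h
          · rw [max_eq_right h, ENNReal.ofReal_of_nonpos h, ENNReal.ofReal_zero]
          · rw [max_eq_left h]
        rw [← ENNReal.ofReal_rpow_of_nonneg (by positivity) (by norm_num),
          ENNReal.ofReal_mul (by positivity), ENNReal.ofReal_mul (by positivity),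
          ENNReal.ofReal_mul (by positivity), ← hC, ← hC, ← hC, ← hC,
          ← ENNReal.mul_rpow_of_nonneg _ _ (by norm_num)]
        have hs : ∫⁻ x, B x = (((∫⁻ x, B x) * ∫⁻ x, B x) ^ (1 / 2 : ℝ)) := by
          rw [← sq, ← ENNReal.rpow_two, ← ENNReal.rpow_mul]; norm_num
        nth_rw 3 [hs]
        rw [← ENNReal.mul_rpow_of_nonneg _ _ (by norm_num)]
        congr 1
        ring

/-- The conical square function controls the square function built from the kernel majorants. -/
theorem exists_lintegral_kmaj_sq_le (hN : 0 < N) : ∃ C : ℝ, 0 < C ∧ ∀ {I : Type*}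
    [MeasurableSpace I] (μ : Measure I) [SFinite μ] (G : I → ℝ × (Fin N → ℝ) → ℝ≥0∞),
    Measurable (fun q : I × (ℝ × (Fin N → ℝ)) => G q.1 q.2) →
    ∫⁻ x, (∫⁻ lam, ∫⁻ i, (∫⁻ p, G i p * kmaj N (randOffset lam.2) lam.1 x p.2 p.1 ∂hsMeas N) ^ 2
      ∂μ ∂lamMeas N) ^ (1 / 2 : ℝ) ≤
      ENNReal.ofReal C * ∫⁻ x, coneSq (fun p => ∫⁻ i, G i p ^ 2 ∂μ) x ^ (1 / 2 : ℝ) := by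
  obtain ⟨C, hC⟩ := exists_lintegral_sqrt_le_of_weight hN
  have hC1 : 0 < max C 1 := lt_max_of_lt_right one_pos
  refine ⟨max C 1, hC1, fun μ _ G hG => ?_⟩
  set A : (Fin N → ℝ) → ℝ≥0∞ :=
    fun x => coneSq (fun p => ∫⁻ i, G i p ^ 2 ∂μ) x ^ (1 / 2 : ℝ) with hA
  have mA : Measurable A := (measurable_coneSq (hG.pow_const 2).lintegral_prod_left').pow_const _
  by_cases hAt : ∫⁻ x, A x = ⊤
  · rw [hAt, ENNReal.mul_top (ENNReal.ofReal_pos.2 hC1).ne']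
    exact le_top
  refine ENNReal.le_of_forall_pos_le_add fun ε hε _ => ?_
  obtain ⟨g, hg0, hgm, hgi⟩ := exists_pos_lintegral_lt_of_sigmaFinite
    (volume : Measure (Fin N → ℝ)) (ε := ε / ENNReal.ofReal (max C 1))
    (ENNReal.div_pos (by simpa using hε.ne') ENNReal.ofReal_ne_top).ne'
  have hgm' : Measurable fun x => (g x : ℝ≥0∞) := hgm.coe_nnreal_ennreal
  refine (hC μ G hG (fun x => A x + g x) (mA.add hgm') (fun x => ?_) ?_ fun x => ?_).trans ?_
  · simp [(hg0 x).ne']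
  · rw [lintegral_add_left mA]
    exact ENNReal.add_ne_top.2 ⟨hAt, (hgi.trans_le le_top).ne⟩
  · exact le_self_add
  · rw [lintegral_add_left mA]
    calc _ ≤ ENNReal.ofReal (max C 1) * ((∫⁻ x, A x) + ε / ENNReal.ofReal (max C 1)) := by
          gcongr
          exact le_max_left _ _
      _ = _ := by
          rw [mul_add, ENNReal.mul_div_cancel (ENNReal.ofReal_pos.2 hC1).ne' ENNReal.ofReal_ne_top]

end PositiveTheorem

/-! ### The scalar components as integral operators -/

section Components

variable {N : ℕ}

/-- The integral kernel of the scalar component with index `a` of the vectorized square function. -/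
def cker (N : ℕ) (a : Idx N) (x z : Fin N → ℝ) : ℝ :=
  match a with
  | Sum.inl (m, ω) => mker (randOffset ω) m x z
  | Sum.inr (q, d) =>
      q.2 ^ ((1 - (N : ℝ)) / 2) * fderiv ℝ (psn N) (x + q.1 - z, q.2) (hdir N d)

/-- An index is regular if its scale is positive. -/
def Reg : Idx N → Prop
  | Sum.inl _ => True
  | Sum.inr (q, _) => 0 < q.2

/-- The scalar component with index `a`, as an integral operator. -/
def cop (N : ℕ) (a : Idx N) (f : (Fin N → ℝ) → ℝ) (x : Fin N → ℝ) : ℝ :=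
  ∫ z, f z * cker N a x z

lemma measurable_sum_prod {A B D G : Type*} [MeasurableSpace A] [MeasurableSpace B]
    [MeasurableSpace D] [MeasurableSpace G] {f : (A ⊕ B) × D → G}
    (hl : Measurable fun q : A × D => f (Sum.inl q.1, q.2))
    (hr : Measurable fun q : B × D => f (Sum.inr q.1, q.2)) : Measurable f := by
  have h : Measurable (f ∘ (MeasurableEquiv.sumProdDistrib A B D).symm) :=
    measurable_fun_sum (by exact hl) (by exact hr)
  have := h.comp (MeasurableEquiv.sumProdDistrib A B D).measurable
  rwa [Function.comp_assoc, MeasurableEquiv.symm_comp_self, Function.comp_id] at this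

lemma measurable_indicator_dcube (k l : ℤ) {M : Type*} [MeasurableSpace M] {ω : M → RSpace N}
    {x z : M → Fin N → ℝ} (hω : Measurable ω) (hx : Measurable x) (hz : Measurable z) :
    Measurable fun m =>
      (dcube (randOffset (ω m) l) k (x m)).indicator (fun _ => (1 : ℝ)) (z m) := by
  have hfl : ∀ {u : M → Fin N → ℝ}, Measurable u → ∀ i, Measurable fun m =>
      ⌊(u m i - randOffset (ω m) l i) / (2 : ℝ) ^ k⌋ := fun hu i =>
    Int.measurable_floor.comp ((((measurable_pi_apply i).comp hu).sub
      ((measurable_pi_apply i).comp ((measurable_randOffset l).comp hω))).div_const _)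
  have hs : MeasurableSet {m | z m ∈ dcube (randOffset (ω m) l) k (x m)} := by
    simp only [mem_dcube_iff, Set.ofPred_forall]
    exact MeasurableSet.iInter fun i => measurableSet_eq_fun (hfl hz i) (hfl hx i)
  exact (measurable_const (a := (1 : ℝ))).indicator hs

lemma measurable_cker {M : Type*} [MeasurableSpace M] {a : M → Idx N} {x z : M → Fin N → ℝ}
    (ha : Measurable a) (hx : Measurable x) (hz : Measurable z) :
    Measurable fun m => cker N (a m) (x m) (z m) := by
  have key : Measurable fun q : Idx N × ((Fin N → ℝ) × (Fin N → ℝ)) =>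
      cker N q.1 q.2.1 q.2.2 := by
    refine measurable_sum_prod ?_ ?_
    · refine measurable_comp_of_countable
        (f := fun k (q : RSpace N × (Fin N → ℝ) × (Fin N → ℝ)) =>
          mker (randOffset q.1) k q.2.1 q.2.2) (fun k => ?_)
        (k := fun q : (ℤ × RSpace N) × ((Fin N → ℝ) × (Fin N → ℝ)) => q.1.1)
        (a := fun q => (q.1.2, q.2.1, q.2.2)) (by fun_prop) (by fun_prop)
      unfold mker
      exact ((measurable_indicator_dcube _ _ measurable_fst (by fun_prop) (by fun_prop)).const_mul
        _).sub ((measurable_indicator_dcube _ _ measurable_fst (by fun_prop)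
          (by fun_prop)).const_mul _)
    · refine Measurable.mul (by fun_prop) ?_
      exact measurable_fderiv_psn_apply
        (γ := fun q : (((Fin N → ℝ) × ℝ) × Fin (N + 1)) × ((Fin N → ℝ) × (Fin N → ℝ)) =>
          (q.2.1 + q.1.1.1 - q.2.2, q.1.1.2)) (by fun_prop)
        ((measurable_of_countable (hdir N)).comp (by fun_prop))
  exact key.comp (ha.prodMk (hx.prodMk hz))

lemma exists_cker_bound {a : Idx N} (ha : Reg a) :
    ∃ C : ℝ, ∀ x z, |cker N a x z| ≤ C := by
  obtain ⟨m, ω⟩ | ⟨q, d⟩ := a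
  · exact ⟨_, fun x z => abs_mker_le _ _ _ _⟩
  · obtain ⟨C, -, hC⟩ := exists_fderiv_psn_bound N
    refine ⟨q.2 ^ ((1 - (N : ℝ)) / 2) * (C / q.2 ^ (N + 1)), fun x z => ?_⟩
    have hq : 0 < q.2 := ha
    change |_ * _| ≤ _
    rw [abs_mul, abs_of_pos (by positivity)]
    exact mul_le_mul_of_nonneg_left (hC _ _ hq d) (by positivity)

lemma cop_inl (m : ℤ) (ω : RSpace N) {f : (Fin N → ℝ) → ℝ} (hf : Integrable f) (x : Fin N → ℝ) :
    cop N (Sum.inl (m, ω)) f x = mdiff (randOffset ω) m f x :=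
  (mdiff_eq_integral hf _ _ _).symm

lemma cop_inr (q : (Fin N → ℝ) × ℝ) (d : Fin (N + 1)) (f : (Fin N → ℝ) → ℝ) (x : Fin N → ℝ) :
    cop N (Sum.inr (q, d)) f x = q.2 ^ ((1 - (N : ℝ)) / 2) * pgrad N d f (x + q.1) q.2 := by
  rw [pgrad, ← integral_const_mul]
  refine integral_congr_ae (Eventually.of_forall fun z => ?_)
  change f z * (_ * _) = _ * (f z * _)
  ring

end Components

/-! ### The one-parameter estimate for vector-valued functions -/

section OneParameter

variable {N : ℕ}

lemma measurable_cop {M : Type*} [MeasurableSpace M] {a : M → Idx N} {Φ : M → (Fin N → ℝ) → ℝ}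
    {x : M → Fin N → ℝ} (ha : Measurable a)
    (hΦ : Measurable fun q : M × (Fin N → ℝ) => Φ q.1 q.2) (hx : Measurable x) :
    Measurable fun m => cop N (a m) (Φ m) (x m) := by
  have hm : Measurable fun q : M × (Fin N → ℝ) => Φ q.1 q.2 * cker N (a q.1) (x q.1) q.2 :=
    hΦ.mul (measurable_cker (ha.comp measurable_fst) (hx.comp measurable_fst) measurable_snd)
  exact (hm.stronglyMeasurable.integral_prod_right').measurable

lemma measurable_pgrad (d : Fin (N + 1)) {M : Type*} [MeasurableSpace M]
    {Φ : M → (Fin N → ℝ) → ℝ} {y : M → Fin N → ℝ} {t : M → ℝ}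
    (hΦ : Measurable fun q : M × (Fin N → ℝ) => Φ q.1 q.2) (hy : Measurable y)
    (ht : Measurable t) : Measurable fun m => pgrad N d (Φ m) (y m) (t m) := by
  have hm : Measurable fun q : M × (Fin N → ℝ) =>
      Φ q.1 q.2 * fderiv ℝ (psn N) (y q.1 - q.2, t q.1) (hdir N d) :=
    hΦ.mul (measurable_fderiv_psn_apply
      (γ := fun q : M × (Fin N → ℝ) => (y q.1 - q.2, t q.1)) (by fun_prop) measurable_const)
  exact (hm.stronglyMeasurable.integral_prod_right').measurable

lemma measurableSet_coneSet (N : ℕ) : MeasurableSet (coneSet N) :=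
  measurableSet_lt (by fun_prop) measurable_snd

lemma snd_pos_of_mem_coneSet {q : (Fin N → ℝ) × ℝ} (hq : q ∈ coneSet N) : 0 < q.2 :=
  (Real.sqrt_nonneg _).trans_lt hq

lemma sqrt_sum_sq_le (y : Fin N → ℝ) : Real.sqrt (∑ i, y i ^ 2) ≤ N * ‖y‖ := by
  refine Real.sqrt_le_iff.2 ⟨by positivity, ?_⟩
  calc ∑ i, y i ^ 2 ≤ ∑ _i : Fin N, ‖y‖ ^ 2 := by
        refine Finset.sum_le_sum fun i _ => ?_
        rw [← sq_abs]
        exact pow_le_pow_left₀ (abs_nonneg _) (norm_le_pi_norm y i) 2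
    _ = N * ‖y‖ ^ 2 := by simp
    _ ≤ (N * ‖y‖) ^ 2 := by
        rw [mul_pow]
        refine mul_le_mul_of_nonneg_right ?_ (by positivity)
        exact_mod_cast Nat.le_self_pow two_ne_zero N

lemma coneSq_le (hN : 0 < N) {e : ℝ × (Fin N → ℝ) → ℝ≥0∞} (he : Measurable e) (x : Fin N → ℝ) :
    coneSq e x ≤ ∫⁻ q in coneSet N, ENNReal.ofReal (q.2 ^ (1 - (N : ℝ))) * e (q.2, x + q.1) := by
  have hN' : (0 : ℝ) < N := by exact_mod_cast hN
  have hm : Measurable fun q : (Fin N → ℝ) × ℝ =>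
      ENNReal.ofReal (q.2 ^ (1 - (N : ℝ))) * e (q.2, x + q.1) :=
    Measurable.mul (by fun_prop) (he.comp (by fun_prop))
  rw [← lintegral_indicator (measurableSet_coneSet N), Measure.volume_eq_prod,
    lintegral_prod_symm _ (hm.indicator (measurableSet_coneSet N)).aemeasurable, coneSq,
    lintegral_hsMeas (by exact measurable_coneSq_integrand he measurable_const measurable_id)]
  refine (lintegral_mono fun t => ?_).trans (setLIntegral_le_lintegral _ _)
  rw [← lintegral_add_left_eq_self _ x]
  refine lintegral_mono fun y => ?_
  by_cases hy : ‖y‖ < t / N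
  · rw [Set.indicator_of_mem (by simpa only [Set.mem_ofPred_eq, add_sub_cancel_left] using hy),
      Set.indicator_of_mem]
    rw [lt_div_iff₀' hN'] at hy
    exact (sqrt_sum_sq_le y).trans_lt hy
  · rw [Set.indicator_of_notMem (by simpa only [Set.mem_ofPred_eq, add_sub_cancel_left] using hy)]
    exact zero_le

lemma lintegral_dyadIdxMeas {g : Idx N → ℝ≥0∞} (hg : Measurable g) :
    ∫⁻ a, g a ∂dyadIdxMeas N = ∫⁻ lam, g (Sum.inl lam) ∂lamMeas N :=
  lintegral_map hg measurable_inl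

lemma lintegral_lusinIdxMeas {g : Idx N → ℝ≥0∞} (hg : Measurable g) :
    ∫⁻ a, g a ∂lusinIdxMeas N = ∫⁻ q in coneSet N, ∑ d, g (Sum.inr (q, d)) := by
  have hg' : Measurable fun r => g (Sum.inr r) := hg.comp measurable_inr
  rw [lusinIdxMeas, lintegral_map hg measurable_inr, lintegral_prod _ hg'.aemeasurable]
  refine lintegral_congr fun q => ?_
  rw [lintegral_count, tsum_fintype]

lemma enorm_sq_eq_ofReal (r : ℝ) : ‖r‖ₑ ^ 2 = ENNReal.ofReal (r ^ 2) := by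
  rw [Real.enorm_eq_ofReal_abs, ← ENNReal.ofReal_pow (abs_nonneg r), sq_abs]

lemma sq_sum_le_ennreal {ι : Type*} (s : Finset ι) (f : ι → ℝ≥0∞) :
    (∑ i ∈ s, f i) ^ 2 ≤ s.card * ∑ i ∈ s, f i ^ 2 := by
  have := ENNReal.rpow_sum_le_const_mul_sum_rpow s f (p := 2) (by norm_num)
  simp only [ENNReal.rpow_two] at this
  norm_num at this
  exact this

/-- The estimate of the random dyadic square function by the Lusin square function, for functions
of one variable with values in a Hilbert space `L²(μ)`. -/
theorem exists_lintegral_dyad_le_lusin (hN : 0 < N) : ∃ C : ℝ, 0 < C ∧ ∀ {I : Type*}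
    [MeasurableSpace I] (μ : Measure I) [SFinite μ] (F : I → (Fin N → ℝ) → ℝ),
    Measurable (fun q : I × (Fin N → ℝ) => F q.1 q.2) → (∀ᵐ i ∂μ, Integrable (F i)) →
    ∫⁻ x, (∫⁻ a, ∫⁻ i, ENNReal.ofReal ((cop N a (F i) x) ^ 2) ∂μ ∂dyadIdxMeas N) ^ (1 / 2 : ℝ) ≤
      ENNReal.ofReal C *
        ∫⁻ x, (∫⁻ a, ∫⁻ i, ENNReal.ofReal ((cop N a (F i) x) ^ 2) ∂μ ∂lusinIdxMeas N) ^
          (1 / 2 : ℝ) := by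
  obtain ⟨C1, hC1⟩ := exists_enorm_mdiff_le hN
  obtain ⟨C2, hC2, h2⟩ := exists_lintegral_kmaj_sq_le hN
  refine ⟨C2 * (Real.sqrt (C1 ^ 2 * (N + 1)) + 1), by positivity, fun {I} _ μ _ F hF hint => ?_⟩
  have mP : ∀ d, Measurable fun q : I × ℝ × (Fin N → ℝ) => pgrad N d (F q.1) q.2.2 q.2.1 :=
    fun d => measurable_pgrad d (M := I × ℝ × (Fin N → ℝ)) (Φ := fun q => F q.1)
      (hF.comp (f := fun q : (I × ℝ × (Fin N → ℝ)) × (Fin N → ℝ) => (q.1.1, q.2)) (by fun_prop))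
      (by fun_prop) (by fun_prop)
  have mG : Measurable fun q : I × ℝ × (Fin N → ℝ) =>
      ENNReal.ofReal C1 * ∑ d, ‖pgrad N d (F q.1) q.2.2 q.2.1‖ₑ :=
    (Finset.measurable_sum _ fun d _ => (mP d).enorm).const_mul _
  set G : I → ℝ × (Fin N → ℝ) → ℝ≥0∞ := fun i p =>
    ENNReal.ofReal C1 * ∑ d, ‖pgrad N d (F i) p.2 p.1‖ₑ with hG
  have mcop : ∀ x, Measurable fun q : Idx N × I => ENNReal.ofReal ((cop N q.1 (F q.2) x) ^ 2) :=
    fun x => ((measurable_cop (M := Idx N × I) (Φ := fun q => F q.2) measurable_fst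
      (hF.comp (f := fun q : (Idx N × I) × (Fin N → ℝ) => (q.1.2, q.2)) (by fun_prop))
      (measurable_const (a := x))).pow_const 2).ennreal_ofReal
  have mcopI : ∀ x, Measurable fun a : Idx N =>
      ∫⁻ i, ENNReal.ofReal ((cop N a (F i) x) ^ 2) ∂μ := fun x =>
    (mcop x).lintegral_prod_right'
  have step1 : ∫⁻ x, (∫⁻ a, ∫⁻ i, ENNReal.ofReal ((cop N a (F i) x) ^ 2) ∂μ ∂dyadIdxMeas N) ^
      (1 / 2 : ℝ) ≤ ∫⁻ x, (∫⁻ lam, ∫⁻ i, (∫⁻ p, G i p *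
        kmaj N (randOffset lam.2) lam.1 x p.2 p.1 ∂hsMeas N) ^ 2 ∂μ ∂lamMeas N) ^ (1 / 2 : ℝ) := by
    refine lintegral_mono fun x => ENNReal.rpow_le_rpow ?_ (by norm_num)
    rw [lintegral_dyadIdxMeas (mcopI x)]
    refine lintegral_mono fun lam => lintegral_mono_ae ?_
    filter_upwards [hint] with i hi
    have mk : Measurable fun p : ℝ × (Fin N → ℝ) => (∑ d, ‖pgrad N d (F i) p.2 p.1‖ₑ) *
        kmaj N (randOffset lam.2) lam.1 x p.2 p.1 :=
      Measurable.mul (Finset.measurable_sum _ fun d _ => ((mP d).comp measurable_prodMk_left).enorm)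
        (measurable_kmaj measurable_const measurable_const measurable_const measurable_snd
          measurable_fst)
    rw [cop_inl _ _ hi, ← enorm_sq_eq_ofReal]
    refine pow_le_pow_left₀ zero_le ((hC1 _ hi _ _ _).trans_eq ?_) 2
    rw [← lintegral_hsMeas mk, ← lintegral_const_mul' _ _ ENNReal.ofReal_ne_top]
    refine lintegral_congr fun p => ?_
    rw [hG, mul_assoc]
  refine step1.trans ((h2 μ G mG).trans ?_)
  rw [ENNReal.ofReal_mul hC2.le, mul_assoc]
  refine mul_le_mul_right ?_ _
  rw [← lintegral_const_mul' _ _ ENNReal.ofReal_ne_top]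
  refine lintegral_mono fun x => ?_
  have me : Measurable fun p : ℝ × (Fin N → ℝ) => ∫⁻ i, G i p ^ 2 ∂μ :=
    Measurable.lintegral_prod_left' (f := fun q : I × ℝ × (Fin N → ℝ) => G q.1 q.2 ^ 2)
      (mG.pow_const 2)
  have main : coneSq (fun p => ∫⁻ i, G i p ^ 2 ∂μ) x ≤ ENNReal.ofReal (C1 ^ 2 * (N + 1)) *
      ∫⁻ a, ∫⁻ i, ENNReal.ofReal ((cop N a (F i) x) ^ 2) ∂μ ∂lusinIdxMeas N := by
    refine (coneSq_le hN me x).trans ?_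
    rw [lintegral_lusinIdxMeas (mcopI x), ← lintegral_const_mul' _ _ ENNReal.ofReal_ne_top]
    refine setLIntegral_mono' (measurableSet_coneSet N) fun q hq => ?_
    have hq0 := snd_pos_of_mem_coneSet hq
    have mc : ∀ d, Measurable fun i => ENNReal.ofReal (cop N (Sum.inr (q, d)) (F i) x ^ 2) :=
      fun d => (mcop x).comp measurable_prodMk_left
    rw [← lintegral_finsetSum _ fun d _ => mc d,
      ← lintegral_const_mul' _ _ ENNReal.ofReal_ne_top,
      ← lintegral_const_mul' _ _ ENNReal.ofReal_ne_top]
    refine lintegral_mono fun i => ?_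
    have e1 : ∀ d, ENNReal.ofReal (cop N (Sum.inr (q, d)) (F i) x ^ 2) =
        ENNReal.ofReal (q.2 ^ (1 - (N : ℝ))) * ‖pgrad N d (F i) (x + q.1) q.2‖ₑ ^ 2 := by
      intro d
      rw [cop_inr, mul_pow, ENNReal.ofReal_mul (by positivity), enorm_sq_eq_ofReal,
        ← Real.rpow_natCast, ← Real.rpow_mul hq0.le]
      norm_num
    simp only [e1, hG]
    rw [← Finset.mul_sum, mul_left_comm, mul_pow]
    refine mul_le_mul_right ?_ _
    rw [ENNReal.ofReal_mul (by positivity), mul_assoc]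
    refine mul_le_mul' ?_ ?_
    · rw [← enorm_sq_eq_ofReal]
      refine pow_le_pow_left₀ zero_le ?_ 2
      rw [Real.enorm_eq_ofReal_abs]
      exact ENNReal.ofReal_le_ofReal (le_abs_self _)
    · refine (sq_sum_le_ennreal _ _).trans_eq ?_
      rw [Finset.card_univ, Fintype.card_fin, ← ENNReal.ofReal_natCast, Nat.cast_add_one]
  refine (ENNReal.rpow_le_rpow main (by norm_num : (0 : ℝ) ≤ 1 / 2)).trans ?_
  rw [ENNReal.mul_rpow_of_nonneg _ _ (by norm_num),
    ENNReal.ofReal_rpow_of_nonneg (by positivity) (by norm_num), ← Real.sqrt_eq_rpow]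
  exact mul_le_mul_left (ENNReal.ofReal_le_ofReal (le_add_of_nonneg_right zero_le_one)) _

end OneParameter

/-! ### The components of the square functions in one variable -/

section PoissonDerivative

variable {N : ℕ}

lemma fderiv_poisson_eq {f : (Fin N → ℝ) → ℝ} (hf : Integrable f) (x : Fin N → ℝ) {t : ℝ}
    (ht : 0 < t) (d : Fin (N + 1)) :
    fderiv ℝ (fun w : (Fin N → ℝ) × ℝ => ∫ z, f z * pk N (w.1 - z) w.2) (x, t) (hdir N d) =
      pgrad N d f x t := by
  obtain ⟨C, hC0, hC⟩ := exists_psn_bounds N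
  have ht2 : 0 < t / 2 := half_pos ht
  have hs : {w : (Fin N → ℝ) × ℝ | t / 2 < w.2} ∈ 𝓝 (x, t) :=
    (isOpen_lt continuous_const continuous_snd).mem_nhds (half_lt_self ht)
  have hmeas : ∀ w : (Fin N → ℝ) × ℝ, AEStronglyMeasurable (fun z => f z * pk N (w.1 - z) w.2) :=
    fun w => hf.aestronglyMeasurable.mul ((measurable_psn N).comp
      (show Measurable fun z : Fin N → ℝ => (w.1 - z, w.2) by fun_prop)).aestronglyMeasurable
  have hmeas' : AEStronglyMeasurable
      (fun z => f z • fderiv ℝ (psn N) (x - z, t)) :=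
    hf.aestronglyMeasurable.smul ((measurable_fderiv ℝ (psn N)).comp
      (show Measurable fun z : Fin N → ℝ => (x - z, t) by fun_prop)).aestronglyMeasurable
  have hbd : ∀ z, ∀ w ∈ {w : (Fin N → ℝ) × ℝ | t / 2 < w.2},
      ‖f z • fderiv ℝ (psn N) (w.1 - z, w.2)‖ ≤ ‖f z‖ * (C / (t / 2) ^ (N + 1)) := by
    intro z w hw
    have hw' : t / 2 < w.2 := hw
    rw [norm_smul]
    refine mul_le_mul_of_nonneg_left
      ((hC (w.1 - z, w.2) (ht2.trans hw')).2.1.trans ?_) (norm_nonneg _)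
    change C / w.2 ^ (N + 1) ≤ _
    gcongr
  have hint : Integrable fun z => f z * pk N (x - z) t := by
    refine (hf.norm.mul_const (C / t ^ N)).mono' (hmeas (x, t)) (Eventually.of_forall fun z => ?_)
    rw [norm_mul]
    exact mul_le_mul_of_nonneg_left (hC (x - z, t) ht).1 (norm_nonneg _)
  have hbint : Integrable fun z => ‖f z‖ * (C / (t / 2) ^ (N + 1)) := hf.norm.mul_const _
  have hder := hasFDerivAt_integral_of_dominated_of_fderiv_le (𝕜 := ℝ)
    (F := fun (w : (Fin N → ℝ) × ℝ) z => f z * pk N (w.1 - z) w.2)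
    (F' := fun w z => f z • fderiv ℝ (psn N) (w.1 - z, w.2)) hs
    (Eventually.of_forall hmeas) hint hmeas'
    (Eventually.of_forall hbd) hbint (Eventually.of_forall fun z w hw => by
      have hw' : t / 2 < w.2 := hw
      have h1 : HasFDerivAt (psn N) (fderiv ℝ (psn N) (w.1 - z, w.2)) (w - (z, 0)) := by
        have e : w - (z, 0) = (w.1 - z, w.2) := by ext <;> simp
        rw [e]
        exact ((contDiffAt_psn (ne_zero_of_snd_pos (w := (w.1 - z, w.2)) (ht2.trans hw'))).differentiableAt
          (by norm_num)).hasFDerivAt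
      have h2 := (h1.comp w ((hasFDerivAt_id w).sub_const (z, (0 : ℝ)))).const_mul (f z)
      refine (h2.congr_fderiv ?_).congr_of_eventuallyEq (Eventually.of_forall fun v => ?_)
      · rw [ContinuousLinearMap.comp_id]
      · simp [psn])
  rw [hder.fderiv, ContinuousLinearMap.integral_apply, pgrad]
  · rfl
  · exact hbint.mono' hmeas' (Eventually.of_forall fun z => hbd z (x, t) (half_lt_self ht))

end PoissonDerivative

section MultiParameter

variable {n : ℕ} {Nd : Fin n → ℕ}

lemma opComp_eq_cop (j : Fin n) {a : Idx (Nd j)} (ha : Reg a) {f : X n Nd → ℝ} {x : X n Nd}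
    (hf : Integrable fun z => f (Function.update x j z)) :
    opComp n Nd j a f x = cop (Nd j) a (fun z => f (Function.update x j z)) (x j) := by
  obtain ⟨m, ω⟩ | ⟨q, d⟩ := a
  · exact (cop_inl m ω hf _).symm
  · rw [cop_inr, ← fderiv_poisson_eq hf _ ha]
    rfl

lemma cop_congr_ae {N : ℕ} (a : Idx N) {f g : (Fin N → ℝ) → ℝ} (h : f =ᵐ[volume] g)
    (x : Fin N → ℝ) : cop N a f x = cop N a g x :=
  integral_congr_ae (h.mono fun z hz => by simp only [hz])

lemma enorm_cop_le {N : ℕ} {a : Idx N} {C : ℝ} (hC : ∀ x z, |cker N a x z| ≤ C)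
    (f : (Fin N → ℝ) → ℝ) (x : Fin N → ℝ) :
    ‖cop N a f x‖ₑ ≤ ENNReal.ofReal C * ∫⁻ z, ‖f z‖ₑ := by
  refine (enorm_integral_le_lintegral_enorm _).trans ?_
  rw [← lintegral_const_mul' _ _ ENNReal.ofReal_ne_top]
  refine lintegral_mono fun z => ?_
  rw [enorm_mul, mul_comm]
  refine mul_le_mul_left ?_ _
  rw [Real.enorm_eq_ofReal_abs]
  exact ENNReal.ofReal_le_ofReal (hC x z)

end MultiParameter

/-! ### Almost everywhere statements on slices of product spaces -/

section Slices

variable {δ : Type*} {Y : δ → Type*} [∀ i, MeasurableSpace (Y i)] {μ : (i : δ) → Measure (Y i)}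
  [DecidableEq δ] [∀ i, SigmaFinite (μ i)] [Fintype δ]

lemma ae_lmarginal_lt_top {f : (∀ i, Y i) → ℝ≥0∞} (hf : Measurable f)
    (hfi : ∫⁻ x, f x ∂Measure.pi μ ≠ ⊤) (s : Finset δ) :
    ∀ᵐ x ∂Measure.pi μ, (∫⋯∫⁻_s, f ∂μ) x < ⊤ := by
  set A : Set (∀ i, Y i) := {x | (∫⋯∫⁻_s, f ∂μ) x = ⊤} with hA
  have hAm : MeasurableSet A := hf.lmarginal μ (measurableSet_singleton _)
  have h1 : Measurable (A.indicator fun _ => (1 : ℝ≥0∞)) := measurable_const.indicator hAm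
  have h0 : Measure.pi μ A = 0 := by
    rcases isEmpty_or_nonempty (∀ i, Y i) with he | ⟨⟨x₀⟩⟩
    · rw [Set.eq_empty_of_isEmpty A, measure_empty]
    have h2 : (∫⋯∫⁻_sᶜ, A.indicator (fun _ => 1) ∂μ) = fun _ => (0 : ℝ≥0∞) := by
      funext x
      have h3 : (∫⋯∫⁻_sᶜ, (∫⋯∫⁻_s, f ∂μ) ∂μ) x ≠ ⊤ := by
        rw [← lmarginal_union' μ f hf disjoint_compl_right, Finset.union_compl]
        rwa [← lintegral_eq_lmarginal_univ]
      have h4 := ae_lt_top ((hf.lmarginal μ).comp measurable_updateFinset) h3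
      refine (lintegral_congr_ae (h4.mono fun y hy => ?_)).trans lintegral_zero
      exact Set.indicator_of_notMem (s := A) (f := fun _ => (1 : ℝ≥0∞)) (fun h => hy.ne h)
    rw [← lintegral_indicator_one hAm]
    change ∫⁻ x, A.indicator (fun _ => (1 : ℝ≥0∞)) x ∂Measure.pi μ = 0
    rw [lintegral_eq_lmarginal_univ x₀, ← Finset.union_compl s,
      lmarginal_union μ _ h1 disjoint_compl_right, h2]
    exact lintegral_zero
  filter_upwards [measure_eq_zero_iff_ae_notMem.1 h0] with x hx
  exact lt_top_iff_ne_top.2 hx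

lemma ae_ae_update {p : (∀ i, Y i) → Prop} (hp : ∀ᵐ x ∂Measure.pi μ, p x) (j : δ) :
    ∀ᵐ x ∂Measure.pi μ, ∀ᵐ z ∂μ j, p (Function.update x j z) := by
  obtain ⟨A, hA, hAm, hA0⟩ := exists_measurable_superset_of_null hp
  have hm : Measurable (A.indicator fun _ => (⊤ : ℝ≥0∞)) := measurable_const.indicator hAm
  have h := ae_lmarginal_lt_top (μ := μ) hm
    (by rw [lintegral_indicator_const hAm, hA0, mul_zero]; exact ENNReal.zero_ne_top) {j}
  filter_upwards [h] with x hx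
  rw [lmarginal_singleton] at hx
  filter_upwards [ae_lt_top (hm.comp (measurable_update x)) hx.ne] with z hz
  by_contra hc
  rw [Function.comp_apply, Set.indicator_of_mem (hA hc)] at hz
  exact lt_irrefl _ hz

end Slices

/-! ### Composition of components in several variables -/

section MultiParameter

variable {n : ℕ} {Nd : Fin n → ℕ}

/-- The composition of the components over the variables in `l`, as integral operators. -/
def cfold (ι : ∀ j, Idx (Nd j)) (l : List (Fin n)) (f : X n Nd → ℝ) : X n Nd → ℝ :=
  l.foldr (fun j g x => cop (Nd j) (ι j) (fun z => g (Function.update x j z)) (x j)) f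

lemma cfold_cons (ι : ∀ j, Idx (Nd j)) (j : Fin n) (l : List (Fin n)) (f : X n Nd → ℝ)
    (x : X n Nd) : cfold ι (j :: l) f x =
      cop (Nd j) (ι j) (fun z => cfold ι l f (Function.update x j z)) (x j) := rfl

lemma measurable_update_comp {M : Type*} [MeasurableSpace M] (j : Fin n) {x : M → X n Nd}
    {z : M → Fin (Nd j) → ℝ} (hx : Measurable x) (hz : Measurable z) :
    Measurable fun m => Function.update (x m) j (z m) := by
  refine measurable_pi_lambda _ fun i => ?_
  by_cases h : i = j
  · subst h
    simpa only [Function.update_self] using hz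
  · simp only [Function.update_of_ne h]
    exact (measurable_pi_apply i).comp hx

lemma measurable_cfold {f : X n Nd → ℝ} (hf : Measurable f) (l : List (Fin n)) {M : Type*}
    [MeasurableSpace M] {ι : M → ∀ j, Idx (Nd j)} {x : M → X n Nd} (hι : Measurable ι)
    (hx : Measurable x) : Measurable fun m => cfold (ι m) l f (x m) := by
  induction l generalizing M with
  | nil => exact hf.comp hx
  | cons j l ih =>
    simp only [cfold_cons]
    refine measurable_cop
      (Φ := fun m z => cfold (ι m) l f (Function.update (x m) j z))
      ((measurable_pi_apply j).comp hι) ?_ ((measurable_pi_apply j).comp hx)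
    exact ih (M := M × (Fin (Nd j) → ℝ)) (hι.comp measurable_fst)
      (measurable_update_comp j (hx.comp measurable_fst) measurable_snd)

lemma cfold_update_of_notMem (ι : ∀ j, Idx (Nd j)) {j : Fin n} (a : Idx (Nd j))
    {l : List (Fin n)} (hj : j ∉ l) (f : X n Nd → ℝ) :
    cfold (Function.update ι j a) l f = cfold ι l f := by
  induction l with
  | nil => rfl
  | cons i l ih =>
    rw [List.mem_cons, not_or] at hj
    funext x
    rw [cfold_cons, cfold_cons, ih hj.2, Function.update_of_ne (Ne.symm hj.1)]

lemma exists_enorm_cfold_le {f : X n Nd → ℝ} (hf : Measurable f) {ι : ∀ j, Idx (Nd j)}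
    (hι : ∀ j, Reg (ι j)) {l : List (Fin n)} (hl : l.Nodup) : ∃ C : ℝ, ∀ x,
    ‖cfold ι l f x‖ₑ ≤
      ENNReal.ofReal C * (∫⋯∫⁻_l.toFinset, (fun x => ‖f x‖ₑ) ∂fun _ => volume) x := by
  induction l with
  | nil => exact ⟨1, fun x => by simp [cfold]⟩
  | cons j l ih =>
    rw [List.nodup_cons] at hl
    obtain ⟨C, hC⟩ := ih hl.2
    obtain ⟨D, hD⟩ := exists_cker_bound (hι j)
    have hD0 : 0 ≤ D := (abs_nonneg _).trans (hD 0 0)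
    refine ⟨D * C, fun x => ?_⟩
    rw [cfold_cons, List.toFinset_cons,
      lmarginal_insert _ hf.enorm (by simpa using hl.1), ENNReal.ofReal_mul hD0, mul_assoc,
      ← lintegral_const_mul' _ _ ENNReal.ofReal_ne_top]
    exact (enorm_cop_le hD _ _).trans (mul_le_mul_right (lintegral_mono fun z => hC _) _)

lemma integrable_cfold_update {f : X n Nd → ℝ} (hf : Measurable f) {ι : ∀ j, Idx (Nd j)}
    (hι : ∀ j, Reg (ι j)) {j : Fin n} {l : List (Fin n)} (hl : (j :: l).Nodup) {x : X n Nd}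
    (hx : (∫⋯∫⁻_(j :: l).toFinset, (fun x => ‖f x‖ₑ) ∂fun _ => volume) x < ⊤) :
    Integrable fun z => cfold ι l f (Function.update x j z) := by
  rw [List.nodup_cons] at hl
  rw [List.toFinset_cons, lmarginal_insert _ hf.enorm (by simpa using hl.1)] at hx
  obtain ⟨C, hC⟩ := exists_enorm_cfold_le hf hι hl.2
  refine ⟨(measurable_cfold hf l measurable_const
    (measurable_update_comp j measurable_const measurable_id)).aestronglyMeasurable, ?_⟩
  refine (lintegral_mono fun z => hC _).trans_lt ?_
  rw [lintegral_const_mul' _ _ ENNReal.ofReal_ne_top]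
  exact ENNReal.mul_lt_top ENNReal.ofReal_lt_top hx

lemma ae_foldr_opComp_eq_cfold {f g : X n Nd → ℝ} (hfg : f =ᵐ[volume] g) (hg : Measurable g)
    (hgi : Integrable g) {l : List (Fin n)} (hl : l.Nodup) :
    ∀ᵐ x, ∀ ι : ∀ j, Idx (Nd j), (∀ j, Reg (ι j)) →
      l.foldr (fun j h => opComp n Nd j (ι j) h) f x = cfold ι l g x := by
  induction l with
  | nil => exact hfg.mono fun x hx ι _ => hx
  | cons j l ih =>
    have h1 := ae_ae_update (μ := fun j : Fin n => (volume : Measure (Fin (Nd j) → ℝ)))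
      (ih (List.nodup_cons.1 hl).2) j
    have h2 := ae_lmarginal_lt_top (μ := fun j : Fin n => (volume : Measure (Fin (Nd j) → ℝ)))
      hg.enorm hgi.2.ne (j :: l).toFinset
    filter_upwards [h1, h2] with x hx1 hx2 ι hι
    have hae : (fun z => l.foldr (fun j h => opComp n Nd j (ι j) h) f (Function.update x j z))
        =ᵐ[volume] fun z => cfold ι l g (Function.update x j z) := hx1.mono fun z hz => hz ι hι
    rw [List.foldr_cons, opComp_eq_cop j (hι j)
      ((integrable_congr hae).2 (integrable_cfold_update hg hι hl hx2)), cop_congr_ae _ hae,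
      cfold_cons]

end MultiParameter

/-! ### Iterated integration over the index spaces -/

section IndexIntegrals

lemma measurableEmbedding_inl {α β : Type*} [MeasurableSpace α] [MeasurableSpace β] :
    MeasurableEmbedding (Sum.inl : α → α ⊕ β) :=
  ⟨Sum.inl_injective, measurable_inl, fun _ hs => hs.inl_image⟩

lemma measurableEmbedding_inr {α β : Type*} [MeasurableSpace α] [MeasurableSpace β] :
    MeasurableEmbedding (Sum.inr : β → α ⊕ β) :=
  ⟨Sum.inr_injective, measurable_inr, fun _ hs => measurableSet_inr_image.2 hs⟩

instance idxMeas.instSigmaFinite (M : ℕ) (b : Bool) : SigmaFinite (idxMeas M b) := by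
  unfold idxMeas dyadIdxMeas lusinIdxMeas
  split_ifs
  · exact measurableEmbedding_inr.sigmaFinite_map
  · exact measurableEmbedding_inl.sigmaFinite_map

lemma ae_idxMeas_reg (M : ℕ) (b : Bool) : ∀ᵐ a ∂idxMeas M b, Reg a := by
  unfold idxMeas dyadIdxMeas lusinIdxMeas
  split_ifs
  · rw [measurableEmbedding_inr.ae_map_iff]
    have h : ∀ᵐ q ∂volume.restrict (coneSet M), 0 < q.2 :=
      (ae_restrict_iff' (measurableSet_coneSet M)).2
        (Eventually.of_forall fun q hq => snd_pos_of_mem_coneSet hq)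
    exact Measure.quasiMeasurePreserving_fst.ae h
  · rw [measurableEmbedding_inl.ae_map_iff]
    exact Eventually.of_forall fun _ => trivial

variable {n : ℕ} {Nd : Fin n → ℕ} {ch : Fin n → Bool}

lemma intAll_congr_reg (l : List (Fin n)) {F G : (∀ j, Idx (Nd j)) → ℝ≥0∞}
    (h : ∀ ι, (∀ j, Reg (ι j)) → F ι = G ι) {ι : ∀ j, Idx (Nd j)} (hι : ∀ j, Reg (ι j)) :
    intAll n Nd ch l F ι = intAll n Nd ch l G ι := by
  induction l generalizing ι with
  | nil => exact h ι hι
  | cons j l ih =>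
    refine lintegral_congr_ae ((ae_idxMeas_reg _ _).mono fun a ha => ih fun i => ?_)
    by_cases hij : i = j
    · subst hij
      rwa [Function.update_self]
    · rw [Function.update_of_ne hij]
      exact hι i

lemma intAll_congr_choice {ch' : Fin n → Bool} {l : List (Fin n)} (h : ∀ j ∈ l, ch j = ch' j)
    (F : (∀ j, Idx (Nd j)) → ℝ≥0∞) (ι : ∀ j, Idx (Nd j)) :
    intAll n Nd ch l F ι = intAll n Nd ch' l F ι := by
  induction l generalizing ι with
  | nil => rfl
  | cons j l ih =>
    simp only [intAll]
    rw [h j List.mem_cons_self]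
    exact lintegral_congr fun a => ih (fun i hi => h i (List.mem_cons_of_mem _ hi)) _

lemma intAll_eq_lmarginal {l : List (Fin n)} (hl : l.Nodup) {F : (∀ j, Idx (Nd j)) → ℝ≥0∞}
    (hF : Measurable F) (ι : ∀ j, Idx (Nd j)) :
    intAll n Nd ch l F ι =
      (∫⋯∫⁻_l.toFinset, F ∂fun j => idxMeas (Nd j) (ch j)) ι := by
  induction l generalizing ι with
  | nil => simp [intAll]
  | cons j l ih =>
    rw [List.nodup_cons] at hl
    rw [List.toFinset_cons, lmarginal_insert _ hF (by simpa using hl.1)]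
    exact lintegral_congr fun a => ih hl.2 _

end IndexIntegrals

section Assembly

variable {m : ℕ} {Nd : Fin (m + 1) → ℕ}

/-- The variables other than the first one. -/
def tailVars (m : ℕ) : List (Fin (m + 1)) := (List.finRange m).map Fin.succ

lemma finRange_eq (m : ℕ) : List.finRange (m + 1) = 0 :: tailVars m := List.finRange_succ

lemma zero_notMem_tailVars (m : ℕ) : (0 : Fin (m + 1)) ∉ tailVars m := by
  simp [tailVars, Fin.succ_ne_zero]

lemma nodup_cons_tailVars (m : ℕ) : (0 :: tailVars m).Nodup :=
  finRange_eq m ▸ List.nodup_finRange _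

/-- The index space of the variables other than the first one. -/
abbrev TailIdx (Nd : Fin (m + 1) → ℕ) := ∀ i : ↥(tailVars m).toFinset, Idx (Nd i)

/-- The index measure of the variables other than the first one. -/
def tailMeas (Nd : Fin (m + 1) → ℕ) (ch : Fin (m + 1) → Bool) : Measure (TailIdx Nd) :=
  Measure.pi fun i => idxMeas (Nd i) (ch i)

instance (Nd : Fin (m + 1) → ℕ) (ch : Fin (m + 1) → Bool) : SFinite (tailMeas Nd ch) := by
  unfold tailMeas; infer_instance

/-- The index of all variables determined by the index of the variables other than the first. -/
def tailIdx (i : TailIdx Nd) : ∀ j, Idx (Nd j) :=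
  Function.updateFinset (defIdx (m + 1) Nd) _ i

lemma measurable_tailIdx : Measurable (tailIdx (Nd := Nd)) := measurable_updateFinset

lemma ae_tailIdx_reg (ch : Fin (m + 1) → Bool) :
    ∀ᵐ i ∂tailMeas Nd ch, ∀ j, Reg (tailIdx i j) := by
  rw [ae_all_iff]
  intro j
  by_cases hj : j ∈ (tailVars m).toFinset
  · have := (Measure.quasiMeasurePreserving_eval
      (fun i : ↥(tailVars m).toFinset => idxMeas (Nd i) (ch i)) ⟨j, hj⟩).ae
      (ae_idxMeas_reg (Nd j) (ch j))
    refine this.mono fun i hi => ?_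
    simpa only [tailIdx, Function.updateFinset, hj, dite_true] using hi
  · refine Eventually.of_forall fun i => ?_
    simp only [tailIdx, Function.updateFinset, hj, dite_false]
    trivial

/-- The norm of the tensor product of square functions, computed with integral operators. -/
def tensorSq (Nd : Fin (m + 1) → ℕ) (ch : Fin (m + 1) → Bool) (b : Bool) (g : X (m + 1) Nd → ℝ)
    (x : X (m + 1) Nd) : ℝ≥0∞ :=
  ∫⁻ a, ∫⁻ i, ENNReal.ofReal ((cop (Nd 0) a (fun z => cfold (tailIdx i) (tailVars m) g
    (Function.update x 0 z)) (x 0)) ^ 2) ∂tailMeas Nd ch ∂idxMeas (Nd 0) b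

lemma measurable_tensorSq (ch : Fin (m + 1) → Bool) (b : Bool) {g : X (m + 1) Nd → ℝ}
    (hg : Measurable g) : Measurable (tensorSq Nd ch b g) := by
  have h : Measurable fun q : (X (m + 1) Nd × Idx (Nd 0)) × TailIdx Nd =>
      ENNReal.ofReal ((cop (Nd 0) q.1.2 (fun z => cfold (tailIdx q.2) (tailVars m) g
        (Function.update q.1.1 0 z)) (q.1.1 0)) ^ 2) := by
    refine Measurable.ennreal_ofReal (Measurable.pow_const ?_ 2)
    refine measurable_cop (Φ := fun (q : (X (m + 1) Nd × Idx (Nd 0)) × TailIdx Nd) z =>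
      cfold (tailIdx q.2) (tailVars m) g (Function.update q.1.1 0 z)) (by fun_prop) ?_ (by fun_prop)
    exact measurable_cfold hg _ (measurable_tailIdx.comp (by fun_prop))
      (measurable_update_comp 0 (by fun_prop) (by fun_prop))
  exact (h.lintegral_prod_right').lintegral_prod_right'

lemma ae_tensorNormSq_eq {ch : Fin (m + 1) → Bool} {b : Bool} {f g : X (m + 1) Nd → ℝ}
    (hfg : f =ᵐ[volume] g) (hg : Measurable g) (hgi : Integrable g) :
    ∀ᵐ x, tensorNormSq (m + 1) Nd (Function.update ch 0 b) f x = tensorSq Nd ch b g x := by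
  filter_upwards [ae_foldr_opComp_eq_cfold hfg hg hgi (nodup_cons_tailVars m)] with x hx
  have hm : Measurable fun ι : ∀ j, Idx (Nd j) =>
      ENNReal.ofReal (cfold ι (0 :: tailVars m) g x ^ 2) :=
    ((measurable_cfold hg _ measurable_id measurable_const).pow_const 2).ennreal_ofReal
  have h0 : (0 : Fin (m + 1)) ∉ (tailVars m).toFinset := by simpa using zero_notMem_tailVars m
  have hdef : ∀ j, Reg (defIdx (m + 1) Nd j) := fun _ => trivial
  rw [tensorNormSq, finRange_eq, intAll_congr_reg (G := fun ι => ENNReal.ofReal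
    (cfold ι (0 :: tailVars m) g x ^ 2)) _ (fun ι hι => by
      rw [compAll, finRange_eq, hx ι hι]) hdef, intAll, tensorSq, Function.update_self]
  refine lintegral_congr fun a => ?_
  rw [intAll_congr_choice (ch' := ch) (fun j hj => Function.update_of_ne
      (ne_of_mem_of_not_mem hj (zero_notMem_tailVars m)) _ _),
    intAll_eq_lmarginal (nodup_cons_tailVars m).of_cons hm, lmarginal, tailMeas]
  refine lintegral_congr fun i => ?_
  have e : Function.updateFinset (Function.update (defIdx (m + 1) Nd) 0 a) _ i =
      Function.update (tailIdx i) 0 a := by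
    funext j
    by_cases hj : j = 0
    · subst hj
      simp [Function.updateFinset, h0]
    · simp [Function.updateFinset, tailIdx, hj]
  rw [e, cfold_cons, Function.update_self, cfold_update_of_notMem _ _ (zero_notMem_tailVars m)]

lemma tensorL1Norm_eq {ch : Fin (m + 1) → Bool} {b : Bool} {f g : X (m + 1) Nd → ℝ}
    (hfg : f =ᵐ[volume] g) (hg : Measurable g) (hgi : Integrable g) :
    tensorL1Norm (m + 1) Nd (Function.update ch 0 b) f =
      ∫⁻ x, tensorSq Nd ch b g x ^ (1 / 2 : ℝ) :=
  lintegral_congr_ae ((ae_tensorNormSq_eq (ch := ch) (b := b) hfg hg hgi).mono fun x hx => by simp only [hx])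

lemma exists_lintegral_tensorSq_le (h0 : 0 < Nd 0) (ch : Fin (m + 1) → Bool) : ∃ C : ℝ, 0 < C ∧
    ∀ g : X (m + 1) Nd → ℝ, Measurable g → Integrable g →
      ∫⁻ x, tensorSq Nd ch false g x ^ (1 / 2 : ℝ) ≤
        ENNReal.ofReal C * ∫⁻ x, tensorSq Nd ch true g x ^ (1 / 2 : ℝ) := by
  obtain ⟨C, hC, hcore⟩ := exists_lintegral_dyad_le_lusin h0
  refine ⟨C, hC, fun g hg hgi => ?_⟩
  have hm : ∀ b, Measurable fun x => tensorSq Nd ch b g x ^ (1 / 2 : ℝ) := fun b =>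
    (measurable_tensorSq ch b hg).pow_const _
  rw [← lintegral_const_mul' _ _ ENNReal.ofReal_ne_top]
  refine lintegral_le_of_lmarginal_le (μ := fun j : Fin (m + 1) =>
    (volume : Measure (Fin (Nd j) → ℝ))) {0} (hm _) ((hm _).const_mul _) fun x => ?_
  rw [lmarginal_singleton, lmarginal_singleton]
  have hlt : (∫⋯∫⁻_(0 :: tailVars m).toFinset, (fun x => ‖g x‖ₑ) ∂fun _ => volume) x < ⊤ := by
    have hu : (0 :: tailVars m).toFinset = Finset.univ := by
      rw [← finRange_eq, List.toFinset_finRange]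
    rw [hu, ← lintegral_eq_lmarginal_univ]
    exact hgi.2
  have key := hcore (tailMeas Nd ch)
    (fun i z => cfold (tailIdx i) (tailVars m) g (Function.update x 0 z))
    (measurable_cfold hg _ (measurable_tailIdx.comp measurable_fst)
      (measurable_update_comp 0 measurable_const measurable_snd))
    ((ae_tailIdx_reg ch).mono fun i hi =>
      integrable_cfold_update hg hi (nodup_cons_tailVars m) hlt)
  simp only [tensorSq, Function.update_idem, Function.update_self]
  rw [lintegral_const_mul' _ _ ENNReal.ofReal_ne_top]
  exact key

end Assembly

/-- **Lemma 2.1**: with `S̃_j` (`j ≥ 2`) an arbitrary fixed choice between the vectorized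
Lusin square function `𝐒_j^L` and the vectorized random dyadic square function `𝐒_j` in the
variable `x_j`, one has
`∫_X ‖(𝐒₁ ⊗ S̃₂ ⊗ ⋯ ⊗ S̃ₙ f)(x)‖ dx ≤ C ∫_X ‖(𝐒₁^L ⊗ S̃₂ ⊗ ⋯ ⊗ S̃ₙ f)(x)‖ dx`
for every `f ∈ L¹(X)` for which the right-hand side is finite, with `C` independent of `f`. -/
theorem lemma_2_1 (n : ℕ) (hn : 0 < n) (Nd : Fin n → ℕ) (hNd : ∀ j, 0 < Nd j)
    (ch : Fin n → Bool) :
    ∃ C : ℝ, 0 < C ∧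
      ∀ f : X n Nd → ℝ, Integrable f volume →
        tensorL1Norm n Nd (Function.update ch ⟨0, hn⟩ true) f < ⊤ →
        tensorL1Norm n Nd (Function.update ch ⟨0, hn⟩ false) f ≤
          ENNReal.ofReal C * tensorL1Norm n Nd (Function.update ch ⟨0, hn⟩ true) f := by
  obtain ⟨m, rfl⟩ : ∃ m, n = m + 1 := ⟨n - 1, by omega⟩
  obtain ⟨C, hC, hle⟩ := exists_lintegral_tensorSq_le (hNd 0) ch
  refine ⟨C, hC, fun f hf _ => ?_⟩
  have hfg := hf.aestronglyMeasurable.ae_eq_mk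
  have hg := hf.aestronglyMeasurable.stronglyMeasurable_mk.measurable
  have hgi := hf.congr hfg
  change tensorL1Norm (m + 1) Nd (Function.update ch 0 false) f ≤
    _ * tensorL1Norm (m + 1) Nd (Function.update ch 0 true) f
  rw [tensorL1Norm_eq hfg hg hgi, tensorL1Norm_eq hfg hg hgi]
  exact hle _ hg hgi

end Treil
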